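/- arXiv:2504.20284 — 4 statements merged into one kernel-verified Lean document; each statement's English description precedes it below -/
import Mathlib

section
/- Let K be an algebraically closed field, complete with respect to a nontrivial non-Archimedean absolute value |·|, whose valuation ring 𝒪_K = {x ∈ K : |x| ≤ 1} has residue field of characteristic 0. Let f ∈ K[z] be a polynomial of degree d ≥ 2 which does not have potential good reduction, i.e., there is no affine map h(z) = αz + β with α ∈ K^×, β ∈ K such that the conjugate h⁻¹ ∘ f ∘ h has all its coefficients in 𝒪_K and leading coefficient of absolute value 1. Then f admits a repelling periodic point of period at most 2: there exists z ∈ K with f(f(z)) = z and |f′(z)| · |f′(f(z))| > 1. -/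
open Polynomial

noncomputable section

/-- The affine conjugate `h⁻¹ ∘ f ∘ h` of the polynomial `f`, where `h(z) = α z + β`. -/
def affConj {K : Type*} [Field K] (f : Polynomial K) (α β : K) : Polynomial K :=
  C α⁻¹ * (f.comp (C α * X + C β) - C β)

lemma norm_eq_of_norm_sub_lt_right {K : Type*} [NormedField K] [IsUltrametricDist K] {x y : K}
    (h : ‖x - y‖ < ‖y‖) : ‖x‖ = ‖y‖ := by
  have := IsUltrametricDist.norm_add_eq_max_of_norm_ne_norm h.ne
  rwa [sub_add_cancel, max_eq_right h.le] at this

/-- The ultrametric inequality through an intermediate point. -/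
lemma norm_sub_le_max_norm_sub {K : Type*} [NormedField K] [IsUltrametricDist K] (x y z : K) :
    ‖x - z‖ ≤ max ‖x - y‖ ‖y - z‖ := by
  simpa using IsUltrametricDist.norm_add_le_max (x - y) (y - z)

lemma norm_sub_lt_of_norm_lt {K : Type*} [NormedField K] [IsUltrametricDist K] {x y : K} {r : ℝ}
    (hx : ‖x‖ < r) (hy : ‖y‖ < r) : ‖x - y‖ < r := by
  simpa using (norm_sub_le_max_norm_sub x 0 y).trans_lt (by simpa using ⟨hx, hy⟩)

lemma norm_coeff_mul_le_one {K : Type*} [NormedField K] [IsUltrametricDist K]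
    {P Q : Polynomial K} (hP : ∀ n, ‖P.coeff n‖ ≤ 1) (hQ : ∀ n, ‖Q.coeff n‖ ≤ 1) (n : ℕ) :
    ‖(P * Q).coeff n‖ ≤ 1 := by
  rw [coeff_mul]
  refine IsUltrametricDist.norm_sum_le_of_forall_le_of_nonneg zero_le_one fun x _ => ?_
  rw [norm_mul]
  exact mul_le_one₀ (hP _) (norm_nonneg _) (hQ _)

lemma norm_coeff_prod_X_sub_C_le_one {K ι : Type*} [NormedField K] [IsUltrametricDist K]
    (s : Finset ι) {c : ι → K} (hc : ∀ i, ‖c i‖ ≤ 1) (n : ℕ) :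
    ‖(∏ i ∈ s, (X - C (c i))).coeff n‖ ≤ 1 := by
  classical
  induction s using Finset.induction_on generalizing n with
  | empty =>
    rw [Finset.prod_empty, coeff_one]
    split_ifs <;> simp
  | insert i s hi ih =>
    rw [Finset.prod_insert hi]
    refine norm_coeff_mul_le_one (fun m => ?_) ih n
    rcases m with _ | m
    · simpa using hc i
    · rw [coeff_sub, coeff_C_succ, sub_zero, coeff_X]
      split_ifs <;> simp

/-- A relatively small perturbation of the factors is a relatively small perturbation of the
product. -/
lemma norm_prod_sub_prod_lt {K ι : Type*} [NormedField K] [IsUltrametricDist K]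
    (s : Finset ι) {x y : ι → K} (h : ∀ i, ‖x i - y i‖ < ‖y i‖) :
    ‖∏ i ∈ s, x i - ∏ i ∈ s, y i‖ < ‖∏ i ∈ s, y i‖ := by
  classical
  induction s using Finset.induction_on with
  | empty => simp
  | insert i s hi ih =>
    rw [Finset.prod_insert hi, Finset.prod_insert hi]
    have hpos : 0 < ‖∏ j ∈ s, y j‖ := (norm_nonneg _).trans_lt ih
    have hyi : 0 < ‖y i‖ := (norm_nonneg _).trans_lt (h i)
    have key : x i * ∏ j ∈ s, x j - y i * ∏ j ∈ s, y j =
        (x i - y i) * ∏ j ∈ s, x j + y i * (∏ j ∈ s, x j - ∏ j ∈ s, y j) := by ring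
    rw [key, norm_mul (y i)]
    refine (IsUltrametricDist.norm_add_le_max _ _).trans_lt (max_lt ?_ ?_)
    · rw [norm_mul, norm_eq_of_norm_sub_lt_right ih]
      exact mul_lt_mul_of_pos_right (h i) hpos
    · rw [norm_mul]
      exact mul_lt_mul_of_pos_left ih hyi

lemma Multiset.exists_eq_map_univ_fin {K : Type*} (m : Multiset K) {n : ℕ} (hn : m.card = n) :
    ∃ p : Fin n → K, m = (Finset.univ : Finset (Fin n)).val.map p := by
  obtain ⟨l, rfl⟩ : ∃ l : List K, (l : Multiset K) = m := ⟨m.toList, m.coe_toList⟩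
  rw [Multiset.coe_card] at hn
  subst hn
  exact ⟨l.get, by rw [Fin.univ_val_map, List.ofFn_get]⟩

lemma Polynomial.Splits.exists_eq_C_mul_prod {K : Type*} [Field K] {g : Polynomial K}
    (hg : g.Splits) :
    ∃ p : Fin g.natDegree → K, g.roots = (Finset.univ : Finset (Fin g.natDegree)).val.map p ∧
      g = C g.leadingCoeff * ∏ i, (X - C (p i)) := by
  obtain ⟨p, hp⟩ := g.roots.exists_eq_map_univ_fin hg.natDegree_eq_card_roots.symm
  refine ⟨p, hp, ?_⟩
  conv_lhs => rw [hg.eq_prod_roots, hp, Multiset.map_map]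
  rfl

/-- If a split polynomial has no root in the open disc of radius `r` around `c`, then on the
closed disc its absolute value is at most its value at the centre. -/
lemma norm_eval_le_of_forall_root {K : Type*} [NormedField K] [IsUltrametricDist K]
    {g : Polynomial K} (hg : g.Splits) {c : K} {r : ℝ}
    (h : ∀ ζ ∈ g.roots, r ≤ ‖ζ - c‖) {x : K} (hx : ‖x - c‖ ≤ r) :
    ‖g.eval x‖ ≤ ‖g.eval c‖ := by
  obtain ⟨p, hp, hgp⟩ := hg.exists_eq_C_mul_prod
  rw [hgp]
  simp only [eval_mul, eval_C, eval_prod, eval_sub, eval_X, norm_mul, norm_prod]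
  gcongr with i
  refine (norm_sub_le_max_norm_sub x c (p i)).trans (max_le (hx.trans ?_) le_rfl)
  rw [norm_sub_rev]
  exact h _ (hp ▸ Multiset.mem_map_of_mem p (Finset.mem_univ i))

/-- Quantitative Newton estimate: a split polynomial has a root within `‖g z‖ / ‖g' z‖` of `z`. -/
lemma exists_root_norm_mul_le {K : Type*} [NormedField K] [IsUltrametricDist K]
    {g : Polynomial K} (hg : g.Splits) {z : K} (hd : (derivative g).eval z ≠ 0) :
    ∃ ζ, g.eval ζ = 0 ∧ ‖z - ζ‖ * ‖(derivative g).eval z‖ ≤ ‖g.eval z‖ := by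
  by_cases hz : g.eval z = 0
  · exact ⟨z, hz, by simp⟩
  by_contra! hcon
  have hgpos : 0 < ‖g.eval z‖ := norm_pos_iff.2 hz
  have hdpos := norm_pos_iff.2 hd
  have hlog := hg.eval_derivative_div_eval_of_ne_zero hz
  have hne : g ≠ 0 := by rintro rfl; simp at hz
  obtain ⟨p, hp, -⟩ := hg.exists_eq_C_mul_prod
  have hsum : ∑ i, 1 / (z - p i) = (derivative g).eval z / g.eval z := by
    rw [hlog, hp, Multiset.map_map]
    rfl
  have hnonempty : (Finset.univ : Finset (Fin g.natDegree)).Nonempty := by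
    by_contra hemp
    rw [Finset.not_nonempty_iff_eq_empty.1 hemp, Finset.sum_empty] at hsum
    exact div_ne_zero hd hz hsum.symm
  obtain ⟨i, -, hi⟩ := IsUltrametricDist.exists_norm_finsetSum_le_of_nonempty
    hnonempty (fun i => 1 / (z - p i))
  rw [hsum, norm_div, norm_div, norm_one] at hi
  have hroot : g.eval (p i) = 0 :=
    (mem_roots hne).1 (hp ▸ Multiset.mem_map_of_mem p (Finset.mem_univ i))
  have hpos : 0 < ‖z - p i‖ :=
    norm_pos_iff.2 (sub_ne_zero.2 fun h => hz (by rw [h, hroot]))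
  have := hcon (p i) hroot
  rw [div_le_div_iff₀ hgpos hpos] at hi
  linarith

section FixedPoints

variable {K ι : Type*} [NormedField K] [Fintype ι]

/-- For `f = X + a ∏ (X - p i)`, the maximum of `‖f z - z‖` over the closed disc of radius `s`
around `c`. -/
def displacement (a : K) (p : ι → K) (c : K) (s : ℝ) : ℝ := ‖a‖ * ∏ i, max s ‖c - p i‖

lemma displacement_mono (a : K) (p : ι → K) (c : K) {s t : ℝ} (h : s ≤ t) :
    displacement a p c s ≤ displacement a p c t := by
  unfold displacement
  gcongr with i

variable {f : Polynomial K} {a : K} {p : ι → K}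

lemma eval_derivative_sub_one (hf : f = X + C a * ∏ i, (X - C (p i))) {z : K}
    (hz : f.eval z ≠ z) :
    (derivative f).eval z - 1 = (f.eval z - z) * ∑ i, (z - p i)⁻¹ := by
  classical
  have h1 : f.eval z - z = a * ∏ i, (z - p i) := by simp [hf, eval_prod]
  have h2 : ∀ i, z - p i ≠ 0 := fun i hi => hz <| by
    rw [← sub_eq_zero, h1, Finset.prod_eq_zero (Finset.mem_univ i) hi, mul_zero]
  rw [h1, hf]
  simp only [derivative_add, derivative_X, derivative_X_sub_C, derivative_mul, derivative_C, zero_mul, zero_add,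
    derivative_prod_finset, eval_add, eval_one, eval_mul, eval_C, eval_finsetSum, eval_prod, eval_sub,
    eval_X, mul_one, add_sub_cancel_left, mul_assoc, Finset.mul_sum]
  refine Finset.sum_congr rfl fun i _ => ?_
  rw [← Finset.prod_erase_mul Finset.univ (fun j => z - p j) (Finset.mem_univ i), mul_assoc, mul_inv_cancel₀ (h2 i), mul_one]

variable [IsUltrametricDist K]

lemma norm_mul_prod_le_displacement (a : K) (p : ι → K) (c z : K) :
    ‖a * ∏ i, (z - p i)‖ ≤ displacement a p c ‖z - c‖ := by
  rw [norm_mul, norm_prod, displacement]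
  gcongr with i
  exact norm_sub_le_max_norm_sub _ _ _

lemma displacement_congr_center (a : K) (p : ι → K) {c c' : K} {s : ℝ} (h : ‖c - c'‖ ≤ s) :
    displacement a p c s = displacement a p c' s := by
  unfold displacement
  congr 1
  refine Finset.prod_congr rfl fun i _ => le_antisymm ?_ ?_
  · refine max_le (le_max_left _ _) ((norm_sub_le_max_norm_sub c c' (p i)).trans ?_)
    exact max_le_max_right _ h
  · refine max_le (le_max_left _ _) ((norm_sub_le_max_norm_sub c' c (p i)).trans ?_)
    rw [norm_sub_rev]
    exact max_le_max_right _ h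

/-- A point moved farther than the cluster of fixed points around `c` is outside that cluster. -/
lemma norm_sub_lt_of_lt_norm_eval_sub (hf : f = X + C a * ∏ i, (X - C (p i))) {c z : K} {r : ℝ}
    (hc : f.eval c = c)
    (hmin : ∀ j, p j ≠ c → ‖p j - c‖ < r → displacement a p c ‖p j - c‖ ≤ ‖p j - c‖)
    (hz : ‖f.eval z - z‖ = r) {j : ι} (hj : ‖p j - c‖ < r) : ‖p j - c‖ < ‖z - c‖ := by
  have hr : 0 < r := (norm_nonneg _).trans_lt hj
  by_cases hjc : p j = c
  · rw [hjc, sub_self, norm_zero, norm_pos_iff, sub_ne_zero]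
    rintro rfl
    rw [hc, sub_self, norm_zero] at hz
    exact hr.ne hz
  · by_contra! hle
    have h1 : f.eval z - z = a * ∏ i, (z - p i) := by simp [hf, eval_prod]
    have := norm_mul_prod_le_displacement a p c z
    rw [← h1, hz] at this
    linarith [displacement_mono a p c hle, hmin j hjc hj]

/-- In residue characteristic zero, just outside a cluster of points around `c` the sum of the
inverses is dominated by the cluster. -/
lemma norm_sum_inv_eq (hres : ∀ n : ℕ, n ≠ 0 → ‖(n : K)‖ = 1) {c z : K} {r : ℝ}
    (hzr : ‖z - c‖ < r) (hc : ∃ i, p i = c)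
    (hcl : ∀ j, ‖p j - c‖ < r → ‖p j - c‖ < ‖z - c‖) :
    ‖∑ i, (z - p i)⁻¹‖ = ‖z - c‖⁻¹ := by
  classical
  obtain ⟨i₀, hi₀⟩ := hc
  have hr : 0 < r := (norm_nonneg _).trans_lt hzr
  have ht : 0 < ‖z - c‖ := by simpa [hi₀, hr] using hcl i₀
  have hzc : z - c ≠ 0 := norm_pos_iff.1 ht
  set s := Finset.univ.filter fun i => ‖p i - c‖ < r with hs
  have hcard : s.card ≠ 0 :=
    Finset.card_ne_zero_of_mem (a := i₀) (by simp [hs, hi₀, hr])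
  have hmain : ‖(s.card : K) * (z - c)⁻¹‖ = ‖z - c‖⁻¹ := by
    rw [norm_mul, hres _ hcard, one_mul, norm_inv]
  have hsum : (s.card : K) * (z - c)⁻¹ = ∑ i, if i ∈ s then (z - c)⁻¹ else 0 := by
    simp
  rw [← hmain]
  refine norm_eq_of_norm_sub_lt_right ?_
  rw [hmain, hsum, ← Finset.sum_sub_distrib]
  obtain ⟨i, -, hi⟩ := IsUltrametricDist.exists_norm_finsetSum_le_of_nonempty
    (⟨i₀, Finset.mem_univ _⟩ : (Finset.univ : Finset ι).Nonempty)
    (fun i => (z - p i)⁻¹ - if i ∈ s then (z - c)⁻¹ else 0)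
  refine hi.trans_lt ?_
  by_cases hmem : i ∈ s
  · have hlt : ‖p i - c‖ < ‖z - c‖ := hcl i (by simpa [hs] using hmem)
    have hzi : ‖z - p i‖ = ‖z - c‖ := norm_eq_of_norm_sub_lt_right (by
      rwa [sub_sub_sub_cancel_left, norm_sub_rev])
    have hne : z - p i ≠ 0 := norm_pos_iff.1 (hzi ▸ ht)
    rw [if_pos hmem, inv_sub_inv hne hzc, sub_sub_sub_cancel_left, norm_div, norm_mul, hzi,
      inv_eq_one_div, div_lt_div_iff₀ (mul_pos ht ht) ht, one_mul]
    exact mul_lt_mul_of_pos_right hlt ht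
  · have hge : r ≤ ‖p i - c‖ := by simpa [hs] using hmem
    have hzi : ‖z - p i‖ = ‖p i - c‖ := by
      rw [norm_sub_rev]
      refine norm_eq_of_norm_sub_lt_right ?_
      rw [sub_sub_sub_cancel_left, norm_sub_rev]
      exact hzr.trans_le hge
    rw [if_neg hmem, sub_zero, norm_inv, hzi]
    exact inv_strictAnti₀ ht (hzr.trans_le hge)

/-- Near the fixed point `c`, a point moved to a distance `r` larger than that to `c` is strictly
expanding. -/
lemma norm_eval_derivative_eq (hres : ∀ n : ℕ, n ≠ 0 → ‖(n : K)‖ = 1)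
    (hf : f = X + C a * ∏ i, (X - C (p i))) {c z : K} {r : ℝ}
    (hc : ∃ i, p i = c)
    (hmin : ∀ j, p j ≠ c → ‖p j - c‖ < r → displacement a p c ‖p j - c‖ ≤ ‖p j - c‖)
    (hzr : ‖z - c‖ < r) (hz : ‖f.eval z - z‖ = r) :
    0 < ‖z - c‖ ∧ ‖(derivative f).eval z‖ = r / ‖z - c‖ := by
  obtain ⟨i₀, hi₀⟩ := id hc
  have hr : 0 < r := (norm_nonneg _).trans_lt hzr
  have hfc : f.eval c = c := by
    have : ∏ i, (c - p i) = 0 := Finset.prod_eq_zero (Finset.mem_univ i₀) (by rw [hi₀, sub_self])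
    simp [hf, eval_prod, this]
  have hcl : ∀ j, ‖p j - c‖ < r → ‖p j - c‖ < ‖z - c‖ := fun j hj =>
    norm_sub_lt_of_lt_norm_eval_sub hf hfc hmin hz hj
  have ht : 0 < ‖z - c‖ := by simpa [hi₀, hr] using hcl i₀
  have hfz : f.eval z ≠ z := by
    rw [← sub_ne_zero, ← norm_pos_iff, hz]
    exact hr
  have h1 : ‖(derivative f).eval z - 1‖ = r / ‖z - c‖ := by
    rw [eval_derivative_sub_one hf hfz, norm_mul, hz, norm_sum_inv_eq hres hzr hc hcl,
      div_eq_mul_inv]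
  refine ⟨ht, ?_⟩
  have hlt : 1 < ‖(derivative f).eval z - 1‖ := h1 ▸ (one_lt_div ht).2 hzr
  rw [← h1]
  exact norm_eq_of_norm_sub_lt_right (by rwa [sub_sub_cancel, norm_one])

/-- A closed disc around a fixed point on which `f` is expanding is covered by the image of the
corresponding open disc. -/
lemma exists_eval_eq_of_lt_displacement [IsAlgClosed K]
    (hres : ∀ n : ℕ, n ≠ 0 → ‖(n : K)‖ = 1)
    (hf : f = X + C a * ∏ i, (X - C (p i))) {c e w : K} (hc : f.eval c = c)
    (hexp : ‖e - c‖ < displacement a p c ‖e - c‖) (hw : ‖w - c‖ ≤ ‖e - c‖) :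
    ∃ z, f.eval z = w ∧ ‖z - c‖ < ‖e - c‖ := by
  by_contra! hcon
  have hbound : ∀ x : K, ‖x - c‖ ≤ ‖e - c‖ → ‖f.eval x - x‖ ≤ ‖e - c‖ := by
    intro x hx
    have h1 : ‖(f - C w).eval x‖ ≤ ‖(f - C w).eval c‖ := by
      refine norm_eval_le_of_forall_root (IsAlgClosed.splits _) (fun ζ hζ => ?_) hx
      refine hcon ζ ?_
      simpa [sub_eq_zero] using isRoot_of_mem_roots hζ
    rw [eval_sub, eval_sub, eval_C, eval_C, hc, norm_sub_rev c w] at h1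
    refine (norm_sub_le_max_norm_sub _ w _).trans (max_le (h1.trans hw) ?_)
    refine (norm_sub_le_max_norm_sub _ c _).trans (max_le hw ?_)
    rwa [norm_sub_rev]
  have hnat : ∀ n : ℕ, ‖(n : K)‖ ≤ 1 := fun n => by
    rcases eq_or_ne n 0 with rfl | hn
    · simp
    · exact (hres n hn).le
  have hx : ∀ n : ℕ, ‖c + n * (e - c) - c‖ ≤ ‖e - c‖ := fun n => by
    rw [add_sub_cancel_left, norm_mul]
    exact mul_le_of_le_one_left (norm_nonneg _) (hnat n)
  have hclose : ∀ n : ℕ, ∃ i, ‖c + n * (e - c) - p i‖ < ‖e - c‖ := by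
    intro n
    by_contra! hfar
    have h1 := hbound _ (hx n)
    have h2 : displacement a p c ‖e - c‖ ≤ ‖f.eval (c + n * (e - c)) - (c + n * (e - c))‖ := by
      have : f.eval (c + n * (e - c)) - (c + n * (e - c)) =
          a * ∏ i, (c + n * (e - c) - p i) := by simp [hf, eval_prod]
      rw [this, norm_mul, norm_prod, displacement]
      gcongr with i
      refine max_le (hfar i) ((norm_sub_le_max_norm_sub c _ _).trans (max_le ?_ le_rfl))
      rw [norm_sub_rev]
      exact (hx n).trans (hfar i)
    exact absurd hexp (h2.trans h1).not_gt
  choose φ hφ using hclose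
  obtain ⟨m, n, hmn, hφmn⟩ := Finite.exists_ne_map_eq_of_infinite φ
  wlog hlt : m < n generalizing m n
  · exact this n m hmn.symm hφmn.symm (lt_of_le_of_ne (not_lt.1 hlt) hmn.symm)
  have h1 := hφ m
  rw [hφmn, norm_sub_rev] at h1
  have h2 := (norm_sub_le_max_norm_sub _ (p (φ n)) _).trans_lt (max_lt (hφ n) h1)
  have h3 : c + (n : K) * (e - c) - (c + m * (e - c)) = ((n - m : ℕ) : K) * (e - c) := by
    rw [Nat.cast_sub hlt.le]; ring
  rw [h3, norm_mul, hres _ (Nat.sub_ne_zero_of_lt hlt), one_mul] at h2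
  exact h2.false

/-- Two fixed points whose distance is minimal among the radii of expanding discs give a repelling
orbit of period two alternating between their neighbourhoods. -/
lemma exists_repelling_of_minimal [IsAlgClosed K] (hres : ∀ n : ℕ, n ≠ 0 → ‖(n : K)‖ = 1)
    (hf : f = X + C a * ∏ i, (X - C (p i))) {i₁ i₂ : ι} (hne : p i₁ ≠ p i₂)
    (hexp : ‖p i₁ - p i₂‖ < displacement a p (p i₁) ‖p i₁ - p i₂‖)
    (hmin : ∀ i j, p i ≠ p j → ‖p i - p j‖ < ‖p i₁ - p i₂‖ →
      displacement a p (p i) ‖p i - p j‖ ≤ ‖p i - p j‖) :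
    ∃ z : K, f.eval (f.eval z) = z ∧
      1 < ‖(derivative f).eval z‖ * ‖(derivative f).eval (f.eval z)‖ := by
  set r := ‖p i₁ - p i₂‖ with hr
  have hr0 : 0 < r := norm_pos_iff.2 (sub_ne_zero.2 hne)
  have hr' : ‖p i₂ - p i₁‖ = r := norm_sub_rev _ _
  have hfix : ∀ i, f.eval (p i) = p i := fun i => by
    have : ∏ j, (p i - p j) = 0 := Finset.prod_eq_zero (Finset.mem_univ i) (sub_self _)
    simp [hf, eval_prod, this]
  have hmin' : ∀ i j, p j ≠ p i → ‖p j - p i‖ < r →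
      displacement a p (p i) ‖p j - p i‖ ≤ ‖p j - p i‖ := fun i j hij hlt => by
    rw [norm_sub_rev] at hlt ⊢
    exact hmin i j hij.symm hlt
  have hmove : ∀ i j, ‖p i - p j‖ = r → ∀ z, ‖z - p i‖ < r → ‖f.eval z - p j‖ < r →
      ‖f.eval z - z‖ = r := fun i j hij z hz hfz => by
    rw [← norm_sub_rev z, ← hij]
    refine norm_eq_of_norm_sub_lt_right ?_
    rw [hij, show z - f.eval z - (p i - p j) = (z - p i) - (f.eval z - p j) by ring]
    exact norm_sub_lt_of_norm_lt hz hfz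
  have hder : ∀ i j, ‖p i - p j‖ = r → ∀ z, ‖z - p i‖ < r → ‖f.eval z - p j‖ < r →
      0 < ‖z - p i‖ ∧ ‖(derivative f).eval z‖ = r / ‖z - p i‖ := fun i j hij z hz hfz =>
    norm_eval_derivative_eq hres hf ⟨i, rfl⟩ (hmin' i) hz (hmove i j hij z hz hfz)
  obtain ⟨w, hw, hw2⟩ : ∃ w, f.eval w = p i₁ ∧ ‖w - p i₂‖ < r := by
    refine exists_eval_eq_of_lt_displacement hres hf (hfix i₂) ?_ le_rfl
    rwa [← displacement_congr_center a p (le_refl ‖p i₁ - p i₂‖)]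
  obtain ⟨z, hz, hz1⟩ : ∃ z, f.eval z = w ∧ ‖z - p i₁‖ < r := by
    rw [← hr']
    refine exists_eval_eq_of_lt_displacement hres hf (hfix i₁) (by rwa [hr']) ?_
    rw [hr']
    refine (norm_sub_le_max_norm_sub w (p i₂) _).trans (max_le hw2.le hr'.le)
  have hfz : ‖f.eval z - p i₂‖ < r := by rwa [hz]
  have hzr : ‖f.eval z - z‖ = r := hmove i₁ i₂ rfl z hz1 hfz
  obtain ⟨ht, hdz⟩ := hder i₁ i₂ rfl z hz1 hfz
  obtain ⟨hu, hdw⟩ := hder i₂ i₁ hr' w hw2 (by rw [hw, sub_self, norm_zero]; exact hr0)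
  set t := ‖z - p i₁‖ with ht'
  set u := ‖w - p i₂‖ with hu'
  have hrt : 1 < r / t := (one_lt_div ht).2 hz1
  have hru : 1 < r / u := (one_lt_div hu).2 hw2
  have hmul : 1 < r / u * (r / t) := one_lt_mul_of_lt_of_le hru hrt.le
  set G := f.comp f - X with hG
  have hGd : ‖(derivative G).eval z‖ = r / u * (r / t) := by
    have h : (derivative G).eval z - (derivative f).eval z * (derivative f).eval w = -1 := by
      simp [hG, derivative_comp, hz]
    have h2 : ‖(derivative f).eval z * (derivative f).eval w‖ = r / u * (r / t) := by
      rw [norm_mul, hdz, hdw, mul_comm]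
    rw [← h2]
    refine norm_eq_of_norm_sub_lt_right ?_
    rwa [h, h2, norm_neg, norm_one]
  have hGz : ‖G.eval z‖ = t := by
    simp [hG, hz, hw, ht', norm_sub_rev]
  obtain ⟨ζ, hζ, hζz⟩ := exists_root_norm_mul_le (IsAlgClosed.splits G) (z := z) (by
    rw [← norm_pos_iff, hGd]; linarith)
  rw [hGd, hGz] at hζz
  have hζt : ‖z - ζ‖ < t := by
    by_contra! hle
    have : t * (r / u * (r / t)) ≤ t := (mul_le_mul_of_nonneg_right hle (by linarith)).trans hζz
    nlinarith
  have hζp : f.eval (f.eval ζ) = ζ := by simpa [hG, sub_eq_zero] using hζ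
  have hζ1 : ‖ζ - p i₁‖ < r := by
    refine (norm_sub_le_max_norm_sub _ z _).trans_lt (max_lt ?_ hz1)
    rw [norm_sub_rev]
    exact hζt.trans hz1
  have htle : ∀ i, t ≤ ‖z - p i‖ := by
    intro i
    by_contra! hlt
    have h1 : ‖p i - p i₁‖ < r := by
      refine (norm_sub_le_max_norm_sub _ z _).trans_lt (max_lt ?_ hz1)
      rw [norm_sub_rev]
      exact hlt.trans hz1
    have h2 := norm_sub_lt_of_lt_norm_eval_sub hf (hfix i₁) (hmin' i₁) hzr h1
    exact ((norm_sub_le_max_norm_sub z (p i) (p i₁)).trans_lt (max_lt hlt h2)).false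
  have hpert : ‖(f.eval ζ - ζ) - (f.eval z - z)‖ < r := by
    have h1 : ∀ x, f.eval x - x = a * ∏ i, (x - p i) := fun x => by simp [hf, eval_prod]
    have h2 := norm_prod_sub_prod_lt Finset.univ (x := fun i => ζ - p i) (y := fun i => z - p i)
      (fun i => by
        rw [sub_sub_sub_cancel_right, norm_sub_rev]
        exact hζt.trans_le (htle i))
    have ha : 0 < ‖a‖ := by
      rw [h1, norm_mul] at hzr
      exact pos_of_mul_pos_left (hzr ▸ hr0) (norm_nonneg _)
    rw [← hzr, h1, h1, ← mul_sub, norm_mul, norm_mul]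
    exact mul_lt_mul_of_pos_left h2 ha
  have hfζ : ‖f.eval ζ - p i₂‖ < r := by
    rw [show f.eval ζ - p i₂ = ((f.eval ζ - ζ) - (f.eval z - z)) + ((f.eval z - p i₂) - (z - ζ)) by
      ring]
    refine (IsUltrametricDist.norm_add_le_max _ _).trans_lt (max_lt hpert ?_)
    exact norm_sub_lt_of_norm_lt hfz (hζt.trans hz1)
  obtain ⟨hpos1, hd1⟩ := hder i₁ i₂ rfl ζ hζ1 hfζ
  obtain ⟨hpos2, hd2⟩ := hder i₂ i₁ hr' (f.eval ζ) hfζ (by rwa [hζp])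
  refine ⟨ζ, hζp, ?_⟩
  rw [hd1, hd2]
  exact one_lt_mul_of_lt_of_le ((one_lt_div hpos1).2 hζ1) ((one_lt_div hpos2).2 hfζ).le

/-- If no disc spanned by two fixed points is expanding, then `f` has potential good reduction. -/
lemma exists_affConj_good_reduction [IsAlgClosed K] [Nonempty ι]
    (hf : f = X + C a * ∏ i, (X - C (p i))) (ha : a ≠ 0) (hd : 2 ≤ Fintype.card ι)
    (h : ∀ i j, p i ≠ p j → displacement a p (p i) ‖p i - p j‖ ≤ ‖p i - p j‖) :
    ∃ α β : K, α ≠ 0 ∧ (∀ n : ℕ, ‖(affConj f α β).coeff n‖ ≤ 1) ∧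
      ‖(affConj f α β).coeff (Fintype.card ι)‖ = 1 := by
  set d := Fintype.card ι with hdcard
  obtain ⟨i₀⟩ := ‹Nonempty ι›
  have hd1 : d - 1 + 1 = d := by omega
  obtain ⟨α, hα⟩ := IsAlgClosed.exists_pow_nat_eq a⁻¹ (show 0 < d - 1 by omega)
  have hα0 : α ≠ 0 := by
    rintro rfl
    rw [zero_pow (by omega)] at hα
    exact inv_ne_zero ha hα.symm
  obtain ⟨j, -, hj⟩ := Finset.exists_max_image Finset.univ (fun i => ‖p i₀ - p i‖)
    ⟨i₀, Finset.mem_univ _⟩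
  have hle : ∀ i, ‖p i₀ - p i‖ ≤ ‖α‖ := by
    intro i
    refine (hj i (Finset.mem_univ _)).trans ?_
    by_cases hij : p i₀ = p j
    · simp [hij]
    set R := ‖p i₀ - p j‖ with hR
    have hR0 : 0 < R := norm_pos_iff.2 (sub_ne_zero.2 hij)
    have h1 := h i₀ j hij
    rw [← hR, displacement, Finset.prod_congr rfl fun i _ => max_eq_left (hj i (Finset.mem_univ i)),
      Finset.prod_const, Finset.card_univ, ← hdcard, ← hd1, pow_succ, ← mul_assoc] at h1
    have h2 : ‖a‖ * R ^ (d - 1) ≤ 1 := by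
      by_contra! hlt
      nlinarith
    have h3 : ‖α‖ ^ (d - 1) = ‖a‖⁻¹ := by rw [← norm_pow, hα, norm_inv]
    refine le_of_pow_le_pow_left₀ (n := d - 1) (by omega) (norm_nonneg _) ?_
    rw [h3, ← one_div, le_div_iff₀ (norm_pos_iff.2 ha), mul_comm]
    exact h2
  have hconj : affConj f α (p i₀) = X + ∏ i, (X - C (α⁻¹ * (p i - p i₀))) := by
    have hfac : ∀ i, C α * X + C (p i₀) - C (p i) = C α * (X - C (α⁻¹ * (p i - p i₀))) := by
      intro i
      rw [mul_sub, ← C_mul, mul_inv_cancel_left₀ hα0, C_sub]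
      ring
    have hprod : (∏ i, (X - C (p i))).comp (C α * X + C (p i₀)) =
        C α ^ d * ∏ i, (X - C (α⁻¹ * (p i - p i₀))) := by
      rw [prod_comp]
      simp only [sub_comp, X_comp, C_comp, hfac, Finset.prod_mul_distrib, Finset.prod_const,
        Finset.card_univ, hdcard]
    have hc1 : C α⁻¹ * C α = (1 : Polynomial K) := by rw [← C_mul, inv_mul_cancel₀ hα0, C_1]
    have hc2 : C a * C α ^ (d - 1) = (1 : Polynomial K) := by
      rw [← C_pow, ← C_mul, hα, mul_inv_cancel₀ ha, C_1]
    rw [affConj, hf, add_comp, mul_comp, hprod, X_comp, C_comp, ← hd1, pow_succ]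
    set Q := ∏ i, (X - C (α⁻¹ * (p i - p i₀)))
    linear_combination (X + C a * C α ^ (d - 1) * Q) * hc1 + Q * hc2
  have hint : ∀ i, ‖α⁻¹ * (p i - p i₀)‖ ≤ 1 := fun i => by
    rw [norm_mul, norm_inv, norm_sub_rev, inv_mul_le_one₀ (norm_pos_iff.2 hα0)]
    exact hle i
  refine ⟨α, p i₀, hα0, fun n => ?_, ?_⟩
  · rw [hconj, coeff_add]
    refine (IsUltrametricDist.norm_add_le_max _ _).trans
      (max_le ?_ (norm_coeff_prod_X_sub_C_le_one _ hint n))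
    rw [coeff_X]
    split_ifs <;> simp
  · have hmonic : (∏ i, (X - C (α⁻¹ * (p i - p i₀)))).Monic := monic_prod_X_sub_C _ _
    have hdeg : (∏ i, (X - C (α⁻¹ * (p i - p i₀)))).natDegree = d := by
      rw [natDegree_prod_of_monic _ _ fun i _ => monic_X_sub_C _]
      simp [hdcard, -map_mul, -map_sub]
    have : (∏ i, (X - C (α⁻¹ * (p i - p i₀)))).coeff d = 1 := by
      conv_lhs => rw [← hdeg]
      exact hmonic
    rw [hconj, coeff_add, this, coeff_X_of_ne_one (by omega), zero_add, norm_one]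

end FixedPoints

/-- **Existence of a repelling cycle of period ≤ 2 for polynomials without potential good
reduction.**  Let `K` be an algebraically closed field, complete with respect to a nontrivial
non-Archimedean absolute value, with residue field of characteristic `0` (encoded by
`‖n‖ = 1` for every nonzero natural number `n`).  If a polynomial `f` over `K` of degree
`d ≥ 2` is not affinely conjugate to a polynomial with coefficients in the valuation ring and
leading coefficient of absolute value `1`, then `f` has a repelling periodic point of period
at most `2`. -/
theorem stmt5 {K : Type*} [NontriviallyNormedField K] [CompleteSpace K] [IsAlgClosed K]
    (hna : IsNonarchimedean (fun x : K => ‖x‖))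
    (hmul : ∀ x y : K, ‖x * y‖ = ‖x‖ * ‖y‖)
    (hres : ∀ n : ℕ, n ≠ 0 → ‖(n : K)‖ = 1)
    (f : Polynomial K) (d : ℕ) (hd : 2 ≤ d) (hdeg : f.natDegree = d)
    (hpgr : ¬ ∃ α β : K, α ≠ 0 ∧
      (∀ i : ℕ, ‖(affConj f α β).coeff i‖ ≤ 1) ∧ ‖(affConj f α β).coeff d‖ = 1) :
    ∃ z : K, f.eval (f.eval z) = z ∧
      1 < ‖(derivative f).eval z‖ * ‖(derivative f).eval (f.eval z)‖ := by
  classical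
  have : IsUltrametricDist K := IsUltrametricDist.isUltrametricDist_of_isNonarchimedean_norm hna
  set g := f - X with hg
  have hgdeg : g.natDegree = d := by
    rw [hg, natDegree_sub_eq_left_of_natDegree_lt (by rw [natDegree_X]; omega), hdeg]
  have hg0 : g ≠ 0 := by
    intro h0
    rw [h0, natDegree_zero] at hgdeg
    omega
  have hsplit : g.Splits := IsAlgClosed.splits g
  obtain ⟨p, -, hgp⟩ := hsplit.exists_eq_C_mul_prod
  have hf : f = X + C g.leadingCoeff * ∏ i, (X - C (p i)) := by
    rw [← hgp, hg]
    ring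
  have hcard : Fintype.card (Fin g.natDegree) = d := by rw [Fintype.card_fin, hgdeg]
  set s := Finset.univ.filter fun x : Fin g.natDegree × Fin g.natDegree => p x.1 ≠ p x.2 ∧
    ‖p x.1 - p x.2‖ < displacement g.leadingCoeff p (p x.1) ‖p x.1 - p x.2‖
  by_cases hne : s.Nonempty
  · obtain ⟨x, hx, hmin⟩ := s.exists_min_image (fun x => ‖p x.1 - p x.2‖) hne
    obtain ⟨hx1, hx2⟩ := (Finset.mem_filter.1 hx).2
    refine exists_repelling_of_minimal hres hf hx1 hx2 fun i j hij hlt => ?_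
    by_contra! hcon
    exact (hmin (i, j) (Finset.mem_filter.2 ⟨Finset.mem_univ _, hij, hcon⟩)).not_gt hlt
  · have : Nonempty (Fin g.natDegree) := Fintype.card_pos_iff.1 (by omega)
    refine absurd ?_ hpgr
    rw [← hcard]
    refine exists_affConj_good_reduction hf (leadingCoeff_ne_zero.2 hg0) (by omega)
      fun i j hij => ?_
    by_contra! hcon
    exact hne ⟨(i, j), Finset.mem_filter.2 ⟨Finset.mem_univ _, hij, hcon⟩⟩
end
end

section
/- Let K be an algebraically closed field, complete with respect to a nontrivial non-Archimedean absolute value |·|, whose valuation ring 𝒪_K = {x ∈ K : |x| ≤ 1} has residue field of characteristic 0. Let f ∈ K[z] be a polynomial of degree d ∈ {2, 3} which does not have potential good reduction, i.e., there is no affine map h(z) = αz + β with α ∈ K^×, β ∈ K such that the conjugate h⁻¹ ∘ f ∘ h has all its coefficients in 𝒪_K and leading coefficient of absolute value 1. Then f admits a repelling fixed point: there exists z ∈ K with f(z) = z and |f′(z)| > 1. -/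
open Polynomial

noncomputable section

/-- In a non-Archimedean normed field, the closed unit ball is closed under addition. -/
theorem IsNonarchimedean.norm_add_le_one {K : Type*} [NormedField K]
    (hna : IsNonarchimedean (fun x : K => ‖x‖)) {x y : K} (hx : ‖x‖ ≤ 1) (hy : ‖y‖ ≤ 1) :
    ‖x + y‖ ≤ 1 :=
  (hna x y).trans (max_le hx hy)

/-- In a non-Archimedean normed field, if `1 + x` lies in the closed unit ball, so does `x`. -/
theorem IsNonarchimedean.norm_le_one_of_norm_one_add_le_one {K : Type*} [NormedField K]
    (hna : IsNonarchimedean (fun x : K => ‖x‖)) {x : K} (hx : ‖1 + x‖ ≤ 1) : ‖x‖ ≤ 1 := by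
  simpa using hna.norm_add_le_one (x := -1) (by simp) hx

/-- A polynomial of degree at least two over an algebraically closed field factors as the
identity plus a constant times a product of linear factors at its fixed points. -/
theorem Polynomial.exists_eq_X_add_C_mul_prod {K : Type*} [Field K] [IsAlgClosed K]
    (f : K[X]) (hf : 2 ≤ f.natDegree) :
    ∃ (a : K) (s : Multiset K), a ≠ 0 ∧ s.card = f.natDegree ∧
      f = X + C a * (s.map fun r => X - C r).prod := by
  have hdeg : (f - X).natDegree = f.natDegree :=
    natDegree_sub_eq_left_of_natDegree_lt (by rw [natDegree_X]; omega)
  have hsplit := IsAlgClosed.splits (f - X)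
  refine ⟨(f - X).leadingCoeff, (f - X).roots, ?_, ?_, ?_⟩
  · rw [leadingCoeff_ne_zero]
    rintro h
    rw [h, natDegree_zero] at hdeg
    omega
  · rw [← hdeg, hsplit.natDegree_eq_card_roots]
  · rw [← hsplit.eq_prod_roots]
    ring

theorem affConj_quadratic {K : Type*} [Field K] {a α : K} (hα : α ≠ 0) (ha : a * α = 1)
    (p u : K) :
    affConj (X + C a * ((X - C p) * (X - C (p + α * u)))) α p = X ^ 2 + C (1 - u) * X := by
  have h1 : (C α⁻¹ * C α : K[X]) = 1 := by rw [← C_mul, inv_mul_cancel₀ hα, C_1]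
  have h2 : (C a * C α : K[X]) = 1 := by rw [← C_mul, ha, C_1]
  simp only [affConj, add_comp, mul_comp, sub_comp, X_comp, C_comp, C_add, C_mul, C_sub, C_1]
  linear_combination (X + C a * C α * X * (X - C u)) * h1 + X * (X - C u) * h2

theorem affConj_cubic {K : Type*} [Field K] {a α : K} (hα : α ≠ 0) (ha : a * α ^ 2 = 1)
    (p u v : K) :
    affConj (X + C a * ((X - C p) * ((X - C (p + α * u)) * (X - C (p + α * v))))) α p =
      X ^ 3 + C (-(u + v)) * X ^ 2 + C (1 + u * v) * X := by
  have h1 : (C α⁻¹ * C α : K[X]) = 1 := by rw [← C_mul, inv_mul_cancel₀ hα, C_1]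
  have h2 : (C a * C α ^ 2 : K[X]) = 1 := by rw [← C_pow, ← C_mul, ha, C_1]
  simp only [affConj, add_comp, mul_comp, sub_comp, X_comp, C_comp, C_add, C_mul, C_neg, C_1]
  linear_combination (X + C a * C α ^ 2 * X * (X - C u) * (X - C v)) * h1 +
    X * (X - C u) * (X - C v) * h2

/-- A quadratic polynomial whose fixed points are all non-repelling has potential good
reduction. -/
theorem exists_affConj_of_quadratic {K : Type*} [NormedField K] [IsAlgClosed K]
    {f : K[X]} (hdeg : f.natDegree = 2)
    (hf : ∀ z : K, f.eval z = z → ‖(derivative f).eval z‖ ≤ 1) :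
    ∃ α β : K, α ≠ 0 ∧ (∀ i : ℕ, ‖(affConj f α β).coeff i‖ ≤ 1) ∧
      ‖(affConj f α β).coeff 2‖ = 1 := by
  obtain ⟨a, s, ha, hs, hfs⟩ := f.exists_eq_X_add_C_mul_prod hdeg.ge
  obtain ⟨p, q, rfl⟩ := Multiset.card_eq_two.mp (hs.trans hdeg)
  obtain ⟨u, rfl⟩ : ∃ u, q = p + a⁻¹ * u := ⟨a * (q - p), by field_simp; ring⟩
  have hα : a * a⁻¹ = 1 := mul_inv_cancel₀ ha
  simp only [Multiset.insert_eq_cons, Multiset.map_cons, Multiset.map_singleton,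
    Multiset.prod_cons, Multiset.prod_singleton] at hfs
  have hp : ‖1 + -u‖ ≤ 1 := by
    convert hf p (by simp [hfs]) using 2
    simp [hfs]
    linear_combination -u * hα
  refine ⟨a⁻¹, p, inv_ne_zero ha, ?_⟩
  rw [hfs, affConj_quadratic (inv_ne_zero ha) hα]
  simp only [coeff_add, coeff_C_mul, coeff_X_pow, coeff_X]
  refine ⟨fun i => ?_, by norm_num⟩
  rcases i with _ | _ | _ | i
  · simp
  · simpa [sub_eq_add_neg] using hp
  · simp
  · simp

/-- A cubic polynomial whose fixed points are all non-repelling has potential good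
reduction. -/
theorem exists_affConj_of_cubic {K : Type*} [NormedField K] [IsAlgClosed K]
    (hna : IsNonarchimedean (fun x : K => ‖x‖)) {f : K[X]} (hdeg : f.natDegree = 3)
    (hf : ∀ z : K, f.eval z = z → ‖(derivative f).eval z‖ ≤ 1) :
    ∃ α β : K, α ≠ 0 ∧ (∀ i : ℕ, ‖(affConj f α β).coeff i‖ ≤ 1) ∧
      ‖(affConj f α β).coeff 3‖ = 1 := by
  obtain ⟨a, s, ha, hs, hfs⟩ := f.exists_eq_X_add_C_mul_prod (by omega)
  obtain ⟨p, q, r, rfl⟩ := Multiset.card_eq_three.mp (hs.trans hdeg)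
  obtain ⟨α, hα⟩ := IsAlgClosed.exists_pow_nat_eq a⁻¹ two_pos
  have hα0 : α ≠ 0 := by
    rintro rfl
    exact inv_ne_zero ha (by simpa using hα.symm)
  have haα : a * α ^ 2 = 1 := by rw [hα, mul_inv_cancel₀ ha]
  obtain ⟨u, rfl⟩ : ∃ u, q = p + α * u := ⟨α⁻¹ * (q - p), by field_simp; ring⟩
  obtain ⟨v, rfl⟩ : ∃ v, r = p + α * v := ⟨α⁻¹ * (r - p), by field_simp; ring⟩
  simp only [Multiset.insert_eq_cons, Multiset.map_cons, Multiset.map_singleton,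
    Multiset.prod_cons, Multiset.prod_singleton] at hfs
  have hp : ‖1 + u * v‖ ≤ 1 := by
    convert hf p (by simp [hfs]) using 2
    simp [hfs]
    linear_combination -u * v * haα
  have hq : ‖1 + u * (u - v)‖ ≤ 1 := by
    convert hf (p + α * u) (by simp [hfs]) using 2
    simp [hfs]
    linear_combination -u * (u - v) * haα
  have hr : ‖1 + v * (v - u)‖ ≤ 1 := by
    convert hf (p + α * v) (by simp [hfs]) using 2
    simp [hfs]
    linear_combination -v * (v - u) * haα
  have huv := hna.norm_le_one_of_norm_one_add_le_one hp
  have hu : ‖u‖ ≤ 1 := by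
    have h := hna.norm_add_le_one (hna.norm_le_one_of_norm_one_add_le_one hq) huv
    rw [show u * (u - v) + u * v = u ^ 2 by ring, norm_pow] at h
    exact (pow_le_one_iff_of_nonneg (norm_nonneg u) two_ne_zero).mp h
  have hv : ‖v‖ ≤ 1 := by
    have h := hna.norm_add_le_one (hna.norm_le_one_of_norm_one_add_le_one hr) huv
    rw [show v * (v - u) + u * v = v ^ 2 by ring, norm_pow] at h
    exact (pow_le_one_iff_of_nonneg (norm_nonneg v) two_ne_zero).mp h
  have hsum : ‖-(u + v)‖ ≤ 1 := by
    rw [norm_neg]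
    exact hna.norm_add_le_one hu hv
  refine ⟨α, p, hα0, ?_⟩
  rw [hfs, affConj_cubic hα0 haα]
  simp only [coeff_add, coeff_C_mul, coeff_X_pow, coeff_X]
  refine ⟨fun i => ?_, by norm_num⟩
  rcases i with _ | _ | _ | _ | i
  · simp
  · simpa using hp
  · simpa using hsum
  · simp
  · simp

/-- **Existence of a repelling fixed point for quadratic and cubic polynomials without
potential good reduction.**  Let `K` be an algebraically closed field, complete with respect
to a nontrivial non-Archimedean absolute value, with residue field of characteristic `0`
(encoded by `‖n‖ = 1` for every nonzero natural number `n`).  If a polynomial `f` over `K` of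
degree `d ∈ {2, 3}` is not affinely conjugate to a polynomial with coefficients in the
valuation ring and leading coefficient of absolute value `1`, then `f` has a repelling fixed
point. -/
theorem stmt6 {K : Type*} [NontriviallyNormedField K] [CompleteSpace K] [IsAlgClosed K]
    (hna : IsNonarchimedean (fun x : K => ‖x‖))
    (hres : ∀ n : ℕ, n ≠ 0 → ‖(n : K)‖ = 1)
    (f : Polynomial K) (d : ℕ) (hd : d = 2 ∨ d = 3) (hdeg : f.natDegree = d)
    (hpgr : ¬ ∃ α β : K, α ≠ 0 ∧
      (∀ i : ℕ, ‖(affConj f α β).coeff i‖ ≤ 1) ∧ ‖(affConj f α β).coeff d‖ = 1) :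
    ∃ z : K, f.eval z = z ∧ 1 < ‖(derivative f).eval z‖ := by
  by_contra! hrep
  apply hpgr
  rcases hd with rfl | rfl
  · exact exists_affConj_of_quadratic hdeg hrep
  · exact exists_affConj_of_cubic hna hdeg hrep
end
end

section
/- Let K be an algebraically closed field, complete with respect to a nontrivial non-Archimedean absolute value |·|, whose valuation ring 𝒪_K = {x ∈ K : |x| ≤ 1} has residue field of characteristic 0. Let f be a rational map of degree 3 over K, given by coprime polynomials P, Q ∈ K[z] with max(deg P, deg Q) = 3. Assume f does not have potential good reduction, i.e., there is no A ∈ GL₂(K) such that the conjugated homogeneous pair (P_A, Q_A) of degree-3 binary forms representing f^A has all its coefficients in 𝒪_K and resultant of absolute value 1. Then f admits a repelling periodic point of period at most 3: there exist n ∈ {1, 2, 3}, A ∈ GL₂(K) and z ∈ K such that, writing g = f^A, the orbit z, g(z), …, g^{n−1}(z) lies in K and avoids the poles of g, gⁿ(z) = z, and ∏_{i=0}^{n−1} |g′(gⁱ(z))| > 1. -/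
open Polynomial

noncomputable section

variable {K : Type*} [Field K]

/-- Degree-`d` homogenization of `P`, precomposed with the linear map of coordinates given by
the matrix `A`, and dehomogenized back to a one-variable polynomial (i.e. evaluated at `(X, 1)`). -/
def homApply (d : ℕ) (P : Polynomial K) (A : Matrix (Fin 2) (Fin 2) K) : Polynomial K :=
  ∑ i ∈ Finset.range (d + 1),
    C (P.coeff i) * (C (A 0 0) * X + C (A 0 1)) ^ i * (C (A 1 0) * X + C (A 1 1)) ^ (d - i)

/-- Numerator of the conjugate rational map `f^A`, where `f = P/Q` has degree `d`. -/
def conjNum (d : ℕ) (P Q : Polynomial K) (A : GL (Fin 2) K) : Polynomial K :=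
  C (((A⁻¹ : GL (Fin 2) K) : Matrix (Fin 2) (Fin 2) K) 0 0) *
      homApply d P (A : Matrix (Fin 2) (Fin 2) K) +
    C (((A⁻¹ : GL (Fin 2) K) : Matrix (Fin 2) (Fin 2) K) 0 1) *
      homApply d Q (A : Matrix (Fin 2) (Fin 2) K)

/-- Denominator of the conjugate rational map `f^A`, where `f = P/Q` has degree `d`. -/
def conjDen (d : ℕ) (P Q : Polynomial K) (A : GL (Fin 2) K) : Polynomial K :=
  C (((A⁻¹ : GL (Fin 2) K) : Matrix (Fin 2) (Fin 2) K) 1 0) *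
      homApply d P (A : Matrix (Fin 2) (Fin 2) K) +
    C (((A⁻¹ : GL (Fin 2) K) : Matrix (Fin 2) (Fin 2) K) 1 1) *
      homApply d Q (A : Matrix (Fin 2) (Fin 2) K)

/-- The conjugate rational map `f^A` as a function on `K` (junk value where the
denominator vanishes). -/
def cg (d : ℕ) (P Q : Polynomial K) (A : GL (Fin 2) K) : K → K :=
  fun z => (conjNum d P Q A).eval z / (conjDen d P Q A).eval z

/-- The derivative of the rational function `N/D`, evaluated at `z` (quotient rule). -/
def ratDeriv (N D : Polynomial K) (z : K) : K :=
  ((derivative N).eval z * D.eval z - N.eval z * (derivative D).eval z) / (D.eval z) ^ 2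

/-- The Sylvester matrix of the pair of degree-`3` binary forms with coefficients
`P.coeff 0, …, P.coeff 3` and `Q.coeff 0, …, Q.coeff 3`. -/
def sylvester3 (P Q : Polynomial K) : Matrix (Fin 6) (Fin 6) K :=
  Matrix.of fun i j =>
    if (i : ℕ) < 3 then
      if (i : ℕ) ≤ (j : ℕ) ∧ (j : ℕ) ≤ (i : ℕ) + 3 then P.coeff (3 + (i : ℕ) - (j : ℕ)) else 0
    else
      if (i : ℕ) - 3 ≤ (j : ℕ) ∧ (j : ℕ) ≤ (i : ℕ) then Q.coeff ((i : ℕ) - (j : ℕ)) else 0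

/-- The resultant of a pair of degree-`3` binary forms: the determinant of the Sylvester
matrix. -/
def res3 (P Q : Polynomial K) : K := (sylvester3 P Q).det

section

variable {L : Type*} [NormedField L]

lemma mul_norm_lt {x u : L} {ρ k : ℝ} (hx : ‖x‖ * ρ ≤ k) (hu : ‖u‖ < ρ) (hk : 0 < k) :
    ‖x * u‖ < k := by
  rw [norm_mul]
  rcases (norm_nonneg x).eq_or_lt' with h | h
  · rw [h]; simpa using hk
  · exact (mul_lt_mul_of_pos_left hu h).trans_le hx

lemma mul_mul_norm_lt {x u v : L} {ρ k : ℝ} (hx : ‖x‖ * ρ ^ 2 ≤ k) (hu : ‖u‖ < ρ)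
    (hv : ‖v‖ < ρ) (hk : 0 < k) : ‖x * (u * v)‖ < k := by
  refine mul_norm_lt hx ?_ hk
  rw [norm_mul, sq]
  exact mul_lt_mul'' hu hv (norm_nonneg _) (norm_nonneg _)

lemma norm_mul_lt_one {a b : L} (ha : ‖a‖ < 1) (hb : ‖b‖ ≤ 1) : ‖a * b‖ < 1 := by
  rw [norm_mul]; exact mul_lt_one_of_nonneg_of_lt_one_left (norm_nonneg _) ha hb

lemma norm_mul_le_mul {x y : L} {a b : ℝ} (hx : ‖x‖ ≤ a) (hy : ‖y‖ ≤ b) : ‖x * y‖ ≤ a * b := by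
  rw [norm_mul]; exact mul_le_mul hx hy (norm_nonneg _) ((norm_nonneg _).trans hx)

lemma norm_mul_lt_mul {x y : L} {a b : ℝ} (hx : ‖x‖ < a) (hy : ‖y‖ ≤ b) (hb : 0 < b) :
    ‖x * y‖ < a * b := by
  rw [norm_mul]
  exact (mul_le_mul_of_nonneg_left hy (norm_nonneg _)).trans_lt (mul_lt_mul_of_pos_right hx hb)

end

section

variable {L : Type*} [Field L] [IsAlgClosed L]

lemma exists_quadratic_roots (h2 : (2 : L) ≠ 0) (a b : L) :
    ∃ z w : L, a = -(z + w) ∧ b = z * w := by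
  obtain ⟨d, hd⟩ := IsAlgClosed.exists_pow_nat_eq (a ^ 2 - 4 * b) (n := 2) two_pos
  refine ⟨(-a + d) / 2, (-a - d) / 2, ?_, ?_⟩
  · field_simp; ring
  · field_simp; linear_combination (1 : L) * hd

lemma exists_cubic_roots (h2 : (2 : L) ≠ 0) (a b c : L) :
    ∃ x y z : L, a = -(x + y + z) ∧ b = x * y + x * z + y * z ∧ c = -(x * y * z) := by
  obtain ⟨x, hx⟩ := IsAlgClosed.exists_root (X ^ 3 + C a * X ^ 2 + C b * X + C c) (by
    have : (X ^ 3 + C a * X ^ 2 + C b * X + C c : L[X]).degree = 3 := by compute_degree!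
    rw [this]; decide)
  simp only [IsRoot.def, eval_add, eval_mul, eval_pow, eval_X, eval_C] at hx
  obtain ⟨y, z, h1, h3⟩ := exists_quadratic_roots h2 (a + x) (b + x * (a + x))
  refine ⟨x, y, z, by linear_combination h1, by linear_combination h3 - x * h1, ?_⟩
  linear_combination hx - x * h3

end

section Ultrametric

variable {L : Type*} [NontriviallyNormedField L] [IsUltrametricDist L]

lemma um_add_lt {x y : L} {r : ℝ} (hx : ‖x‖ < r) (hy : ‖y‖ < r) : ‖x + y‖ < r :=
  (IsUltrametricDist.norm_add_le_max x y).trans_lt (max_lt hx hy)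

lemma um_sub_lt {x y : L} {r : ℝ} (hx : ‖x‖ < r) (hy : ‖y‖ < r) : ‖x - y‖ < r := by
  rw [sub_eq_add_neg]; exact um_add_lt hx (by rwa [norm_neg])

lemma um_add_le {x y : L} {r : ℝ} (hx : ‖x‖ ≤ r) (hy : ‖y‖ ≤ r) : ‖x + y‖ ≤ r :=
  (IsUltrametricDist.norm_add_le_max x y).trans (max_le hx hy)

lemma um_sub_le {x y : L} {r : ℝ} (hx : ‖x‖ ≤ r) (hy : ‖y‖ ≤ r) : ‖x - y‖ ≤ r := by
  rw [sub_eq_add_neg]; exact um_add_le hx (by rwa [norm_neg])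

lemma um_norm_eq {x y : L} {r : ℝ} (hy : ‖y‖ = r) (h : ‖x - y‖ < r) : ‖x‖ = r := by
  apply le_antisymm
  · have := um_add_le h.le hy.le
    simpa using this
  · by_contra! hx
    have := um_sub_lt hx h
    simp only [sub_sub_cancel] at this
    exact this.ne hy

variable [IsAlgClosed L]

/-- A monic cubic which is small at `y` compared with its derivative has a root near `y`. -/
lemma exists_cubic_root_near (h2 : (2 : L) ≠ 0) {a b c y : L} {ρ : ℝ}
    (h : ‖y ^ 3 + a * y ^ 2 + b * y + c‖ < ρ * ‖3 * y ^ 2 + 2 * a * y + b‖) :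
    ∃ z, z ^ 3 + a * z ^ 2 + b * z + c = 0 ∧ ‖z - y‖ < ρ := by
  obtain ⟨u, v, w, rfl, rfl, rfl⟩ := exists_cubic_roots h2 a b c
  by_contra! hn
  have hu : ρ ≤ ‖y - u‖ := by rw [norm_sub_rev]; exact hn u (by ring)
  have hv : ρ ≤ ‖y - v‖ := by rw [norm_sub_rev]; exact hn v (by ring)
  have hw : ρ ≤ ‖y - w‖ := by rw [norm_sub_rev]; exact hn w (by ring)
  have e1 : y ^ 3 + -(u + v + w) * y ^ 2 + (u * v + u * w + v * w) * y + -(u * v * w)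
      = (y - u) * (y - v) * (y - w) := by ring
  have e2 : 3 * y ^ 2 + 2 * -(u + v + w) * y + (u * v + u * w + v * w)
      = (y - u) * (y - v) + (y - u) * (y - w) + (y - v) * (y - w) := by ring
  rw [e1, e2] at h
  have hρ : 0 < ρ := by
    by_contra! hρ
    exact absurd (h.trans_le (mul_nonpos_of_nonpos_of_nonneg hρ (norm_nonneg _)))
      (norm_nonneg _).not_gt
  have : ‖(y - u) * (y - v) + (y - u) * (y - w) + (y - v) * (y - w)‖
      ≤ ‖(y - u) * (y - v) * (y - w)‖ / ρ := by
    refine um_add_le (um_add_le ?_ ?_) ?_ <;> rw [le_div_iff₀ hρ] <;>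
      simp only [norm_mul]
    · gcongr
    · calc ‖y - u‖ * ‖y - w‖ * ρ ≤ ‖y - u‖ * ‖y - w‖ * ‖y - v‖ := by gcongr
        _ = _ := by ring
    · calc ‖y - v‖ * ‖y - w‖ * ρ ≤ ‖y - v‖ * ‖y - w‖ * ‖y - u‖ := by gcongr
        _ = _ := by ring
  have := (le_div_iff₀ hρ).1 this
  linarith

end Ultrametric

section InverseBranch

variable {L : Type*} [NontriviallyNormedField L]

/-- The `n`-th iterate of `f` has an inverse branch from the ball around `t` of radius `σ` into the
ball around `y` of radius `ρ`, contracting distances by the factor `Λ`, the orbits staying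
in `reg` and the derivatives `df` along them having product of norms `Λ`. -/
def HasInverseBranch (f : L → L) (reg : Set L) (df : L → L) (n : ℕ) (t : L) (σ : ℝ) (y : L)
    (ρ Λ : ℝ) : Prop :=
  ∃ g : L → L, ∀ w ∈ Metric.ball t σ, g w ∈ Metric.ball y ρ ∧ (∀ i < n, f^[i] (g w) ∈ reg) ∧
    f^[n] (g w) = w ∧ ∏ i ∈ Finset.range n, ‖df (f^[i] (g w))‖ = Λ ∧
    ∀ w' ∈ Metric.ball t σ, Λ * ‖g w - g w'‖ ≤ ‖w - w'‖

lemma HasInverseBranch.comp {f df : L → L} {reg : Set L} {n : ℕ} {t y t' y' : L}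
    {σ ρ Λ σ' ρ' Λ' : ℝ} (h : HasInverseBranch f reg df n t σ y ρ Λ)
    (h' : HasInverseBranch f reg df 1 t' σ' y' ρ' Λ') (hΛ : 0 ≤ Λ)
    (hb : Metric.ball y ρ ⊆ Metric.ball t' σ') :
    HasInverseBranch f reg df (n + 1) t σ y' ρ' (Λ * Λ') := by
  obtain ⟨g, hg⟩ := h
  obtain ⟨g', hg'⟩ := h'
  refine ⟨fun w => g' (g w), fun w hw => ?_⟩
  obtain ⟨h1, h2, h3, h4, h5⟩ := hg w hw
  obtain ⟨k1, k2, k3, k4, k5⟩ := hg' (g w) (hb h1)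
  simp only [Function.iterate_one] at k3
  refine ⟨k1, ?_, ?_, ?_, fun w' hw' => ?_⟩
  · intro i hi
    cases i with
    | zero => exact k2 0 one_pos
    | succ i => rw [Function.iterate_succ_apply, k3]; exact h2 i (by omega)
  · rw [Function.iterate_succ_apply, k3, h3]
  · rw [Finset.prod_range_succ']
    simp only [Function.iterate_succ_apply, k3, h4]
    simp only [Finset.prod_range_one, Function.iterate_zero, id] at k4
    simp [k4]
  · have h6 := k5 _ (hb (hg w' hw').1)
    calc Λ * Λ' * ‖g' (g w) - g' (g w')‖ = Λ * (Λ' * ‖g' (g w) - g' (g w')‖) := by ring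
      _ ≤ Λ * ‖g w - g w'‖ := by gcongr
      _ ≤ _ := h5 w' hw'

/-- An inverse branch that strictly contracts a ball into itself produces a repelling
periodic point. -/
lemma HasInverseBranch.exists_periodic [CompleteSpace L] [IsUltrametricDist L]
    {f df : L → L} {reg : Set L} {n : ℕ}
    {t y : L} {σ ρ Λ : ℝ} (h : HasInverseBranch f reg df n t σ y ρ Λ) (hσ : 0 < σ) (hΛ : 1 < Λ)
    (hb : Metric.ball y ρ ⊆ Metric.ball t σ) :
    ∃ z, (∀ i < n, f^[i] z ∈ reg) ∧ f^[n] z = z ∧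
      1 < ∏ i ∈ Finset.range n, ‖df (f^[i] z)‖ := by
  obtain ⟨g, hg⟩ := h
  have hmaps : Set.MapsTo g (Metric.ball t σ) (Metric.ball t σ) := fun w hw => hb (hg w hw).1
  have hc : ContractingWith (Real.toNNReal Λ⁻¹) (hmaps.restrict g _ _) := by
    refine ⟨?_, LipschitzWith.of_dist_le_mul fun a b => ?_⟩
    · rw [Real.toNNReal_lt_one]; exact inv_lt_one_of_one_lt₀ hΛ
    · have := (hg a a.2).2.2.2.2 b b.2
      rw [Real.coe_toNNReal _ (by positivity)]
      simp only [Subtype.dist_eq, Set.MapsTo.val_restrict_apply, dist_eq_norm]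
      rw [inv_mul_eq_div, le_div_iff₀ (by linarith)]
      linarith
  have hcomp : IsComplete (Metric.ball t σ) :=
    (IsUltrametricDist.isClosed_ball t σ).isComplete
  obtain ⟨z, hz, hfix, -, -⟩ := hc.exists_fixedPoint' hcomp hmaps
    (x := t) (Metric.mem_ball_self hσ) (edist_ne_top _ _)
  obtain ⟨h1, h2, h3, h4, h5⟩ := hg z hz
  rw [hfix.eq] at h2 h3 h4
  exact ⟨z, h2, h3, by rw [h4]; exact hΛ⟩

end InverseBranch

section NormalForm

variable {L : Type*} [Field L]

/-- The numerator of the normal form of a cubic rational map fixing `∞` and having a pole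
at `0`. -/
def nfNum (q b c : L) : L[X] := X ^ 3 + C q * X ^ 2 + C b * X + C c

/-- The denominator of the normal form of a cubic rational map with poles `0`, `s` and `∞`. -/
def nfDen (r s : L) : L[X] := C r * X * (X - C s)

/-- The cubic rational map in normal form. -/
def nfMap (r s q b c : L) : L → L := fun z => (nfNum q b c).eval z / (nfDen r s).eval z

/-- The complement of the poles of a map in normal form. -/
def nfReg (r s : L) : Set L := {z | (nfDen r s).eval z ≠ 0}

@[simp] lemma nfNum_eval (q b c z : L) :
    (nfNum q b c).eval z = z ^ 3 + q * z ^ 2 + b * z + c := by simp [nfNum]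

@[simp] lemma nfDen_eval (r s z : L) : (nfDen r s).eval z = r * z * (z - s) := by simp [nfDen]

lemma nfNum_derivative_eval (q b c z : L) :
    (derivative (nfNum q b c)).eval z = 3 * z ^ 2 + 2 * q * z + b := by
  simp [nfNum]; ring

lemma nfDen_derivative_eval (r s z : L) :
    (derivative (nfDen r s)).eval z = r * (2 * z - s) := by
  simp [nfDen]; ring

end NormalForm

section NormalFormBranch

variable {L : Type*} [NontriviallyNormedField L] [IsUltrametricDist L]

lemma norm_slope_eq {k k2 Q0 Q1 Q2 v v' : L} {ρ : ℝ} (hv : ‖v‖ < ρ) (hv' : ‖v'‖ < ρ)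
    (hk : k ≠ 0) (hQ : Q0 ≠ 0) (hk2 : ‖k2‖ * ρ ≤ ‖k‖) (hρk : ρ ^ 2 ≤ ‖k‖)
    (hQ1 : ‖Q1‖ * ρ ≤ ‖Q0‖) (hQ2 : ‖Q2‖ * ρ ^ 2 ≤ ‖Q0‖) :
    ‖k * Q0 + k2 * Q0 * (v + v') + Q0 * (v ^ 2 + v * v' + v' ^ 2) + (k2 * Q1 - k * Q2) * (v * v')
      + Q1 * (v * v') * (v + v') + Q2 * (v * v') ^ 2‖ = ‖k‖ * ‖Q0‖ := by
  have hρ : 0 < ρ := (norm_nonneg v).trans_lt hv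
  have hk0 : 0 < ‖k‖ := norm_pos_iff.2 hk
  have hQ0 : 0 < ‖Q0‖ := norm_pos_iff.2 hQ
  have hkQ : 0 < ‖k‖ * ‖Q0‖ := by positivity
  refine um_norm_eq (y := k * Q0) (norm_mul _ _) ?_
  have hsum : ‖v + v'‖ < ρ := um_add_lt hv hv'
  have e : k * Q0 + k2 * Q0 * (v + v') + Q0 * (v ^ 2 + v * v' + v' ^ 2)
      + (k2 * Q1 - k * Q2) * (v * v') + Q1 * (v * v') * (v + v') + Q2 * (v * v') ^ 2 - k * Q0
      = k2 * Q0 * (v + v') + Q0 * (v * v) + Q0 * (v * v') + Q0 * (v' * v')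
        + k2 * Q1 * (v * v') + -(k * Q2) * (v * v') + Q1 * (v + v') * (v * v')
        + Q2 * (v * v') * (v * v') := by ring
  have b1 : ‖v + v'‖ ≤ ρ := hsum.le
  have b2 : ‖v * v'‖ ≤ ρ ^ 2 := by rw [norm_mul, sq]; gcongr
  rw [e]
  have hq : ‖Q0‖ * ρ ^ 2 ≤ ‖k‖ * ‖Q0‖ := by rw [mul_comm]; gcongr
  refine um_add_lt (um_add_lt (um_add_lt (um_add_lt (um_add_lt (um_add_lt (um_add_lt ?_ ?_) ?_) ?_)
    ?_) ?_) ?_) ?_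
  · refine mul_norm_lt ?_ hsum hkQ
    rw [norm_mul]
    calc ‖k2‖ * ‖Q0‖ * ρ = ‖k2‖ * ρ * ‖Q0‖ := by ring
      _ ≤ _ := by gcongr
  · exact mul_mul_norm_lt hq hv hv hkQ
  · exact mul_mul_norm_lt hq hv hv' hkQ
  · exact mul_mul_norm_lt hq hv' hv' hkQ
  · refine mul_mul_norm_lt ?_ hv hv' hkQ
    rw [norm_mul]
    calc ‖k2‖ * ‖Q1‖ * ρ ^ 2 = (‖k2‖ * ρ) * (‖Q1‖ * ρ) := by ring
      _ ≤ _ := by gcongr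
  · refine mul_mul_norm_lt ?_ hv hv' hkQ
    rw [norm_neg, norm_mul, mul_assoc]
    gcongr
  · refine mul_mul_norm_lt ?_ hv hv' hkQ
    rw [norm_mul]
    calc ‖Q1‖ * ‖v + v'‖ * ρ ^ 2 ≤ ‖Q1‖ * ρ * ρ ^ 2 := by gcongr
      _ ≤ ‖Q0‖ * ‖k‖ := by gcongr
      _ = _ := mul_comm _ _
  · refine mul_mul_norm_lt ?_ hv hv' hkQ
    rw [norm_mul]
    calc ‖Q2‖ * ‖v * v'‖ * ρ ^ 2 ≤ ‖Q2‖ * ρ ^ 2 * ρ ^ 2 := by gcongr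
      _ ≤ ‖Q0‖ * ‖k‖ := by gcongr
      _ = _ := mul_comm _ _

/-- A simple preimage `y` of `t` which is far from the poles and the critical points gives an
inverse branch near `t`. -/
lemma nfMap_hasInverseBranch [IsAlgClosed L] (h2 : ‖(2 : L)‖ = 1) {r s q b c t y : L} {ρ σ : ℝ}
    (hr : ‖r‖ = 1) (hρ : 0 < ρ) (hy : y ^ 3 + q * y ^ 2 + b * y + c = t * (r * y * (y - s)))
    (hy1 : ρ ≤ ‖y‖) (hy2 : ρ ≤ ‖y - s‖)
    (hk0 : 3 * y ^ 2 + 2 * (q - r * t) * y + (b + r * s * t) ≠ 0)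
    (hk2 : ‖3 * y + (q - r * t)‖ * ρ ≤ ‖3 * y ^ 2 + 2 * (q - r * t) * y + (b + r * s * t)‖)
    (hkρ : ρ ^ 2 ≤ ‖3 * y ^ 2 + 2 * (q - r * t) * y + (b + r * s * t)‖)
    (hσ : σ * (‖y‖ * ‖y - s‖) ≤ ‖3 * y ^ 2 + 2 * (q - r * t) * y + (b + r * s * t)‖ * ρ) :
    HasInverseBranch (nfMap r s q b c) (nfReg r s) (ratDeriv (nfNum q b c) (nfDen r s)) 1 t σ y ρ
      (‖3 * y ^ 2 + 2 * (q - r * t) * y + (b + r * s * t)‖ / (‖y‖ * ‖y - s‖)) := by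
  set k := 3 * y ^ 2 + 2 * (q - r * t) * y + (b + r * s * t) with hkdef
  have hr0 : r ≠ 0 := by rintro rfl; simp at hr
  have h20 : (2 : L) ≠ 0 := by intro h; simp [h] at h2
  have hkp : 0 < ‖k‖ := norm_pos_iff.2 hk0
  have hyp : 0 < ‖y‖ := hρ.trans_le hy1
  have hysp : 0 < ‖y - s‖ := hρ.trans_le hy2
  have hQ0 : r * y * (y - s) ≠ 0 :=
    mul_ne_zero (mul_ne_zero hr0 (norm_pos_iff.1 hyp)) (norm_pos_iff.1 hysp)
  have nQ0 : ‖r * y * (y - s)‖ = ‖y‖ * ‖y - s‖ := by rw [norm_mul, norm_mul, hr, one_mul]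
  have hex : ∀ w ∈ Metric.ball t σ, ∃ z, z ^ 3 + (q - r * w) * z ^ 2 + (b + r * s * w) * z + c = 0
      ∧ ‖z - y‖ < ρ := by
    intro w hw
    rw [Metric.mem_ball, dist_eq_norm] at hw
    have hσ0 : 0 ≤ σ := (norm_nonneg _).trans hw.le
    have c1 : σ * ‖y‖ ≤ ‖k‖ := by
      refine le_of_mul_le_mul_right ?_ hρ
      calc σ * ‖y‖ * ρ ≤ σ * ‖y‖ * ‖y - s‖ := by gcongr
        _ ≤ _ := by rw [mul_assoc]; exact hσ
    have c2 : σ * ‖y - s‖ ≤ ‖k‖ := by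
      refine le_of_mul_le_mul_right ?_ hρ
      calc σ * ‖y - s‖ * ρ ≤ σ * ‖y - s‖ * ‖y‖ := by gcongr
        _ ≤ _ := by rw [mul_assoc, mul_comm ‖y - s‖]; exact hσ
    have nk : ‖3 * y ^ 2 + 2 * (q - r * w) * y + (b + r * s * w)‖ = ‖k‖ := by
      refine um_norm_eq rfl ?_
      have : 3 * y ^ 2 + 2 * (q - r * w) * y + (b + r * s * w) - k
          = -(r * y) * (w - t) + -(r * (y - s)) * (w - t) := by rw [hkdef]; ring
      rw [this]
      refine um_add_lt (mul_norm_lt ?_ hw hkp) (mul_norm_lt ?_ hw hkp)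
      · rw [norm_neg, norm_mul, hr, one_mul, mul_comm]; exact c1
      · rw [norm_neg, norm_mul, hr, one_mul, mul_comm]; exact c2
    refine exists_cubic_root_near h20 ?_
    rw [nk]
    have : y ^ 3 + (q - r * w) * y ^ 2 + (b + r * s * w) * y + c
        = (-(r * y * (y - s))) * (w - t) := by linear_combination hy
    rw [this]
    refine mul_norm_lt ?_ hw (by positivity)
    rw [norm_neg, nQ0, mul_comm, mul_comm ρ]
    exact hσ
  choose! g hg hgn using hex
  have hz1 : ∀ w ∈ Metric.ball t σ, ‖g w‖ = ‖y‖ := fun w hw =>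
    um_norm_eq rfl ((hgn w hw).trans_le hy1)
  have hz2 : ∀ w ∈ Metric.ball t σ, ‖g w - s‖ = ‖y - s‖ := fun w hw =>
    um_norm_eq rfl (by rw [sub_sub_sub_cancel_right]; exact (hgn w hw).trans_le hy2)
  have nD : ∀ w ∈ Metric.ball t σ, ‖r * g w * (g w - s)‖ = ‖y‖ * ‖y - s‖ := fun w hw => by
    rw [norm_mul, norm_mul, hr, one_mul, hz1 w hw, hz2 w hw]
  have hD : ∀ w ∈ Metric.ball t σ, r * g w * (g w - s) ≠ 0 := fun w hw => by
    rw [← norm_pos_iff, nD w hw]; positivity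
  have hf : ∀ w ∈ Metric.ball t σ, nfMap r s q b c (g w) = w := fun w hw => by
    rw [nfMap, nfNum_eval, nfDen_eval, div_eq_iff (hD w hw)]
    linear_combination hg w hw
  have hE : ∀ w ∈ Metric.ball t σ, ∀ w' ∈ Metric.ball t σ, _ := fun w hw w' hw' =>
    norm_slope_eq (k := k) (k2 := 3 * y + (q - r * t)) (Q0 := r * y * (y - s))
      (Q1 := r * (2 * y - s)) (Q2 := r) (hgn w hw) (hgn w' hw') hk0 hQ0 hk2 hkρ (by
        rw [nQ0, norm_mul, hr, one_mul]
        have : 2 * y - s = y + (y - s) := by ring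
        rw [this]
        rcases le_total ‖y‖ ‖y - s‖ with h | h
        · calc _ ≤ ‖y - s‖ * ρ := by gcongr; exact um_add_le h le_rfl
            _ ≤ ‖y - s‖ * ‖y‖ := by gcongr
            _ = _ := mul_comm _ _
        · calc _ ≤ ‖y‖ * ρ := by gcongr; exact um_add_le le_rfl h
            _ ≤ _ := by gcongr) (by
        rw [nQ0, hr, one_mul, sq]; gcongr)
  rw [nQ0] at hE
  refine ⟨g, fun w hw => ⟨by rw [Metric.mem_ball, dist_eq_norm]; exact hgn w hw, ?_, ?_, ?_,
    fun w' hw' => ?_⟩⟩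
  · intro i hi
    obtain rfl : i = 0 := by omega
    simp only [Function.iterate_zero, id, nfReg, Set.mem_ofPred_eq, nfDen_eval]
    exact hD w hw
  · rw [Function.iterate_one, hf w hw]
  · rw [Finset.prod_range_one, Function.iterate_zero, id, ratDeriv, nfDen_eval,
      nfNum_derivative_eval, nfDen_derivative_eval, nfNum_eval, norm_div, norm_pow, nD w hw]
    have := hE w hw w hw
    rw [div_eq_div_iff (by positivity) (by positivity)]
    rw [pow_two (‖y‖ * ‖y - s‖), ← mul_assoc ‖k‖, ← this]
    congr 2
    rw [hkdef]
    linear_combination (-(r * (2 * g w - s))) * hy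
  · have := hE w hw w' hw'
    have e1 := hf w hw
    have e2 := hf w' hw'
    rw [nfMap, nfNum_eval, nfDen_eval, div_eq_iff (hD w hw)] at e1
    rw [nfMap, nfNum_eval, nfDen_eval, div_eq_iff (hD w' hw')] at e2
    rw [div_mul_eq_mul_div, div_le_iff₀ (by positivity)]
    refine le_of_mul_le_mul_right (a := ‖y‖ * ‖y - s‖) ?_ (by positivity)
    refine le_of_eq ?_
    calc _ = ‖k‖ * (‖y‖ * ‖y - s‖) * ‖g w - g w'‖ := by ring
      _ = ‖(w - w') * (r * g w * (g w - s)) * (r * g w' * (g w' - s))‖ := by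
        rw [← this, ← norm_mul]
        congr 1
        linear_combination (r * g w' * (g w' - s)) * e1 - (r * g w * (g w - s)) * e2
          - (r * g w' * (g w' - s) - r * g w * (g w - s)) * hy
      _ = _ := by rw [norm_mul, norm_mul, nD w hw, nD w' hw']

end NormalFormBranch

section Core

variable {L : Type*} [NontriviallyNormedField L] [IsUltrametricDist L]

/-- The partial map `f`, defined on `reg` and with derivative `df`, has a repelling cycle of
period at most `3`. -/
def HasShortRepellingCycle (f : L → L) (reg : Set L) (df : L → L) : Prop :=
  ∃ n : ℕ, (n = 1 ∨ n = 2 ∨ n = 3) ∧ ∃ z, (∀ i < n, f^[i] z ∈ reg) ∧ f^[n] z = z ∧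
    1 < ∏ i ∈ Finset.range n, ‖df (f^[i] z)‖

lemma um_ball_subset {t y : L} {σ ρ : ℝ} (h : ‖y - t‖ < σ) (hρ : ρ ≤ σ) :
    Metric.ball y ρ ⊆ Metric.ball t σ := by
  intro w hw
  rw [Metric.mem_ball, dist_eq_norm] at hw ⊢
  have := um_add_lt (hw.trans_le hρ) h
  simpa using this

lemma HasInverseBranch.hasShortRepellingCycle [CompleteSpace L] {f df : L → L} {reg : Set L}
    {n : ℕ} {t y : L} {σ ρ Λ : ℝ} (h : HasInverseBranch f reg df n t σ y ρ Λ)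
    (hn : n = 1 ∨ n = 2 ∨ n = 3) (hΛ : 1 < Λ) (hy : ‖y - t‖ < σ) (hρ : ρ ≤ σ) :
    HasShortRepellingCycle f reg df :=
  ⟨n, hn, h.exists_periodic ((norm_nonneg _).trans_lt hy) hΛ (um_ball_subset hy hρ)⟩

lemma norm_three_le_one : ‖(3 : L)‖ ≤ 1 := by
  exact_mod_cast IsUltrametricDist.norm_natCast_le_one L 3

lemma norm_four_le_one : ‖(4 : L)‖ ≤ 1 := by
  exact_mod_cast IsUltrametricDist.norm_natCast_le_one L 4

/-- A quadratic polynomial attains its Gauss norm at one of three points of the unit disc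
at mutual distance `1`. -/
lemma quadratic_attains {A B C t u : L} {Δ : ℝ} (hΔ : Δ = max (max ‖A‖ ‖B‖) ‖C‖)
    (ht : ‖t‖ = 1) (hu : ‖u‖ = 1) (htu : ‖u - t‖ = 1) :
    ‖A‖ = Δ ∨ ‖A + B * t + C * t ^ 2‖ = Δ ∨ ‖A + B * u + C * u ^ 2‖ = Δ := by
  have hA : ‖A‖ ≤ Δ := by rw [hΔ]; exact (le_max_left _ _).trans (le_max_left _ _)
  have hB : ‖B‖ ≤ Δ := by rw [hΔ]; exact (le_max_right _ _).trans (le_max_left _ _)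
  have hC : ‖C‖ ≤ Δ := by rw [hΔ]; exact le_max_right _ _
  have hle : ∀ x : L, ‖x‖ = 1 → ‖A + B * x + C * x ^ 2‖ ≤ Δ := fun x hx =>
    um_add_le (um_add_le hA (by simpa [hx])) (by simpa [hx])
  by_contra! h
  obtain ⟨h0, h1, h3⟩ := h
  replace h0 := lt_of_le_of_ne hA h0
  replace h1 := lt_of_le_of_ne (hle t ht) h1
  replace h3 := lt_of_le_of_ne (hle u hu) h3
  have e1 : ‖B + C * t‖ < Δ := by
    have : A + B * t + C * t ^ 2 - A = (B + C * t) * t := by ring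
    have h := um_sub_lt h1 h0
    rwa [this, norm_mul, ht, mul_one] at h
  have e2 : ‖B + C * u‖ < Δ := by
    have : A + B * u + C * u ^ 2 - A = (B + C * u) * u := by ring
    have h := um_sub_lt h3 h0
    rwa [this, norm_mul, hu, mul_one] at h
  have e3 : ‖C‖ < Δ := by
    have : B + C * u - (B + C * t) = C * (u - t) := by ring
    have h := um_sub_lt e2 e1
    rwa [this, norm_mul, htu, mul_one] at h
  have e4 : ‖B‖ < Δ := by
    have h := um_sub_lt e1 (show ‖C * t‖ < Δ by rwa [norm_mul, ht, mul_one])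
    rwa [add_sub_cancel_right] at h
  exact absurd hΔ (max_lt (max_lt h0 e4) e3).ne'

variable [IsAlgClosed L]

lemma exists_small_cubic_root (h2 : ‖(2 : L)‖ = 1) {a b c : L} (hb : ‖b‖ = 1) (hc : ‖c‖ < 1) :
    ∃ y, y ^ 3 + a * y ^ 2 + b * y + c = 0 ∧ ‖y‖ < 1 := by
  have h20 : (2 : L) ≠ 0 := by intro h; simp [h] at h2
  obtain ⟨y, hy, hn⟩ := exists_cubic_root_near h20 (a := a) (b := b) (c := c) (y := 0) (ρ := 1)
    (by simpa [hb] using hc)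
  exact ⟨y, hy, by simpa using hn⟩

lemma exists_unit_cubic_root (h2 : ‖(2 : L)‖ = 1) {a b c : L} (ha : ‖a‖ = 1) (hb : ‖b‖ < 1)
    (hc : ‖c‖ < 1) : ∃ y, y ^ 3 + a * y ^ 2 + b * y + c = 0 ∧ ‖y + a‖ < 1 ∧ ‖y‖ = 1 ∧
      ‖3 * y ^ 2 + 2 * a * y + b‖ = 1 := by
  have h20 : (2 : L) ≠ 0 := by intro h; simp [h] at h2
  have key : ‖3 * (-a) ^ 2 + 2 * a * (-a) + b‖ = 1 := by
    refine um_norm_eq (y := a ^ 2) (by simp [ha]) ?_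
    convert hb using 2; ring
  obtain ⟨y, hy, hn⟩ := exists_cubic_root_near h20 (a := a) (b := b) (c := c) (y := -a) (ρ := 1)
    (by
      rw [key, one_mul]
      have : (-a) ^ 3 + a * (-a) ^ 2 + b * (-a) + c = b * (-a) + c := by ring
      rw [this]
      exact um_add_lt (norm_mul_lt_one hb (by simp [ha])) hc)
  rw [sub_neg_eq_add] at hn
  have hy1 : ‖y‖ = 1 := um_norm_eq (y := -a) (by simp [ha]) (by simpa using hn)
  refine ⟨y, hy, hn, hy1, um_norm_eq (y := a ^ 2) (by simp [ha]) ?_⟩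
  have : 3 * y ^ 2 + 2 * a * y + b - a ^ 2 = (y + a) * (y + y + y - a) + b := by ring
  rw [this]
  exact um_add_lt (norm_mul_lt_one hn (um_sub_le (um_add_le (um_add_le hy1.le hy1.le) hy1.le)
    ha.le)) hb


/-- The case of a simple pole at `0` after reduction. -/
lemma nfMap_cycle_of_norm_b [CompleteSpace L] (h2 : ‖(2 : L)‖ = 1) {r s q b c : L} (hr : ‖r‖ = 1)
    (hq : ‖q‖ ≤ 1) (hs : ‖s‖ ≤ 1) (hb : ‖b‖ = 1) (hc : ‖c‖ < 1) (hc0 : c ≠ 0)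
    (hNs : s ^ 3 + q * s ^ 2 + b * s + c ≠ 0) :
    HasShortRepellingCycle (nfMap r s q b c) (nfReg r s) (ratDeriv (nfNum q b c) (nfDen r s)) := by
  obtain ⟨y, hy, hy1⟩ := exists_small_cubic_root h2 (a := q) hb hc
  have hy0 : 0 < ‖y‖ := by rw [norm_pos_iff]; rintro rfl; simp [hc0] at hy
  have hys : 0 < ‖y - s‖ := by rw [norm_pos_iff, sub_ne_zero]; rintro rfl; exact hNs hy
  have hys1 : ‖y - s‖ ≤ 1 := um_sub_le hy1.le hs
  have hk : ‖3 * y ^ 2 + 2 * (q - r * 0) * y + (b + r * s * 0)‖ = 1 := by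
    refine um_norm_eq hb ?_
    have : 3 * y ^ 2 + 2 * (q - r * 0) * y + (b + r * s * 0) - b = y * (y + y + y + q + q) := by
      ring
    rw [this]
    exact norm_mul_lt_one hy1 (um_add_le (um_add_le (um_add_le (um_add_le hy1.le hy1.le)
      hy1.le) hq) hq)
  have hρ1 : min ‖y‖ ‖y - s‖ ≤ 1 := (min_le_left _ _).trans hy1.le
  have := nfMap_hasInverseBranch h2 (q := q) (b := b) (c := c) (t := 0) (σ := 1) hr
    (lt_min hy0 hys)
    (by rw [hy]; ring) (min_le_left _ _) (min_le_right _ _) (by rw [← norm_pos_iff, hk]; exact one_pos)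
    (by
      rw [hk]
      refine mul_le_one₀ ?_ (lt_min hy0 hys).le hρ1
      have : 3 * y + (q - r * 0) = y + y + y + q := by ring
      rw [this]
      exact um_add_le (um_add_le (um_add_le hy1.le hy1.le) hy1.le) hq)
    (by rw [hk]; exact pow_le_one₀ (lt_min hy0 hys).le hρ1)
    (by
      rw [hk, one_mul, one_mul]
      exact le_min (mul_le_of_le_one_right hy0.le hys1) (mul_le_of_le_one_left hys.le hy1.le))
  refine this.hasShortRepellingCycle (.inl rfl) ?_ (by simpa using hy1) hρ1
  rw [hk, one_lt_div (by positivity)]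
  exact mul_lt_one_of_nonneg_of_lt_one_left hy0.le hy1 hys1

lemma nfMap_cycle_of_norm_s_q [CompleteSpace L] (h2 : ‖(2 : L)‖ = 1) {r s q b c : L} (hr : ‖r‖ = 1)
    (hq : ‖q‖ = 1) (hs : ‖s‖ = 1) (hb : ‖b‖ < 1) (hc : ‖c‖ < 1) (hc0 : c ≠ 0)
    (hNs : s ^ 3 + q * s ^ 2 + b * s + c ≠ 0) :
    HasShortRepellingCycle (nfMap r s q b c) (nfReg r s) (ratDeriv (nfNum q b c) (nfDen r s)) := by
  obtain ⟨u, hu, huq, hu1, hk⟩ := exists_unit_cubic_root h2 hq hb hc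
  have hus : 0 < ‖u - s‖ := by rw [norm_pos_iff, sub_ne_zero]; rintro rfl; exact hNs hu
  have hus1 : ‖u - s‖ ≤ 1 := um_sub_le hu1.le hs.le
  replace hk : ‖3 * u ^ 2 + 2 * (q - r * 0) * u + (b + r * s * 0)‖ = 1 := by simpa using hk
  have B1 := nfMap_hasInverseBranch h2 (q := q) (b := b) (c := c) (t := 0) (σ := 1) hr hus
    (by rw [hu]; ring) (hus1.trans_eq hu1.symm) le_rfl
    (by rw [← norm_pos_iff, hk]; exact one_pos)
    (by
      rw [hk]
      refine mul_le_one₀ ?_ hus.le hus1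
      have : 3 * u + (q - r * 0) = u + u + u + q := by ring
      rw [this]
      exact um_add_le (um_add_le (um_add_le hu1.le hu1.le) hu1.le) hq.le)
    (by rw [hk]; exact pow_le_one₀ hus.le hus1)
    (by rw [hk, hu1]; simp)
  rw [hk, hu1, one_mul] at B1
  have hβ : ‖b + r * s * u‖ = 1 := um_norm_eq (y := r * s * u) (by simp [hr, hs, hu1]) (by simpa)
  obtain ⟨y, hy, hy1⟩ := exists_small_cubic_root h2 (a := q - r * u) hβ hc
  have hy0 : 0 < ‖y‖ := by rw [norm_pos_iff]; rintro rfl; simp [hc0] at hy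
  have hys : ‖y - s‖ = 1 := um_norm_eq (y := -s) (by simpa) (by simpa)
  have ha : ‖q - r * u‖ ≤ 1 := um_sub_le hq.le (by simp [hr, hu1])
  have hk' : ‖3 * y ^ 2 + 2 * (q - r * u) * y + (b + r * s * u)‖ = 1 := by
    refine um_norm_eq hβ ?_
    have : 3 * y ^ 2 + 2 * (q - r * u) * y + (b + r * s * u) - (b + r * s * u)
      = y * (y + y + y + (q - r * u) + (q - r * u)) := by ring
    rw [this]
    exact norm_mul_lt_one hy1 (um_add_le (um_add_le (um_add_le (um_add_le hy1.le hy1.le)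
      hy1.le) ha) ha)
  have B2 := nfMap_hasInverseBranch h2 (q := q) (b := b) (c := c) (t := u) (σ := 1) hr hy0
    (by linear_combination hy) le_rfl (hy1.le.trans_eq hys.symm)
    (by rw [← norm_pos_iff, hk']; exact one_pos)
    (by
      rw [hk']
      refine mul_le_one₀ ?_ hy0.le hy1.le
      have : 3 * y + (q - r * u) = y + y + y + (q - r * u) := by ring
      rw [this]
      exact um_add_le (um_add_le (um_add_le hy1.le hy1.le) hy1.le) ha)
    (by rw [hk']; exact pow_le_one₀ hy0.le hy1.le)
    (by rw [hk', hys]; simp)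
  rw [hk', hys, mul_one] at B2
  refine (B1.comp B2 (by positivity) (Metric.ball_subset_ball hus1)).hasShortRepellingCycle
    (by simp) ?_ (by simpa using hy1) hy1.le
  have h1 : 1 ≤ 1 / ‖u - s‖ := (one_le_div hus).2 hus1
  have h3 : 1 < 1 / ‖y‖ := (one_lt_div hy0).2 hy1
  exact one_lt_mul_of_le_of_lt h1 h3

lemma nfMap_unit_branch (h2 : ‖(2 : L)‖ = 1) {r s q b c t : L} (hr : ‖r‖ = 1)
    (hs : ‖s‖ < 1) (hb : ‖b‖ < 1) (hc : ‖c‖ < 1) (ht : ‖t‖ ≤ 1) (ha : ‖q - r * t‖ = 1) :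
    ∃ y, ‖y + (q - r * t)‖ < 1 ∧ ‖y‖ = 1 ∧ HasInverseBranch (nfMap r s q b c) (nfReg r s)
      (ratDeriv (nfNum q b c) (nfDen r s)) 1 t 1 y 1 1 := by
  have hβ : ‖b + r * s * t‖ < 1 :=
    um_add_lt hb (norm_mul_lt_one (by rw [norm_mul, hr, one_mul]; exact hs) ht)
  obtain ⟨y, hy, hya, hy1, hk⟩ := exists_unit_cubic_root h2 ha hβ hc
  have hys : ‖y - s‖ = 1 := um_norm_eq hy1 (by simpa)
  have B := nfMap_hasInverseBranch h2 (q := q) (b := b) (c := c) (t := t) (σ := 1) hr one_pos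
    (by linear_combination hy) hy1.ge hys.ge (by rw [← norm_pos_iff, hk]; exact one_pos)
    (by
      rw [hk, mul_one]
      have : 3 * y + (q - r * t) = y + y + y + (q - r * t) := by ring
      rw [this]
      exact um_add_le (um_add_le (um_add_le hy1.le hy1.le) hy1.le) ha.le)
    (by rw [hk]; simp) (by rw [hk, hy1, hys]; simp)
  rw [hk, hy1, hys] at B
  exact ⟨y, hya, hy1, by simpa using B⟩

lemma exists_cubic_root_norm_le (h20 : (2 : L) ≠ 0) {a b c : L} {δ : ℝ} (hδ : 0 < δ) (hδ1 : δ < 1)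
    (hc : ‖c‖ ≤ δ ^ 2) (hd : ‖b ^ 2 - 4 * a * c‖ = δ ^ 2) :
    ∃ y, y ^ 3 + a * y ^ 2 + b * y + c = 0 ∧ ‖y‖ ≤ δ := by
  obtain ⟨u, v, w, h1, h3, h5⟩ := exists_cubic_roots h20 a b c
  by_contra! hn
  have hu := hn u (by rw [h1, h3, h5]; ring)
  have hv := hn v (by rw [h1, h3, h5]; ring)
  have hw := hn w (by rw [h1, h3, h5]; ring)
  have hp : ‖u‖ * ‖v‖ * ‖w‖ ≤ δ ^ 2 := by
    rw [h5, norm_neg, norm_mul, norm_mul] at hc; exact hc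
  have huv : ‖u‖ * ‖v‖ < δ := by
    by_contra! h
    nlinarith [mul_lt_mul_of_pos_left hw (hδ.trans_le h), mul_le_mul_of_nonneg_right h hδ.le]
  have huw : ‖u‖ * ‖w‖ < δ := by
    by_contra! h
    nlinarith [mul_lt_mul_of_pos_left hv (hδ.trans_le h), mul_le_mul_of_nonneg_right h hδ.le]
  have hvw : ‖v‖ * ‖w‖ < δ := by
    by_contra! h
    nlinarith [mul_lt_mul_of_pos_left hu (hδ.trans_le h), mul_le_mul_of_nonneg_right h hδ.le]
  have hb' : ‖b‖ < δ := by
    rw [h3]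
    exact um_add_lt (um_add_lt (by rwa [norm_mul]) (by rwa [norm_mul])) (by rwa [norm_mul])
  have ha' : ‖a‖ < 1 := by
    rw [h1, norm_neg]
    refine um_add_lt (um_add_lt ?_ ?_) ?_
    · by_contra! h; nlinarith
    · by_contra! h; nlinarith
    · by_contra! h; nlinarith
  have : ‖b ^ 2 - 4 * a * c‖ < δ ^ 2 := by
    refine um_sub_lt ?_ ?_
    · rw [norm_pow]; gcongr
    · rw [mul_assoc, norm_mul, norm_mul]
      calc ‖(4 : L)‖ * (‖a‖ * ‖c‖) ≤ 1 * (‖a‖ * δ ^ 2) := by gcongr; exact norm_four_le_one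
        _ < 1 * (1 * δ ^ 2) := by gcongr
        _ = δ ^ 2 := by ring
  exact this.ne hd

lemma nfMap_expanding_branch (h2 : ‖(2 : L)‖ = 1) {r s q b c t : L} {δ : ℝ} (hr : ‖r‖ = 1)
    (hδ : 0 < δ) (hδ1 : δ < 1) (hs : ‖s‖ ≤ δ) (hb : ‖b‖ ≤ δ) (hc : ‖c‖ ≤ δ ^ 2) (ht : ‖t‖ ≤ 1)
    (hq : ‖q‖ ≤ 1) (hc0 : c ≠ 0) (hNs : s ^ 3 + q * s ^ 2 + b * s + c ≠ 0)
    (hd : ‖(b + r * s * t) ^ 2 - 4 * (q - r * t) * c‖ = δ ^ 2) :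
    ∃ y ρ Λ, ‖y‖ < 1 ∧ ρ ≤ 1 ∧ 1 < Λ ∧ HasInverseBranch (nfMap r s q b c) (nfReg r s)
      (ratDeriv (nfNum q b c) (nfDen r s)) 1 t 1 y ρ Λ := by
  have h20 : (2 : L) ≠ 0 := by intro h; simp [h] at h2
  have hβ : ‖b + r * s * t‖ ≤ δ := by
    refine um_add_le hb ?_
    rw [norm_mul, norm_mul, hr, one_mul]
    calc ‖s‖ * ‖t‖ ≤ δ * 1 := by gcongr
      _ = δ := mul_one _
  have ha : ‖q - r * t‖ ≤ 1 := um_sub_le hq (by rwa [norm_mul, hr, one_mul])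
  obtain ⟨y, hy, hyδ⟩ := exists_cubic_root_norm_le h20 hδ hδ1 hc hd
  have hy0 : 0 < ‖y‖ := by rw [norm_pos_iff]; rintro rfl; simp [hc0] at hy
  have hys : 0 < ‖y - s‖ := by
    rw [norm_pos_iff, sub_ne_zero]; rintro rfl; exact hNs (by linear_combination hy)
  have hysδ : ‖y - s‖ ≤ δ := um_sub_le hyδ hs
  set a := q - r * t with hadef
  set β := b + r * s * t with hβdef
  have e1 : ‖2 * a * y + β‖ = δ := by
    have : ‖(2 * a * y + β) ^ 2‖ = δ ^ 2 := by
      refine um_norm_eq hd ?_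
      have : (2 * a * y + β) ^ 2 - (β ^ 2 - 4 * a * c) = -(4 * (a * y ^ 3)) := by
        linear_combination 4 * a * hy
      rw [this, norm_neg, norm_mul, norm_mul, norm_pow]
      calc ‖(4 : L)‖ * (‖a‖ * ‖y‖ ^ 3) ≤ 1 * (1 * δ ^ 3) := by gcongr; exact norm_four_le_one
        _ < δ ^ 2 := by nlinarith [pow_pos hδ 2]
    rw [norm_pow] at this
    exact (pow_left_inj₀ (norm_nonneg _) hδ.le two_ne_zero).1 this
  have hk : ‖3 * y ^ 2 + 2 * a * y + β‖ = δ := by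
    refine um_norm_eq e1 ?_
    have : 3 * y ^ 2 + 2 * a * y + β - (2 * a * y + β) = 3 * y ^ 2 := by ring
    rw [this, norm_mul, norm_pow]
    calc ‖(3 : L)‖ * ‖y‖ ^ 2 ≤ 1 * δ ^ 2 := by gcongr; exact norm_three_le_one
      _ < δ := by nlinarith
  have hρ : 0 < min ‖y‖ ‖y - s‖ := lt_min hy0 hys
  have hρδ : min ‖y‖ ‖y - s‖ ≤ δ := (min_le_left _ _).trans hyδ
  have B := nfMap_hasInverseBranch h2 (q := q) (b := b) (c := c) (t := t) (σ := 1) hr hρ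
    (by linear_combination hy) (min_le_left _ _) (min_le_right _ _)
    (by rw [← norm_pos_iff, hk]; exact hδ)
    (by
      rw [hk]
      refine (mul_le_of_le_one_left hρ.le ?_).trans hρδ
      have : 3 * y + (q - r * t) = y + y + y + a := by ring
      rw [this]
      have hy1 := hyδ.trans hδ1.le
      exact um_add_le (um_add_le (um_add_le hy1 hy1) hy1) ha)
    (by rw [hk]; nlinarith)
    (by
      rw [hk, one_mul]
      rcases le_total ‖y‖ ‖y - s‖ with h | h
      · rw [min_eq_left h, mul_comm]; gcongr
      · rw [min_eq_right h]; gcongr)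
  refine ⟨y, _, _, hyδ.trans_lt hδ1, hρδ.trans hδ1.le, ?_, B⟩
  rw [hk, one_lt_div (by positivity)]
  calc ‖y‖ * ‖y - s‖ ≤ δ * δ := by gcongr
    _ < δ := by nlinarith

lemma nfMap_cycle_of_norm_q [CompleteSpace L] (h2 : ‖(2 : L)‖ = 1) {r s q b c : L} (hr : ‖r‖ = 1)
    (hr1 : ‖1 + r‖ = 1)
    (hq : ‖q‖ = 1) (hs : ‖s‖ < 1) (hb : ‖b‖ < 1) (hc : ‖c‖ < 1) (hc0 : c ≠ 0)
    (hNs : s ^ 3 + q * s ^ 2 + b * s + c ≠ 0) :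
    HasShortRepellingCycle (nfMap r s q b c) (nfReg r s) (ratDeriv (nfNum q b c) (nfDen r s)) := by
  obtain ⟨t, ht, ht1, B1⟩ := nfMap_unit_branch h2 hr hs hb hc (t := 0) (q := q) (by simp)
    (by simpa using hq)
  rw [mul_zero, sub_zero] at ht
  have hrt : ‖r * (t + q)‖ < 1 := by rwa [norm_mul, hr, one_mul]
  have ha : ‖q - r * t‖ = 1 := by
    refine um_norm_eq (y := q * (1 + r)) (by rw [norm_mul, hq, hr1, one_mul]) ?_
    have : q - r * t - q * (1 + r) = -(r * (t + q)) := by ring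
    rwa [this, norm_neg]
  obtain ⟨u, hu, hu1, B2⟩ := nfMap_unit_branch h2 hr hs hb hc (q := q) ht1.le ha
  have hut : ‖u - t‖ = 1 := by
    refine um_norm_eq (y := -(r * q)) (by rw [norm_neg, norm_mul, hr, hq, one_mul]) ?_
    have : u - t - -(r * q) = u + (q - r * t) - (t + q) + r * (t + q) := by ring
    rw [this]
    exact um_add_lt (um_sub_lt hu ht) hrt
  have h4 : ‖(4 : L)‖ = 1 := by
    have : (4 : L) = 2 * 2 := by norm_num
    rw [this, norm_mul, h2, one_mul]
  obtain ⟨Δ, hΔ⟩ : ∃ Δ, Δ = max (max ‖b ^ 2 - 4 * q * c‖ ‖2 * b * r * s + 4 * r * c‖)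
    ‖r ^ 2 * s ^ 2‖ := ⟨_, rfl⟩
  have hD0 : ‖b ^ 2 - 4 * q * c‖ ≤ Δ := by rw [hΔ]; exact (le_max_left _ _).trans (le_max_left _ _)
  have hD1 : ‖2 * b * r * s + 4 * r * c‖ ≤ Δ := by
    rw [hΔ]; exact (le_max_right _ _).trans (le_max_left _ _)
  have hD2 : ‖s‖ ^ 2 ≤ Δ := by
    have : ‖r ^ 2 * s ^ 2‖ ≤ Δ := by rw [hΔ]; exact le_max_right _ _
    simpa [hr] using this
  have n1 : ‖4 * q * c‖ = ‖c‖ := by rw [norm_mul, norm_mul, h4, hq, one_mul, one_mul]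
  have n2 : ‖4 * r * c‖ = ‖c‖ := by rw [norm_mul, norm_mul, h4, hr, one_mul, one_mul]
  have n3 : ‖2 * b * r * s‖ = ‖b‖ * ‖s‖ := by simp [h2, hr]
  have hcp : 0 < ‖c‖ := norm_pos_iff.2 hc0
  have hcΔ : ‖c‖ ≤ Δ := by
    by_contra! h
    have e1 : ‖b ^ 2‖ = ‖c‖ := um_norm_eq n1 (hD0.trans_lt h)
    have e2 : ‖2 * b * r * s‖ = ‖c‖ := by
      refine um_norm_eq (y := -(4 * r * c)) (by rw [norm_neg, n2]) ?_
      rw [sub_neg_eq_add]; exact hD1.trans_lt h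
    rw [norm_pow] at e1
    rw [n3] at e2
    have e3 : ‖c‖ * ‖s‖ ^ 2 = ‖c‖ * ‖c‖ := by rw [← e1, ← mul_pow, e2, e1, sq]
    have := mul_left_cancel₀ hcp.ne' e3
    linarith
  have hbΔ : ‖b‖ ^ 2 ≤ Δ := by
    rw [← norm_pow]
    have := um_add_le hD0 (n1.trans_le hcΔ)
    rwa [sub_add_cancel] at this
  have hΔ0 : 0 < Δ := hcp.trans_le hcΔ
  have hΔ1 : Δ < 1 := by
    have hb2 : ‖b ^ 2‖ < 1 := by rw [norm_pow]; exact pow_lt_one₀ (norm_nonneg _) hb two_ne_zero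
    rw [hΔ]
    refine max_lt (max_lt (um_sub_lt hb2 (n1.trans_lt hc)) (um_add_lt ?_ (n2.trans_lt hc))) ?_
    · rw [n3]; exact mul_lt_one_of_nonneg_of_lt_one_left (norm_nonneg _) hb hs.le
    · rw [norm_mul, norm_pow, norm_pow, hr, one_pow, one_mul]
      exact pow_lt_one₀ (norm_nonneg _) hs two_ne_zero
  have hδ2 : √Δ ^ 2 = Δ := Real.sq_sqrt hΔ0.le
  have hδ1 : √Δ < 1 := by rw [Real.sqrt_lt' one_pos]; simpa
  have hex : ∀ w : L, ‖w‖ ≤ 1 →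
      ‖b ^ 2 - 4 * q * c + (2 * b * r * s + 4 * r * c) * w + r ^ 2 * s ^ 2 * w ^ 2‖ = Δ → _ :=
    fun w hw h => nfMap_expanding_branch h2 hr (Real.sqrt_pos.2 hΔ0) hδ1 (Real.le_sqrt_of_sq_le hD2)
      (Real.le_sqrt_of_sq_le hbΔ) (by rw [hδ2]; exact hcΔ) hw hq.le hc0 hNs (by
        rw [hδ2, ← h]; congr 1; ring)
  rcases quadratic_attains hΔ ht1 hu1 hut with h | h | h
  · obtain ⟨y, ρ, Λ, hy, hρ, hΛ, B⟩ := hex 0 (by simp) (by simpa using h)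
    exact B.hasShortRepellingCycle (by simp) hΛ (by simpa using hy) hρ
  · obtain ⟨y, ρ, Λ, hy, hρ, hΛ, B⟩ := hex t ht1.le h
    exact (B1.comp B zero_le_one subset_rfl).hasShortRepellingCycle (by simp) (by simpa)
      (by simpa using hy) hρ
  · obtain ⟨y, ρ, Λ, hy, hρ, hΛ, B⟩ := hex u hu1.le h
    exact ((B1.comp B2 zero_le_one subset_rfl).comp B (by simp) subset_rfl).hasShortRepellingCycle
      (by simp) (by simpa) (by simpa using hy) hρ

end Core

section DoublePole

variable {L : Type*} [NontriviallyNormedField L] [IsUltrametricDist L]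

lemma norm_three_mul_le {x : L} {R : ℝ} (h : ‖x‖ ≤ R) : ‖3 * x‖ ≤ R := by
  rw [norm_mul]
  exact (mul_le_of_le_one_left (norm_nonneg _) norm_three_le_one).trans h

lemma norm_two_le_one : ‖(2 : L)‖ ≤ 1 := by
  exact_mod_cast IsUltrametricDist.norm_natCast_le_one L 2

lemma norm_two_mul_le {x : L} {R : ℝ} (h : ‖x‖ ≤ R) : ‖2 * x‖ ≤ R := by
  rw [norm_mul]
  exact (mul_le_of_le_one_left (norm_nonneg _) norm_two_le_one).trans h

variable [IsAlgClosed L]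

/-- Two steps of inverse branches from a ball around `m`, first towards the point `θ` close to a
square root `θ₀` of `-r s m`, then towards a small point `x`. -/
lemma nfMap_two_step_branch (h2 : ‖(2 : L)‖ = 1) {r s q b c m θ₀ : L} {h : ℝ} (hr : ‖r‖ = 1)
    (hs : ‖s‖ = 1) (hh : 0 < h) (hh1 : h < 1) (hq : ‖q‖ ≤ h ^ 2) (hb : ‖b‖ ≤ h ^ 4)
    (hc : ‖c‖ ≤ h ^ 6) (hc0 : c ≠ 0) (hm : ‖m‖ = h ^ 2) (hθ₀ : θ₀ ^ 2 = -(r * s) * m) :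
    ∃ x, h * ‖x‖ = ‖c‖ ∧ ‖-(r * s) * θ₀ * x - c‖ < ‖c‖ ∧
      HasInverseBranch (nfMap r s q b c) (nfReg r s) (ratDeriv (nfNum q b c) (nfDen r s)) 2
        m (h ^ 2) x ‖x‖ (h * (h / ‖x‖)) := by
  have h20 : (2 : L) ≠ 0 := by intro h; simp [h] at h2
  have pw : ∀ {i j : ℕ}, j ≤ i → h ^ i ≤ h ^ j := fun hij =>
    pow_le_pow_of_le_one hh.le hh1.le hij
  have pwlt : ∀ {i j : ℕ}, j < i → h ^ i < h ^ j := fun hij =>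
    pow_lt_pow_right_of_lt_one₀ hh hh1 hij
  have hrs : ‖r * s‖ = 1 := by rw [norm_mul, hr, hs, one_mul]
  have nθ₀ : ‖θ₀‖ = h := by
    have : ‖θ₀‖ ^ 2 = h ^ 2 := by rw [← norm_pow, hθ₀, norm_mul, norm_neg, hrs, hm, one_mul]
    exact (pow_left_inj₀ (norm_nonneg _) hh.le two_ne_zero).1 this
  have ha : ‖q - r * m‖ ≤ h ^ 2 := um_sub_le hq (by rw [norm_mul, hr, hm, one_mul])
  have n2θ : ‖2 * θ₀ ^ 2‖ = h ^ 2 := by rw [norm_mul, norm_pow, h2, nθ₀, one_mul]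
  have ka : ∀ z : L, ‖z‖ = h → ‖2 * (q - r * m) * z + b‖ < h ^ 2 := fun z hz => by
    refine um_add_lt ?_ (hb.trans_lt (pwlt (by norm_num)))
    calc _ ≤ h ^ 2 * h := norm_mul_le_mul (norm_two_mul_le ha) hz.le
      _ = h ^ 3 := by ring
      _ < _ := pwlt (by norm_num)
  have k₀ : ‖3 * θ₀ ^ 2 + 2 * (q - r * m) * θ₀ + (b + r * s * m)‖ = h ^ 2 := by
    refine um_norm_eq n2θ ?_
    have : 3 * θ₀ ^ 2 + 2 * (q - r * m) * θ₀ + (b + r * s * m) - 2 * θ₀ ^ 2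
        = 2 * (q - r * m) * θ₀ + b := by linear_combination hθ₀
    rw [this]
    exact ka _ nθ₀
  obtain ⟨θ, hθ, hθn⟩ := exists_cubic_root_near h20 (a := q - r * m) (b := b + r * s * m) (c := c)
    (y := θ₀) (ρ := h) (by
      rw [k₀]
      have : θ₀ ^ 3 + (q - r * m) * θ₀ ^ 2 + (b + r * s * m) * θ₀ + c
        = (q - r * m) * θ₀ ^ 2 + b * θ₀ + c := by linear_combination θ₀ * hθ₀
      rw [this]
      calc _ ≤ h ^ 4 := by
            refine um_add_le (um_add_le ?_ ?_) (hc.trans (pw (by norm_num)))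
            · calc _ ≤ h ^ 2 * h ^ 2 := norm_mul_le_mul ha (by rw [norm_pow, nθ₀])
                _ = _ := by ring
            · calc _ ≤ h ^ 4 * h := norm_mul_le_mul hb nθ₀.le
                _ = h ^ 5 := by ring
                _ ≤ _ := pw (by norm_num)
        _ < h ^ 3 := pwlt (by norm_num)
        _ = _ := by ring)
  have nθ : ‖θ‖ = h := um_norm_eq nθ₀ hθn
  have nθs : ‖θ - s‖ = 1 := um_norm_eq (y := -s) (by simpa) (by simpa [nθ])
  have k₁ : ‖3 * θ ^ 2 + 2 * (q - r * m) * θ + (b + r * s * m)‖ = h ^ 2 := by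
    refine um_norm_eq n2θ ?_
    have : 3 * θ ^ 2 + 2 * (q - r * m) * θ + (b + r * s * m) - 2 * θ₀ ^ 2
        = (θ - θ₀) * (3 * (θ + θ₀)) + (2 * (q - r * m) * θ + b) := by linear_combination hθ₀
    rw [this]
    refine um_add_lt ?_ (ka _ nθ)
    rw [sq]
    exact norm_mul_lt_mul hθn (norm_three_mul_le (um_add_le nθ.le nθ₀.le)) hh
  have B1 := nfMap_hasInverseBranch h2 (q := q) (b := b) (c := c) (t := m) (σ := h ^ 2) hr hh
    (by linear_combination hθ) nθ.ge (hh1.le.trans_eq nθs.symm)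
    (by rw [← norm_pos_iff, k₁]; positivity)
    (by
      rw [k₁, sq]
      gcongr
      exact um_add_le (norm_three_mul_le nθ.le) (ha.trans (by simpa using pw one_le_two)))
    k₁.ge (by rw [k₁, nθ, nθs, mul_one])
  rw [k₁, nθ, nθs, mul_one, sq, mul_div_assoc, div_self hh.ne', mul_one, ← sq] at B1
  have ha' : ‖q - r * θ‖ ≤ h :=
    um_sub_le (hq.trans (by simpa using pw one_le_two)) (by rw [norm_mul, hr, nθ, one_mul])
  have hβ : ‖b + r * s * θ‖ = h := by
    refine um_norm_eq (y := r * s * θ) (by rw [norm_mul, hrs, nθ, one_mul]) ?_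
    rw [add_sub_cancel_right]
    exact hb.trans_lt (by simpa using pwlt (show 1 < 4 by norm_num))
  obtain ⟨x, hx, hxn⟩ := exists_cubic_root_near h20 (a := q - r * θ) (b := b + r * s * θ) (c := c)
    (y := 0) (ρ := h ^ 3) (by
      simp only [ne_eq, OfNat.ofNat_ne_zero, not_false_eq_true, zero_pow, mul_zero, add_zero,
        zero_add, hβ]
      calc _ ≤ h ^ 6 := hc
        _ < h ^ 4 := pwlt (by norm_num)
        _ = _ := by ring)
  rw [sub_zero] at hxn
  have hx0 : 0 < ‖x‖ := by rw [norm_pos_iff]; rintro rfl; simp [hc0] at hx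
  have hxh : ‖x‖ < h := hxn.trans (by simpa using pwlt (show 1 < 3 by norm_num))
  have nxs : ‖x - s‖ = 1 := um_norm_eq (y := -s) (by simpa) (by simpa using hxh.trans hh1)
  have hsm : ‖x ^ 2 + (q - r * θ) * x + b‖ < h := by
    refine um_add_lt (um_add_lt ?_ ?_) (hb.trans_lt (by simpa using pwlt (show 1 < 4 by norm_num)))
    · rw [norm_pow]
      calc ‖x‖ ^ 2 ≤ h ^ 2 := by gcongr
        _ < h := by simpa using pwlt (show 1 < 2 by norm_num)
    · calc _ ≤ h * h := norm_mul_le_mul ha' hxh.le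
        _ = h ^ 2 := by ring
        _ < h := by simpa using pwlt (show 1 < 2 by norm_num)
  have nx : h * ‖x‖ = ‖c‖ := by
    have e : c = -(x ^ 2 + (q - r * θ) * x + (b + r * s * θ)) * x := by linear_combination hx
    have : ‖x ^ 2 + (q - r * θ) * x + (b + r * s * θ)‖ = h := by
      refine um_norm_eq (y := r * s * θ) (by rw [norm_mul, hrs, nθ, one_mul]) ?_
      convert hsm using 2; ring
    rw [e, norm_mul, norm_neg, this]
  have k₂ : ‖3 * x ^ 2 + 2 * (q - r * θ) * x + (b + r * s * θ)‖ = h := by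
    refine um_norm_eq hβ ?_
    have : 3 * x ^ 2 + 2 * (q - r * θ) * x + (b + r * s * θ) - (b + r * s * θ)
        = (3 * x + 2 * (q - r * θ)) * x := by ring
    rw [this]
    calc _ ≤ h * h := norm_mul_le_mul (um_add_le (norm_three_mul_le hxh.le) (norm_two_mul_le ha'))
          hxh.le
      _ < h := by nlinarith
  have B2 := nfMap_hasInverseBranch h2 (q := q) (b := b) (c := c) (t := θ) (σ := h) hr hx0
    (by linear_combination hx) le_rfl (hxh.le.trans (hh1.le.trans_eq nxs.symm))
    (by rw [← norm_pos_iff, k₂]; exact hh)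
    (by
      rw [k₂]
      calc _ ≤ h * 1 := by
            gcongr
            · exact um_add_le (norm_three_mul_le hxh.le) ha'
            · exact (hxh.trans hh1).le
        _ = h := mul_one _)
    (by rw [k₂]; nlinarith) (by rw [k₂, nxs, mul_one])
  rw [k₂, nxs, mul_one] at B2
  refine ⟨x, nx, ?_, B1.comp B2 hh.le subset_rfl⟩
  have : -(r * s) * θ₀ * x - c = (r * s) * (θ - θ₀) * x + (x ^ 2 + (q - r * θ) * x + b) * x := by
    linear_combination -hx
  rw [this, ← nx]
  refine um_add_lt ?_ (norm_mul_lt_mul hsm le_rfl hx0)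
  refine norm_mul_lt_mul ?_ le_rfl hx0
  rwa [norm_mul, hrs, one_mul]

/-- The last step of the construction of a cycle of period `3`. -/
lemma nfMap_cycle_of_two_step_branch [CompleteSpace L] (h2 : ‖(2 : L)‖ = 1)
    {r s q b c m x y : L} {R ρ h : ℝ} (hr : ‖r‖ = 1) (hs : ‖s‖ = 1) (hh : 0 < h) (hR : R = h ^ 2)
    (hR1 : R < 1) (hm : ‖m‖ = R) (hx : x ≠ 0)
    (hB : HasInverseBranch (nfMap r s q b c) (nfReg r s) (ratDeriv (nfNum q b c) (nfDen r s)) 2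
      m R x ‖x‖ (h * (h / ‖x‖)))
    (hy : y ^ 3 + q * y ^ 2 + b * y + c = x * (r * y * (y - s))) (hym : ‖y - m‖ < R)
    (hρ : 0 < ρ) (hρR : ρ ≤ R)
    (hk2 : ‖3 * y + (q - r * x)‖ * ρ ≤ ‖3 * y ^ 2 + 2 * (q - r * x) * y + (b + r * s * x)‖)
    (hkρ : ρ ^ 2 ≤ ‖3 * y ^ 2 + 2 * (q - r * x) * y + (b + r * s * x)‖)
    (hσ : ‖x‖ * R ≤ ‖3 * y ^ 2 + 2 * (q - r * x) * y + (b + r * s * x)‖ * ρ)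
    (hkx : ‖x‖ < ‖3 * y ^ 2 + 2 * (q - r * x) * y + (b + r * s * x)‖) :
    HasShortRepellingCycle (nfMap r s q b c) (nfReg r s) (ratDeriv (nfNum q b c) (nfDen r s)) := by
  have hR0 : 0 < R := hρ.trans_le hρR
  have ny : ‖y‖ = R := um_norm_eq hm hym
  have nys : ‖y - s‖ = 1 := um_norm_eq (y := -s) (by simpa) (by simpa [ny])
  have hx0 : 0 < ‖x‖ := norm_pos_iff.2 hx
  have B := nfMap_hasInverseBranch h2 hr hρ hy (hρR.trans_eq ny.symm)
    (hρR.trans (hR1.le.trans_eq nys.symm)) (norm_pos_iff.1 (hx0.trans hkx)) hk2 hkρ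
    (σ := ‖x‖) (by rwa [ny, nys, mul_one])
  refine (hB.comp B (by positivity) subset_rfl).hasShortRepellingCycle (by simp) ?_ hym hρR
  have e : h * (h / ‖x‖) * (‖3 * y ^ 2 + 2 * (q - r * x) * y + (b + r * s * x)‖ / R)
      = ‖3 * y ^ 2 + 2 * (q - r * x) * y + (b + r * s * x)‖ / ‖x‖ := by
    rw [hR]; field_simp
  rw [ny, nys, mul_one, e, one_lt_div hx0]
  exact hkx

/-- A cubic with small linear coefficient has a root which is at least as far from the other
roots as from `0`. -/
lemma exists_separated_root (h2 : ‖(2 : L)‖ = 1) (h3 : ‖(3 : L)‖ = 1) {a b d : L} {R : ℝ}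
    (hR : 0 < R) (hb : ‖b‖ * R ≤ ‖d‖) (hd : ‖d‖ < R ^ 3) (hd0 : d ≠ 0) :
    ∃ v w₁ w₂ : L, a = -(v + w₁ + w₂) ∧ b = v * w₁ + v * w₂ + w₁ * w₂ ∧ d = -(v * w₁ * w₂) ∧
      ‖v‖ < R ∧ max ‖v‖ ‖w₁‖ ≤ ‖v - w₁‖ ∧ max ‖v‖ ‖w₂‖ ≤ ‖v - w₂‖ := by
  have h20 : (2 : L) ≠ 0 := by intro h; simp [h] at h2
  obtain ⟨u, v, w, ha, hb', hd', huv, hvw⟩ : ∃ u v w : L, a = -(u + v + w) ∧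
      b = u * v + u * w + v * w ∧ d = -(u * v * w) ∧ ‖v‖ ≤ ‖u‖ ∧ ‖w‖ ≤ ‖v‖ := by
    obtain ⟨u, v, w, e1, e2, e3⟩ := exists_cubic_roots h20 a b d
    rcases le_total ‖v‖ ‖u‖ with k1 | k1 <;> rcases le_total ‖w‖ ‖v‖ with k2 | k2 <;>
      rcases le_total ‖w‖ ‖u‖ with k3 | k3
    · exact ⟨u, v, w, e1, e2, e3, k1, k2⟩
    · exact ⟨u, v, w, e1, e2, e3, k1, k2⟩
    · exact ⟨u, w, v, by rw [e1]; ring, by rw [e2]; ring, by rw [e3]; ring, k3, k2⟩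
    · exact ⟨w, u, v, by rw [e1]; ring, by rw [e2]; ring, by rw [e3]; ring, k3, k1⟩
    · exact ⟨v, u, w, by rw [e1]; ring, by rw [e2]; ring, by rw [e3]; ring, k1, k3⟩
    · exact ⟨v, w, u, by rw [e1]; ring, by rw [e2]; ring, by rw [e3]; ring, k2, k3⟩
    · exact ⟨w, v, u, by rw [e1]; ring, by rw [e2]; ring, by rw [e3]; ring, k2, k1⟩
    · exact ⟨w, v, u, by rw [e1]; ring, by rw [e2]; ring, by rw [e3]; ring, k2, k1⟩
  have nd : ‖d‖ = ‖u‖ * ‖v‖ * ‖w‖ := by rw [hd', norm_neg, norm_mul, norm_mul]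
  have hd0' : 0 < ‖u‖ * ‖v‖ * ‖w‖ := nd ▸ norm_pos_iff.2 hd0
  have hu0 : 0 < ‖u‖ := norm_pos_iff.2 (by rintro rfl; simp at hd0')
  have hv0 : 0 < ‖v‖ := norm_pos_iff.2 (by rintro rfl; simp at hd0')
  have hw0 : 0 < ‖w‖ := norm_pos_iff.2 (by rintro rfl; simp at hd0')
  have hwR : ‖w‖ < R := by
    by_contra! h
    have : R ^ 3 ≤ ‖u‖ * ‖v‖ * ‖w‖ := by
      calc R ^ 3 = R * R * R := by ring
        _ ≤ _ := by gcongr <;> linarith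
    linarith
  have hbuv : ‖b‖ < ‖u‖ * ‖v‖ := by
    refine lt_of_mul_lt_mul_right ?_ hR.le
    calc ‖b‖ * R ≤ ‖u‖ * ‖v‖ * ‖w‖ := hb.trans_eq nd
      _ < _ := by gcongr
  have hvw' : ‖v‖ = ‖w‖ := by
    refine le_antisymm ?_ hvw
    by_contra! h
    have e1 : ‖u * w‖ < ‖u‖ * ‖v‖ := by rw [norm_mul]; gcongr
    have e2 : ‖v * w‖ < ‖u‖ * ‖v‖ := by
      rw [norm_mul]
      calc ‖v‖ * ‖w‖ ≤ ‖u‖ * ‖w‖ := by gcongr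
        _ < _ := by gcongr
    have := um_sub_lt (um_sub_lt hbuv e1) e2
    rw [hb'] at this
    have e3 : u * v + u * w + v * w - u * w - v * w = u * v := by ring
    rw [e3, norm_mul] at this
    exact this.false
  rcases huv.eq_or_lt with huv' | huv'
  · set e := ‖u‖ with he
    have hw : ‖w‖ = e := hvw'.symm.trans huv'
    have key : ∀ x y z : L, ‖x‖ = e → ‖y‖ = e → ‖z‖ = e → ‖x * y + x * z + y * z‖ < e * e →
        ‖x - y‖ < e → ‖z - x‖ = e ∧ ‖z - y‖ = e := by
      intro x y z hx hy hz hs hxy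
      have t : ‖z - x‖ = e := by
        refine le_antisymm (um_sub_le hz.le hx.le) ?_
        by_contra! h
        have i1 : ‖x * (x - y) + z * (x - y) + 2 * (x * (x - z))‖ < e * e := by
          rw [norm_sub_rev] at h
          refine um_add_lt (um_add_lt ?_ ?_) ?_
          · rw [norm_mul, hx]; gcongr
          · rw [norm_mul, hz]; gcongr
          · rw [norm_mul, norm_mul, h2, one_mul, hx]; gcongr
        have i2 := um_add_lt hs i1
        have : x * y + x * z + y * z + (x * (x - y) + z * (x - y) + 2 * (x * (x - z)))
          = 3 * (x * x) := by ring
        rw [this, norm_mul, norm_mul, h3, one_mul, hx] at i2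
        exact i2.false
      refine ⟨t, um_norm_eq t ?_⟩
      convert hxy using 2; ring
    rw [huv'] at hbuv
    by_cases c1 : ‖u - v‖ < e
    · obtain ⟨t1, t2⟩ := key u v w rfl huv' hw (hb' ▸ hbuv) c1
      exact ⟨w, u, v, by rw [ha]; ring, by rw [hb']; ring, by rw [hd']; ring, hwR,
        by rw [t1, hw, ← he, max_self], by rw [t2, hw, huv']; simp⟩
    by_cases c2 : ‖u - w‖ < e
    · obtain ⟨t1, t2⟩ := key u w v rfl hw huv' (by
        have : u * w + u * v + w * v = b := by rw [hb']; ring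
        rwa [this]) c2
      exact ⟨v, u, w, by rw [ha]; ring, by rw [hb']; ring, by rw [hd']; ring, hvw' ▸ hwR,
        by rw [t1, huv', ← he, max_self], by rw [t2, hw, huv']; simp⟩
    · push Not at c1 c2
      exact ⟨u, v, w, ha, hb', hd', by rw [← he, ← hw]; exact hwR,
        by rw [huv', ← he, max_self]; exact c1, by rw [hw, ← he, max_self]; exact c2⟩
  · have t1 : ‖w - u‖ = ‖u‖ := um_norm_eq (y := -u) (norm_neg _) (by simpa [← hvw'])
    have t2 : ‖v + w‖ < ‖v‖ := by
      have e2 : ‖v * w‖ < ‖u‖ * ‖v‖ := by rw [norm_mul, ← hvw']; gcongr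
      have e3 := um_sub_lt hbuv e2
      have : b - v * w = u * (v + w) := by rw [hb']; ring
      rw [this, norm_mul] at e3
      exact lt_of_mul_lt_mul_left e3 hu0.le
    have t3 : ‖w - v‖ = ‖v‖ := by
      refine um_norm_eq (y := 2 * w) (by rw [norm_mul, h2, one_mul, hvw']) ?_
      have : w - v - 2 * w = -(v + w) := by ring
      rwa [this, norm_neg]
    exact ⟨w, u, v, by rw [ha]; ring, by rw [hb']; ring, by rw [hd']; ring, hwR,
      by rw [t1]; exact max_le (hvw.trans huv) le_rfl, by rw [t3]; exact max_le hvw le_rfl⟩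

/-- The roots of a cubic with small coefficients and nonzero constant term: there is a root of
maximal norm `R`, and the coefficients are bounded by powers of `R`. -/
lemma exists_max_root (h20 : (2 : L) ≠ 0) {q b c : L} (hq : ‖q‖ < 1) (hb : ‖b‖ < 1) (hc : ‖c‖ < 1)
    (hc0 : c ≠ 0) : ∃ m : L, m ^ 3 + q * m ^ 2 + b * m + c = 0 ∧ m ≠ 0 ∧ ‖m‖ < 1 ∧ ‖q‖ ≤ ‖m‖ ∧
      ‖b‖ ≤ ‖m‖ ^ 2 ∧ ‖c‖ ≤ ‖m‖ ^ 3 := by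
  have hlt : ∀ m : L, m ^ 3 + q * m ^ 2 + b * m + c = 0 → ‖m‖ < 1 := by
    intro m hm
    by_contra! h
    have e : m ^ 3 = -(q * m ^ 2 + b * m + c) := by linear_combination hm
    have : ‖m ^ 3‖ < ‖m‖ ^ 3 := by
      rw [e, norm_neg]
      have h1 : ‖m‖ ^ 2 ≤ ‖m‖ ^ 3 := pow_le_pow_right₀ h (by norm_num)
      have h3 : ‖m‖ ≤ ‖m‖ ^ 3 := le_self_pow₀ h (by norm_num)
      have h4 : 1 ≤ ‖m‖ ^ 3 := one_le_pow₀ h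
      refine um_add_lt (um_add_lt ?_ ?_) (hc.trans_le h4)
      · rw [norm_mul, norm_pow]; nlinarith [norm_nonneg q, norm_nonneg m]
      · rw [norm_mul]; nlinarith [norm_nonneg b, norm_nonneg m]
    rw [norm_pow] at this
    exact this.false
  have main : ∀ u v w : L, q = -(u + v + w) → b = u * v + u * w + v * w → c = -(u * v * w) →
      ‖v‖ ≤ ‖u‖ → ‖w‖ ≤ ‖u‖ → ∃ m : L, m ^ 3 + q * m ^ 2 + b * m + c = 0 ∧ m ≠ 0 ∧ ‖m‖ < 1 ∧
      ‖q‖ ≤ ‖m‖ ∧ ‖b‖ ≤ ‖m‖ ^ 2 ∧ ‖c‖ ≤ ‖m‖ ^ 3 := by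
    intro u v w e1 e2 e3 hv hw
    have hu : u ^ 3 + q * u ^ 2 + b * u + c = 0 := by rw [e1, e2, e3]; ring
    refine ⟨u, hu, by rintro rfl; simp at e3; exact hc0 e3, hlt u hu, ?_, ?_, ?_⟩
    · rw [e1, norm_neg]; exact um_add_le (um_add_le le_rfl hv) hw
    · rw [e2, sq]
      exact um_add_le (um_add_le (norm_mul_le_mul le_rfl hv) (norm_mul_le_mul le_rfl hw))
        (norm_mul_le_mul hv hw)
    · rw [e3, norm_neg]
      calc _ ≤ ‖u‖ * ‖u‖ * ‖u‖ := norm_mul_le_mul (norm_mul_le_mul le_rfl hv) hw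
        _ = _ := by ring
  obtain ⟨u, v, w, e1, e2, e3⟩ := exists_cubic_roots h20 q b c
  rcases le_total ‖v‖ ‖u‖ with k1 | k1 <;> rcases le_total ‖w‖ ‖v‖ with k2 | k2
  · exact main u v w e1 e2 e3 k1 (k2.trans k1)
  · rcases le_total ‖w‖ ‖u‖ with k3 | k3
    · exact main u v w e1 e2 e3 k1 k3
    · exact main w u v (by rw [e1]; ring) (by rw [e2]; ring) (by rw [e3]; ring) k3 k2
  · exact main v u w (by rw [e1]; ring) (by rw [e2]; ring) (by rw [e3]; ring) k1 k2
  · exact main w u v (by rw [e1]; ring) (by rw [e2]; ring) (by rw [e3]; ring) (k1.trans k2) k2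

lemma nfMap_cycle_of_norm_s [CompleteSpace L] (h2 : ‖(2 : L)‖ = 1) (h3 : ‖(3 : L)‖ = 1)
    {r s q b c : L} (hr : ‖r‖ = 1) (hq : ‖q‖ < 1) (hs : ‖s‖ = 1) (hb : ‖b‖ < 1) (hc : ‖c‖ < 1)
    (hc0 : c ≠ 0) :
    HasShortRepellingCycle (nfMap r s q b c) (nfReg r s) (ratDeriv (nfNum q b c) (nfDen r s)) := by
  have h20 : (2 : L) ≠ 0 := by intro h; simp [h] at h2
  have h30 : (3 : L) ≠ 0 := by intro h; simp [h] at h3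
  obtain ⟨m, hm, hm0, hm1, hqm, hbm, hcm⟩ := exists_max_root h20 hq hb hc hc0
  obtain ⟨h, hh, hhm⟩ : ∃ h : ℝ, 0 < h ∧ ‖m‖ = h ^ 2 :=
    ⟨√‖m‖, Real.sqrt_pos.2 (norm_pos_iff.2 hm0), (Real.sq_sqrt (norm_nonneg _)).symm⟩
  have hh1 : h < 1 := by
    rw [hhm] at hm1
    exact (pow_lt_one_iff_of_nonneg hh.le two_ne_zero).1 hm1
  rw [hhm] at hqm hbm hcm hm1
  rw [← pow_mul] at hbm hcm
  have pw : ∀ {i j : ℕ}, j ≤ i → h ^ i ≤ h ^ j := fun hij =>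
    pow_le_pow_of_le_one hh.le hh1.le hij
  have pwlt : ∀ {i j : ℕ}, j < i → h ^ i < h ^ j := fun hij =>
    pow_lt_pow_right_of_lt_one₀ hh hh1 hij
  have hxc : ∀ {x : L}, h * ‖x‖ = ‖c‖ → ‖x‖ ≤ h ^ 5 := by
    intro x hx
    refine le_of_mul_le_mul_left ?_ hh
    calc h * ‖x‖ ≤ h ^ 6 := hx.trans_le hcm
      _ = h * h ^ 5 := by ring
  have hx0 : ∀ {x : L}, h * ‖x‖ = ‖c‖ → x ≠ 0 := by
    rintro x hx rfl
    rw [norm_zero, mul_zero] at hx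
    exact hc0 (norm_eq_zero.1 hx.symm)
  have nms : ∀ {z : L}, ‖z‖ = h ^ 2 → ‖z - s‖ = 1 := fun hz =>
    um_norm_eq (y := -s) (by simpa) (by rwa [sub_neg_eq_add, sub_add_cancel, hz])
  have n2ms : ∀ {z : L}, ‖z‖ = h ^ 2 → ‖2 * z - s‖ ≤ 1 := fun hz =>
    um_sub_le (norm_two_mul_le (hz.trans_lt hm1).le) hs.le
  have hder : ‖3 * m ^ 2 + 2 * q * m + b‖ ≤ h ^ 4 := by
    refine um_add_le (um_add_le (norm_three_mul_le (by rw [norm_pow, hhm, ← pow_mul])) ?_) hbm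
    calc _ ≤ h ^ 2 * h ^ 2 := norm_mul_le_mul (norm_two_mul_le hqm) hhm.le
      _ = _ := by ring
  rcases hder.eq_or_lt with hder | hder
  · obtain ⟨θ, hθ⟩ := IsAlgClosed.exists_pow_nat_eq (-(r * s) * m) (n := 2) two_pos
    obtain ⟨x, hx, -, B⟩ := nfMap_two_step_branch h2 hr hs hh hh1 hqm hbm hcm hc0 hhm hθ
    have nrx : ‖r * x‖ ≤ h ^ 5 := by rw [norm_mul, hr, one_mul]; exact hxc hx
    have e0 : ‖3 * m ^ 2 + 2 * (q - r * x) * m + (b + r * s * x)‖ = h ^ 4 := by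
      refine um_norm_eq hder ?_
      have : 3 * m ^ 2 + 2 * (q - r * x) * m + (b + r * s * x) - (3 * m ^ 2 + 2 * q * m + b)
          = -((r * x) * (2 * m - s)) := by ring
      rw [this, norm_neg]
      calc _ ≤ h ^ 5 * 1 := norm_mul_le_mul nrx (n2ms hhm)
        _ < _ := by rw [mul_one]; exact pwlt (by norm_num)
    obtain ⟨y, hy, hym⟩ := exists_cubic_root_near h20 (a := q - r * x) (b := b + r * s * x) (c := c)
      (y := m) (ρ := h ^ 2) (by
        rw [e0]
        have : m ^ 3 + (q - r * x) * m ^ 2 + (b + r * s * x) * m + c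
          = -((r * x) * (m * (m - s))) := by linear_combination hm
        rw [this, norm_neg]
        calc _ ≤ h ^ 5 * (h ^ 2 * 1) := norm_mul_le_mul nrx (norm_mul_le_mul hhm.le (nms hhm).le)
          _ = h ^ 7 := by ring
          _ < h ^ 6 := pwlt (by norm_num)
          _ = _ := by ring)
    have ny : ‖y‖ = h ^ 2 := um_norm_eq hhm hym
    have nqx : ‖q - r * x‖ ≤ h ^ 2 := um_sub_le hqm (nrx.trans (pw (by norm_num)))
    have e1 : ‖3 * y ^ 2 + 2 * (q - r * x) * y + (b + r * s * x)‖ = h ^ 4 := by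
      refine um_norm_eq e0 ?_
      have : 3 * y ^ 2 + 2 * (q - r * x) * y + (b + r * s * x)
          - (3 * m ^ 2 + 2 * (q - r * x) * m + (b + r * s * x))
          = (y - m) * (3 * (y + m) + 2 * (q - r * x)) := by ring
      rw [this]
      calc _ < h ^ 2 * h ^ 2 := norm_mul_lt_mul hym (um_add_le
            (norm_three_mul_le (um_add_le ny.le hhm.le)) (norm_two_mul_le nqx)) (by positivity)
        _ = _ := by ring
    refine nfMap_cycle_of_two_step_branch h2 hr hs hh rfl hm1 hhm (hx0 hx) B
      (by linear_combination hy) hym (by positivity) le_rfl ?_ ?_ ?_ ?_ <;> rw [e1]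
    · calc _ ≤ h ^ 2 * h ^ 2 := by gcongr; exact um_add_le (norm_three_mul_le ny.le) nqx
        _ = _ := by ring
    · rw [← pow_mul]
    · gcongr; exact (hxc hx).trans (pw (by norm_num))
    · exact (hxc hx).trans_lt (pwlt (by norm_num))
  · obtain ⟨z, hz, hzm⟩ : ∃ z, 3 * z ^ 2 + 2 * q * z + b = 0 ∧ ‖z - m‖ < h ^ 2 := by
      obtain ⟨u, v, e1, e2⟩ := exists_quadratic_roots h20 (2 * q / 3) (b / 3)
      rw [div_eq_iff h30] at e1 e2
      by_contra! hn
      have hu := hn u (by linear_combination u * e1 + e2)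
      have hv := hn v (by linear_combination v * e1 + e2)
      have : 3 * m ^ 2 + 2 * q * m + b = 3 * ((u - m) * (v - m)) := by
        linear_combination m * e1 + e2
      rw [this, norm_mul, norm_mul, h3, one_mul] at hder
      have : h ^ 2 * h ^ 2 ≤ ‖u - m‖ * ‖v - m‖ := by gcongr
      have e : h ^ 2 * h ^ 2 = h ^ 4 := by ring
      linarith
    have nz : ‖z‖ = h ^ 2 := um_norm_eq hhm hzm
    have nNz : ‖z ^ 3 + q * z ^ 2 + b * z + c‖ < h ^ 6 := by
      have : z ^ 3 + q * z ^ 2 + b * z + c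
          = -((z - m) * ((z - m) * (3 * z + q - (z - m)))) := by
        linear_combination hm + (z - m) * hz
      rw [this, norm_neg]
      calc _ < h ^ 2 * (h ^ 2 * h ^ 2) := norm_mul_lt_mul hzm (norm_mul_le_mul hzm.le
            (um_sub_le (um_add_le (norm_three_mul_le nz.le) hqm) hzm.le)) (by positivity)
        _ = _ := by ring
    obtain ⟨θ, hθ⟩ := IsAlgClosed.exists_pow_nat_eq (-(r * s) * z) (n := 2) two_pos
    have hrs : ‖-(r * s)‖ = 1 := by rw [norm_neg, norm_mul, hr, hs, one_mul]
    have nθ : ‖θ‖ = h := by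
      have : ‖θ‖ ^ 2 = h ^ 2 := by rw [← norm_pow, hθ, norm_mul, hrs, nz, one_mul]
      exact (pow_left_inj₀ (norm_nonneg _) hh.le two_ne_zero).1 this
    have nD : ‖r * z * (z - s)‖ = h ^ 2 := by
      rw [norm_mul, norm_mul, hr, nms nz, nz, one_mul, mul_one]
    obtain ⟨x, hx, hd, B⟩ : ∃ x, h * ‖x‖ = ‖c‖ ∧
        ‖x‖ * h ^ 2 ≤ ‖z ^ 3 + q * z ^ 2 + b * z + c - x * (r * z * (z - s))‖ ∧
        HasInverseBranch (nfMap r s q b c) (nfReg r s) (ratDeriv (nfNum q b c) (nfDen r s)) 2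
          z (h ^ 2) x ‖x‖ (h * (h / ‖x‖)) := by
      obtain ⟨x, hx, hxθ, B⟩ := nfMap_two_step_branch h2 hr hs hh hh1 hqm hbm hcm hc0 nz hθ
      obtain ⟨x', hx', hxθ', B'⟩ := nfMap_two_step_branch h2 hr hs hh hh1 hqm hbm hcm hc0 nz
        (θ₀ := -θ) (by rw [neg_sq, hθ])
      have nxx : ‖x'‖ = ‖x‖ := mul_left_cancel₀ hh.ne' (hx'.trans hx.symm)
      have hsum : ‖x + x'‖ < ‖x‖ := by
        have := um_sub_lt hxθ hxθ'
        have e : -(r * s) * θ * x - c - (-(r * s) * -θ * x' - c) = -(r * s) * θ * (x + x') := by ring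
        rw [e, norm_mul, norm_mul, hrs, nθ, one_mul, ← hx] at this
        exact lt_of_mul_lt_mul_left this hh.le
      have hdiff : ‖x' - x‖ = ‖x‖ := by
        refine um_norm_eq (y := -(2 * x)) (by rw [norm_neg, norm_mul, h2, one_mul]) ?_
        convert hsum using 2; ring
      by_contra! hn
      have i1 := hn x hx
      have i2 := hn x' hx'
      by_cases j1 : ‖x‖ * h ^ 2 ≤ ‖z ^ 3 + q * z ^ 2 + b * z + c - x * (r * z * (z - s))‖
      · exact i1 j1 B
      by_cases j2 : ‖x'‖ * h ^ 2 ≤ ‖z ^ 3 + q * z ^ 2 + b * z + c - x' * (r * z * (z - s))‖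
      · exact i2 j2 B'
      push Not at j1 j2
      rw [nxx] at j2
      have := um_sub_lt j1 j2
      have e : z ^ 3 + q * z ^ 2 + b * z + c - x * (r * z * (z - s))
        - (z ^ 3 + q * z ^ 2 + b * z + c - x' * (r * z * (z - s)))
        = (x' - x) * (r * z * (z - s)) := by ring
      rw [e, norm_mul, hdiff, nD] at this
      exact this.false
    have nx := hxc hx
    have nrx : ‖r * x‖ = ‖x‖ := by rw [norm_mul, hr, one_mul]
    set d := z ^ 3 + q * z ^ 2 + b * z + c - x * (r * z * (z - s)) with hddef
    have hdlt : ‖d‖ < (h ^ 2) ^ 3 := by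
      rw [← pow_mul]
      refine um_sub_lt nNz ?_
      calc _ ≤ h ^ 5 * h ^ 2 := norm_mul_le_mul nx nD.le
        _ = h ^ 7 := by ring
        _ < _ := pwlt (by norm_num)
    have hxp : 0 < ‖x‖ := norm_pos_iff.2 (hx0 hx)
    have hd0 : d ≠ 0 := norm_pos_iff.1 (lt_of_lt_of_le (by positivity) hd)
    obtain ⟨v, w₁, w₂, f1, f2, f3, hv, hw1, hw2⟩ := exists_separated_root h2 h3
      (a := 3 * z + q - r * x) (b := -(r * x * (2 * z - s))) (d := d) (R := h ^ 2) (by positivity)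
      (by
        refine le_trans ?_ hd
        gcongr
        rw [norm_neg, ← mul_one ‖x‖]
        exact norm_mul_le_mul nrx.le (n2ms nz)) hdlt hd0
    have hk : 3 * (z + v) ^ 2 + 2 * (q - r * x) * (z + v) + (b + r * s * x)
        = (v - w₁) * (v - w₂) := by
      linear_combination hz + 2 * v * f1 + f2
    have hk2 : 3 * (z + v) + (q - r * x) = (v - w₁) + (v - w₂) := by linear_combination f1
    have hvp : 0 < ‖v‖ := norm_pos_iff.2 (by rintro rfl; exact hd0 (by rw [f3]; ring))
    have v1 : ‖v‖ ≤ ‖v - w₁‖ := (le_max_left _ _).trans hw1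
    have v2 : ‖v‖ ≤ ‖v - w₂‖ := (le_max_left _ _).trans hw2
    have hdk : ‖x‖ * h ^ 2 ≤ ‖v - w₁‖ * ‖v - w₂‖ * ‖v‖ := by
      refine hd.trans ?_
      rw [f3, norm_neg, norm_mul, norm_mul]
      calc ‖v‖ * ‖w₁‖ * ‖w₂‖ ≤ ‖v‖ * ‖v - w₁‖ * ‖v - w₂‖ := by
            gcongr
            · exact (le_max_right _ _).trans hw1
            · exact (le_max_right _ _).trans hw2
        _ = _ := by ring
    refine nfMap_cycle_of_two_step_branch h2 hr hs hh rfl hm1 nz (hx0 hx) B (y := z + v) (ρ := ‖v‖)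
      ?_ (by simpa using hv) hvp hv.le ?_ ?_ ?_ ?_
    · linear_combination hddef + f3 + v * f2 + v ^ 2 * f1 + v * hz
    · rw [hk, hk2, norm_mul]
      rcases le_total ‖v - w₁‖ ‖v - w₂‖ with i | i
      · calc _ ≤ ‖v - w₂‖ * ‖v - w₁‖ := by gcongr; exact um_add_le i le_rfl
          _ = _ := mul_comm _ _
      · gcongr; exact um_add_le le_rfl i
    · rw [hk, norm_mul, sq]; gcongr
    · rw [hk, norm_mul]; exact hdk
    · rw [hk, norm_mul]
      refine lt_of_mul_lt_mul_right (hdk.trans_lt ?_) (by positivity : 0 ≤ h ^ 2)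
      have : 0 < ‖v - w₁‖ * ‖v - w₂‖ := mul_pos (hvp.trans_le v1) (hvp.trans_le v2)
      gcongr

end DoublePole

section CoreTheorem

variable {L : Type*} [NontriviallyNormedField L] [IsUltrametricDist L] [IsAlgClosed L]
  [CompleteSpace L]

/-- A map in integral normal form with bad reduction at the pole `0` and nonconstant reduction
has a repelling cycle of period at most `3`. -/
lemma nfMap_cycle (h2 : ‖(2 : L)‖ = 1) (h3 : ‖(3 : L)‖ = 1) {r s q b c : L} (hr : ‖r‖ = 1)
    (hr1 : ‖1 + r‖ = 1) (hq : ‖q‖ ≤ 1) (hs : ‖s‖ ≤ 1) (hb : ‖b‖ ≤ 1) (hc : ‖c‖ < 1) (hc0 : c ≠ 0)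
    (hNs : s ^ 3 + q * s ^ 2 + b * s + c ≠ 0) (h : ‖q‖ = 1 ∨ ‖s‖ = 1 ∨ ‖b‖ = 1) :
    HasShortRepellingCycle (nfMap r s q b c) (nfReg r s) (ratDeriv (nfNum q b c) (nfDen r s)) := by
  rcases hb.eq_or_lt with hb | hb
  · exact nfMap_cycle_of_norm_b h2 hr hq hs hb hc hc0 hNs
  rcases hs.eq_or_lt with hs | hs <;> rcases hq.eq_or_lt with hq | hq
  · exact nfMap_cycle_of_norm_s_q h2 hr hq hs hb hc hc0 hNs
  · exact nfMap_cycle_of_norm_s h2 h3 hr hq hs hb hc hc0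
  · exact nfMap_cycle_of_norm_q h2 hr hr1 hq hs hb hc hc0 hNs
  · rcases h with h | h | h
    · exact absurd h hq.ne
    · exact absurd h hs.ne
    · exact absurd h hb.ne

end CoreTheorem

section Conjugation

variable {L : Type*} [Field L]

/-- The value at `(x, y)` of the cubic binary form with the coefficients of `P`. -/
def cubicForm (P : L[X]) (x y : L) : L :=
  P.coeff 0 * y ^ 3 + P.coeff 1 * x * y ^ 2 + P.coeff 2 * x ^ 2 * y + P.coeff 3 * x ^ 3

/-- The cubic binary forms of `P` and `Q` have no common projective zero. -/
def NoCommonZero (P Q : L[X]) : Prop :=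
  ∀ x y : L, cubicForm P x y = 0 → cubicForm Q x y = 0 → x = 0 ∧ y = 0

lemma homApply_three (P : L[X]) (A : Matrix (Fin 2) (Fin 2) L) :
    homApply 3 P A = C (cubicForm P (A 0 1) (A 1 1)) +
      C (3 * P.coeff 0 * A 1 0 * A 1 1 ^ 2
        + P.coeff 1 * (A 0 0 * A 1 1 ^ 2 + 2 * A 0 1 * A 1 0 * A 1 1)
        + P.coeff 2 * (2 * A 0 0 * A 0 1 * A 1 1 + A 0 1 ^ 2 * A 1 0)
        + 3 * P.coeff 3 * A 0 0 * A 0 1 ^ 2) * X +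
      C (3 * P.coeff 0 * A 1 0 ^ 2 * A 1 1
        + P.coeff 1 * (2 * A 0 0 * A 1 0 * A 1 1 + A 0 1 * A 1 0 ^ 2)
        + P.coeff 2 * (A 0 0 ^ 2 * A 1 1 + 2 * A 0 0 * A 0 1 * A 1 0)
        + 3 * P.coeff 3 * A 0 0 ^ 2 * A 0 1) * X ^ 2 +
      C (cubicForm P (A 0 0) (A 1 0)) * X ^ 3 := by
  simp only [homApply, cubicForm, Finset.sum_range_succ, Finset.sum_range_zero, map_add, map_mul,
    map_pow, map_ofNat]
  ring

lemma coeff_cubic (a b c d : L) (p : L[X]) (h : p = C a + C b * X + C c * X ^ 2 + C d * X ^ 3) :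
    p.coeff 0 = a ∧ p.coeff 1 = b ∧ p.coeff 2 = c ∧ p.coeff 3 = d := by
  subst h
  simp [coeff_X, coeff_C]

lemma homApply_coeff_zero (P : L[X]) (A : Matrix (Fin 2) (Fin 2) L) :
    (homApply 3 P A).coeff 0 = cubicForm P (A 0 1) (A 1 1) :=
  (coeff_cubic _ _ _ _ _ (homApply_three P A)).1

lemma homApply_coeff_one (P : L[X]) (A : Matrix (Fin 2) (Fin 2) L) :
    (homApply 3 P A).coeff 1 = 3 * P.coeff 0 * A 1 0 * A 1 1 ^ 2
        + P.coeff 1 * (A 0 0 * A 1 1 ^ 2 + 2 * A 0 1 * A 1 0 * A 1 1)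
        + P.coeff 2 * (2 * A 0 0 * A 0 1 * A 1 1 + A 0 1 ^ 2 * A 1 0)
        + 3 * P.coeff 3 * A 0 0 * A 0 1 ^ 2 :=
  (coeff_cubic _ _ _ _ _ (homApply_three P A)).2.1

lemma homApply_coeff_two (P : L[X]) (A : Matrix (Fin 2) (Fin 2) L) :
    (homApply 3 P A).coeff 2 = 3 * P.coeff 0 * A 1 0 ^ 2 * A 1 1
        + P.coeff 1 * (2 * A 0 0 * A 1 0 * A 1 1 + A 0 1 * A 1 0 ^ 2)
        + P.coeff 2 * (A 0 0 ^ 2 * A 1 1 + 2 * A 0 0 * A 0 1 * A 1 0)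
        + 3 * P.coeff 3 * A 0 0 ^ 2 * A 0 1 :=
  (coeff_cubic _ _ _ _ _ (homApply_three P A)).2.2.1

lemma homApply_coeff_three (P : L[X]) (A : Matrix (Fin 2) (Fin 2) L) :
    (homApply 3 P A).coeff 3 = cubicForm P (A 0 0) (A 1 0) :=
  (coeff_cubic _ _ _ _ _ (homApply_three P A)).2.2.2

lemma homApply_natDegree_le (P : L[X]) (A : Matrix (Fin 2) (Fin 2) L) :
    (homApply 3 P A).natDegree ≤ 3 := by
  rw [homApply_three]; compute_degree

lemma homApply_eval (P : L[X]) (A : Matrix (Fin 2) (Fin 2) L) (z : L) :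
    (homApply 3 P A).eval z = cubicForm P (A 0 0 * z + A 0 1) (A 1 0 * z + A 1 1) := by
  simp [homApply, cubicForm, Finset.sum_range_succ]

lemma cubicForm_homApply (P : L[X]) (A : Matrix (Fin 2) (Fin 2) L) (x y : L) :
    cubicForm (homApply 3 P A) x y = cubicForm P (A 0 0 * x + A 0 1 * y) (A 1 0 * x + A 1 1 * y) := by
  rw [cubicForm, homApply_coeff_zero, homApply_coeff_one, homApply_coeff_two, homApply_coeff_three]
  simp only [cubicForm]
  ring

lemma cubicForm_linear (P Q : L[X]) (a b x y : L) :
    cubicForm (C a * P + C b * Q) x y = a * cubicForm P x y + b * cubicForm Q x y := by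
  simp only [cubicForm, coeff_add, coeff_C_mul]
  ring

lemma cubicForm_one_right {P : L[X]} (hP : P.natDegree ≤ 3) (z : L) :
    cubicForm P z 1 = P.eval z := by
  rw [eval_eq_sum_range' (Nat.lt_succ_of_le hP)]
  simp [Finset.sum_range_succ, cubicForm]

lemma conjNum_natDegree_le (P Q : L[X]) (A : GL (Fin 2) L) : (conjNum 3 P Q A).natDegree ≤ 3 :=
  natDegree_add_le_of_degree_le (natDegree_C_mul_le _ _ |>.trans (homApply_natDegree_le _ _))
    (natDegree_C_mul_le _ _ |>.trans (homApply_natDegree_le _ _))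

lemma conjDen_natDegree_le (P Q : L[X]) (A : GL (Fin 2) L) : (conjDen 3 P Q A).natDegree ≤ 3 :=
  natDegree_add_le_of_degree_le (natDegree_C_mul_le _ _ |>.trans (homApply_natDegree_le _ _))
    (natDegree_C_mul_le _ _ |>.trans (homApply_natDegree_le _ _))

lemma NoCommonZero.conj {P Q : L[X]} (h : NoCommonZero P Q) (A : GL (Fin 2) L) :
    NoCommonZero (conjNum 3 P Q A) (conjDen 3 P Q A) := by
  intro x y h1 h2
  rw [conjNum, cubicForm_linear, cubicForm_homApply, cubicForm_homApply] at h1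
  rw [conjDen, cubicForm_linear, cubicForm_homApply, cubicForm_homApply] at h2
  have e1 : (A : Matrix (Fin 2) (Fin 2) L) * ((A⁻¹ : GL (Fin 2) L) : Matrix (Fin 2) (Fin 2) L) = 1 :=
    A.mul_inv
  have e2 : ((A⁻¹ : GL (Fin 2) L) : Matrix (Fin 2) (Fin 2) L) * (A : Matrix (Fin 2) (Fin 2) L) = 1 :=
    A.inv_mul
  set M := (A : Matrix (Fin 2) (Fin 2) L)
  set N := ((A⁻¹ : GL (Fin 2) L) : Matrix (Fin 2) (Fin 2) L)
  have a00 := congrFun (congrFun e1 0) 0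
  have a01 := congrFun (congrFun e1 0) 1
  have a10 := congrFun (congrFun e1 1) 0
  have a11 := congrFun (congrFun e1 1) 1
  have b00 := congrFun (congrFun e2 0) 0
  have b01 := congrFun (congrFun e2 0) 1
  have b10 := congrFun (congrFun e2 1) 0
  have b11 := congrFun (congrFun e2 1) 1
  simp only [Matrix.mul_apply, Fin.sum_univ_two, Matrix.one_apply_eq, ne_eq, Fin.isValue,
    zero_ne_one, not_false_eq_true, Matrix.one_apply_ne, one_ne_zero] at a00 a01 a10 a11 b00 b01 b10 b11
  set u := cubicForm P (M 0 0 * x + M 0 1 * y) (M 1 0 * x + M 1 1 * y)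
  set w := cubicForm Q (M 0 0 * x + M 0 1 * y) (M 1 0 * x + M 1 1 * y)
  have hu : u = 0 := by linear_combination M 0 0 * h1 + M 0 1 * h2 - u * a00 - w * a01
  have hw : w = 0 := by linear_combination M 1 0 * h1 + M 1 1 * h2 - u * a10 - w * a11
  obtain ⟨k1, k2⟩ := h _ _ hu hw
  constructor
  · linear_combination N 0 0 * k1 + N 0 1 * k2 - x * b00 - y * b01
  · linear_combination N 1 0 * k1 + N 1 1 * k2 - x * b10 - y * b11

lemma cubicForm_mul_mul (P : L[X]) (a x y : L) :
    cubicForm P (a * x) (a * y) = a ^ 3 * cubicForm P x y := by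
  simp only [cubicForm]; ring

lemma homApply_linear (P Q : L[X]) (a b : L) (A : Matrix (Fin 2) (Fin 2) L) :
    homApply 3 (C a * P + C b * Q) A = C a * homApply 3 P A + C b * homApply 3 Q A := by
  simp only [homApply, coeff_add, coeff_C_mul, map_add, map_mul, Finset.sum_range_succ,
    Finset.sum_range_zero]
  ring

lemma homApply_mul [Infinite L] (P : L[X]) (A B : Matrix (Fin 2) (Fin 2) L) :
    homApply 3 (homApply 3 P A) B = homApply 3 P (A * B) := by
  refine Polynomial.funext fun z => ?_
  rw [homApply_eval, cubicForm_homApply, homApply_eval]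
  simp only [Matrix.mul_apply, Fin.sum_univ_two]
  congr 1 <;> ring

lemma conj_conj [Infinite L] (P Q : L[X]) (A B : GL (Fin 2) L) :
    conjNum 3 (conjNum 3 P Q A) (conjDen 3 P Q A) B = conjNum 3 P Q (A * B) ∧
      conjDen 3 (conjNum 3 P Q A) (conjDen 3 P Q A) B = conjDen 3 P Q (A * B) := by
  have h : ((A * B : GL (Fin 2) L) : Matrix (Fin 2) (Fin 2) L) = A * B := rfl
  have h' : (((A * B)⁻¹ : GL (Fin 2) L) : Matrix (Fin 2) (Fin 2) L)
      = ((B⁻¹ : GL (Fin 2) L) : Matrix (Fin 2) (Fin 2) L)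
        * ((A⁻¹ : GL (Fin 2) L) : Matrix (Fin 2) (Fin 2) L) := by rw [mul_inv_rev]; rfl
  constructor <;>
  · simp only [conjNum, conjDen, homApply_linear, homApply_mul, h, h', Matrix.mul_apply,
      Fin.sum_univ_two, map_add, map_mul]
    ring

/-- The change of coordinates `z ↦ x + 1 / z`. -/
def moveInfty (x : L) : GL (Fin 2) L where
  val := !![x, 1; 1, 0]
  inv := !![0, 1; 1, -x]
  val_inv := by ext i j; fin_cases i <;> fin_cases j <;> simp [Matrix.mul_apply, Fin.sum_univ_two]
  inv_val := by ext i j; fin_cases i <;> fin_cases j <;> simp [Matrix.mul_apply, Fin.sum_univ_two]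

lemma conjNum_moveInfty (P Q : L[X]) (x : L) :
    conjNum 3 P Q (moveInfty x) = homApply 3 Q !![x, 1; 1, 0] := by
  have h : ((moveInfty x : GL (Fin 2) L) : Matrix (Fin 2) (Fin 2) L) = !![x, 1; 1, 0] := rfl
  have h' : (((moveInfty x)⁻¹ : GL (Fin 2) L) : Matrix (Fin 2) (Fin 2) L) = !![0, 1; 1, -x] := rfl
  simp [conjNum, h, h']

lemma conjDen_moveInfty (P Q : L[X]) (x : L) :
    conjDen 3 P Q (moveInfty x) =
      homApply 3 P !![x, 1; 1, 0] - C x * homApply 3 Q !![x, 1; 1, 0] := by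
  have h : ((moveInfty x : GL (Fin 2) L) : Matrix (Fin 2) (Fin 2) L) = !![x, 1; 1, 0] := rfl
  have h' : (((moveInfty x)⁻¹ : GL (Fin 2) L) : Matrix (Fin 2) (Fin 2) L) = !![0, 1; 1, -x] := rfl
  simp [conjDen, h, h']
  ring

/-- The change of coordinates `z ↦ τ z + β`, represented by `k` times the standard matrix. -/
def affineGL {k τ : L} (hk : k ≠ 0) (hτ : τ ≠ 0) (β : L) : GL (Fin 2) L where
  val := !![k * τ, k * β; 0, k]
  inv := !![(k * τ)⁻¹, -β * (k * τ)⁻¹; 0, k⁻¹]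
  val_inv := by
    ext i j
    fin_cases i <;> fin_cases j <;> simp [Matrix.mul_apply, Fin.sum_univ_two] <;> field_simp
    ring
  inv_val := by
    ext i j
    fin_cases i <;> fin_cases j <;> simp [Matrix.mul_apply, Fin.sum_univ_two] <;> field_simp
    ring

lemma conjNum_affineGL_eval {k τ : L} (hk : k ≠ 0) (hτ : τ ≠ 0) (β : L) (P Q : L[X]) (z : L) :
    (conjNum 3 P Q (affineGL hk hτ β)).eval z =
      k ^ 2 / τ * (cubicForm P (τ * z + β) 1 - β * cubicForm Q (τ * z + β) 1) := by
  have h : ((affineGL hk hτ β : GL (Fin 2) L) : Matrix (Fin 2) (Fin 2) L)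
    = !![k * τ, k * β; 0, k] := rfl
  have h' : (((affineGL hk hτ β)⁻¹ : GL (Fin 2) L) : Matrix (Fin 2) (Fin 2) L)
    = !![(k * τ)⁻¹, -β * (k * τ)⁻¹; 0, k⁻¹] := rfl
  have e : k * τ * z + k * β = k * (τ * z + β) := by ring
  simp [conjNum, h, h', homApply_eval, e]
  rw [show cubicForm P (k * (τ * z + β)) k = k ^ 3 * cubicForm P (τ * z + β) 1 by
      rw [← cubicForm_mul_mul, mul_one],
    show cubicForm Q (k * (τ * z + β)) k = k ^ 3 * cubicForm Q (τ * z + β) 1 by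
      rw [← cubicForm_mul_mul, mul_one]]
  field_simp
  ring

lemma conjDen_affineGL_eval {k τ : L} (hk : k ≠ 0) (hτ : τ ≠ 0) (β : L) (P Q : L[X]) (z : L) :
    (conjDen 3 P Q (affineGL hk hτ β)).eval z = k ^ 2 * cubicForm Q (τ * z + β) 1 := by
  have h : ((affineGL hk hτ β : GL (Fin 2) L) : Matrix (Fin 2) (Fin 2) L)
    = !![k * τ, k * β; 0, k] := rfl
  have h' : (((affineGL hk hτ β)⁻¹ : GL (Fin 2) L) : Matrix (Fin 2) (Fin 2) L)
    = !![(k * τ)⁻¹, -β * (k * τ)⁻¹; 0, k⁻¹] := rfl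
  have e : k * τ * z + k * β = k * (τ * z + β) := by ring
  simp [conjDen, h, h', homApply_eval, e]
  rw [show cubicForm Q (k * (τ * z + β)) k = k ^ 3 * cubicForm Q (τ * z + β) 1 by
      rw [← cubicForm_mul_mul, mul_one]]
  field_simp

lemma cubicForm_nfNum (q b c x y : L) :
    cubicForm (nfNum q b c) x y = x ^ 3 + q * x ^ 2 * y + b * x * y ^ 2 + c * y ^ 3 := by
  simp [cubicForm, nfNum, coeff_X, coeff_C]; ring

lemma nfDen_eq (r s : L) : nfDen r s = C r * X ^ 2 - C (r * s) * X := by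
  rw [nfDen, C_mul]; ring

lemma cubicForm_nfDen (r s x y : L) :
    cubicForm (nfDen r s) x y = r * x * (x - s * y) * y := by
  simp [cubicForm, nfDen_eq, coeff_X]; ring

lemma res3_nf (r s q b c : L) :
    res3 (nfNum q b c) (nfDen r s) = r ^ 3 * c * (s ^ 3 + q * s ^ 2 + b * s + c) := by
  have : sylvester3 (nfNum q b c) (nfDen r s) =
      !![1, q, b, c, 0, 0; 0, 1, q, b, c, 0; 0, 0, 1, q, b, c; 0, r, -(r * s), 0, 0, 0;
        0, 0, r, -(r * s), 0, 0; 0, 0, 0, r, -(r * s), 0] := by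
    ext i j
    fin_cases i <;> fin_cases j <;> simp [sylvester3, nfNum, nfDen_eq, coeff_X, coeff_C]
  rw [res3, this]
  simp [Matrix.det_succ_column_zero, Fin.sum_univ_succ, Fin.succAbove]
  ring

end Conjugation

section Reduction

variable {L : Type*} [Field L]

lemma eq_cubic {P : L[X]} (hP : P.natDegree ≤ 3) :
    P = C (P.coeff 0) + C (P.coeff 1) * X + C (P.coeff 2) * X ^ 2 + C (P.coeff 3) * X ^ 3 := by
  conv_lhs => rw [P.as_sum_range' 4 (by omega)]
  simp [Finset.sum_range_succ, ← C_mul_X_pow_eq_monomial]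

lemma eval_cubic {P : L[X]} (hP : P.natDegree ≤ 3) (z : L) :
    P.eval z = P.coeff 0 + P.coeff 1 * z + P.coeff 2 * z ^ 2 + P.coeff 3 * z ^ 3 := by
  conv_lhs => rw [eq_cubic hP]
  simp

lemma eval_derivative_cubic {P : L[X]} (hP : P.natDegree ≤ 3) (z : L) :
    (derivative P).eval z = P.coeff 1 + 2 * P.coeff 2 * z + 3 * P.coeff 3 * z ^ 2 := by
  conv_lhs => rw [eq_cubic hP]
  simp
  ring

lemma noCommonZero_of_isCoprime {P Q : L[X]} (hco : IsCoprime P Q)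
    (hdeg : max P.natDegree Q.natDegree = 3) : NoCommonZero P Q := by
  intro x y h1 h2
  by_cases hy : y = 0
  · subst hy
    refine ⟨?_, rfl⟩
    by_contra hx
    simp only [cubicForm, ne_eq, OfNat.ofNat_ne_zero, not_false_eq_true, zero_pow, mul_zero,
      add_zero, zero_add, mul_eq_zero, pow_eq_zero_iff, hx, or_false] at h1 h2
    rcases max_choice P.natDegree Q.natDegree with h | h <;> rw [hdeg] at h
    · rw [h, coeff_natDegree, leadingCoeff_eq_zero] at h1
      simp [h1] at h
    · rw [h, coeff_natDegree, leadingCoeff_eq_zero] at h2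
      simp [h2] at h
  · exfalso
    have hP : P.natDegree ≤ 3 := hdeg ▸ le_max_left _ _
    have hQ : Q.natDegree ≤ 3 := hdeg ▸ le_max_right _ _
    have key : ∀ R : L[X], R.natDegree ≤ 3 → cubicForm R x y = 0 → R.eval (x / y) = 0 := by
      intro R hR h
      have e := cubicForm_mul_mul R y (x / y) 1
      rw [mul_div_cancel₀ _ hy, mul_one, h, cubicForm_one_right hR] at e
      exact (mul_eq_zero.1 e.symm).resolve_left (pow_ne_zero _ hy)
    obtain ⟨a, b, hab⟩ := hco
    simpa [key P hP h1, key Q hQ h2] using congrArg (eval (x / y)) hab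

lemma NoCommonZero.eval_ne_zero {P Q : L[X]} (h : NoCommonZero P Q) (hP : P.natDegree ≤ 3)
    (hQ : Q.natDegree ≤ 3) {z : L} (hz : P.eval z = z * Q.eval z) : Q.eval z ≠ 0 := by
  intro h0
  rw [h0, mul_zero] at hz
  exact one_ne_zero (h z 1 (by rwa [cubicForm_one_right hP]) (by rwa [cubicForm_one_right hQ])).2

lemma conj_one [Infinite L] {P Q : L[X]} (hP : P.natDegree ≤ 3) (hQ : Q.natDegree ≤ 3) :
    conjNum 3 P Q 1 = P ∧ conjDen 3 P Q 1 = Q := by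
  have key : ∀ R : L[X], R.natDegree ≤ 3 → homApply 3 R 1 = R := by
    intro R hR
    refine Polynomial.funext fun z => ?_
    simp [homApply_eval, cubicForm_one_right hR]
  simp [conjNum, conjDen, key P hP, key Q hQ]

variable [IsAlgClosed L]

lemma NoCommonZero.exists_not_fixed {P Q : L[X]} (h : NoCommonZero P Q) (hP : P.natDegree ≤ 3)
    (hQ : Q.natDegree ≤ 3) : ∃ x : L, P.eval x ≠ x * Q.eval x := by
  have : Infinite L := IsAlgClosed.instInfinite
  by_contra! hn
  by_cases hd : Q.degree = 0
  · obtain ⟨q, rfl⟩ : ∃ q, Q = C q := ⟨_, eq_C_of_degree_eq_zero hd⟩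
    have hPQ : P = X * C q := Polynomial.funext fun x => by rw [hn x, eval_mul, eval_X]
    refine one_ne_zero (h 1 0 ?_ ?_).1
    · simp [cubicForm, hPQ, coeff_X]
    · simp [cubicForm, coeff_C]
  · obtain ⟨z, hz⟩ := IsAlgClosed.exists_root Q hd
    exact h.eval_ne_zero hP hQ (hn z) hz

lemma exists_quartic_roots (h2 : (2 : L) ≠ 0) (a b c d : L) :
    ∃ w x y z : L, ∀ t, t ^ 4 + a * t ^ 3 + b * t ^ 2 + c * t + d
      = (t - w) * (t - x) * (t - y) * (t - z) := by
  obtain ⟨w, hw⟩ := IsAlgClosed.exists_root (X ^ 4 + C a * X ^ 3 + C b * X ^ 2 + C c * X + C d) (by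
    have : (X ^ 4 + C a * X ^ 3 + C b * X ^ 2 + C c * X + C d : L[X]).degree = 4 := by
      compute_degree!
    rw [this]; decide)
  simp only [IsRoot.def, eval_add, eval_mul, eval_pow, eval_X, eval_C] at hw
  obtain ⟨x, y, z, h1, h3, h4⟩ := exists_cubic_roots h2 (a + w) (b + w * (a + w))
    (c + w * (b + w * (a + w)))
  refine ⟨w, x, y, z, fun t => ?_⟩
  linear_combination hw + (t - w) * (t ^ 2 * h1 + t * h3 + h4)

/-- A cubic map fixing `∞` and unramified there is conjugate to a map in normal form. -/
lemma exists_conj_eq_nf (h2 : (2 : L) ≠ 0) {P Q : L[X]} (hP : P.natDegree ≤ 3)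
    (hQ : Q.natDegree ≤ 3) (hQ3 : Q.coeff 3 = 0) (hP3 : P.coeff 3 ≠ 0) (hQ2 : Q.coeff 2 ≠ 0) :
    ∃ (A : GL (Fin 2) L) (q b c s : L), conjNum 3 P Q A = nfNum q b c ∧
      conjDen 3 P Q A = nfDen (Q.coeff 2 / P.coeff 3) s := by
  have : Infinite L := IsAlgClosed.instInfinite
  obtain ⟨k, hk⟩ := IsAlgClosed.exists_pow_nat_eq (P.coeff 3)⁻¹ (n := 2) two_pos
  have hk0 : k ≠ 0 := by
    rintro rfl
    exact inv_ne_zero hP3 (by rw [← hk]; ring)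
  obtain ⟨β, γ, h1, h3⟩ := exists_quadratic_roots h2 (Q.coeff 1 / Q.coeff 2)
    (Q.coeff 0 / Q.coeff 2)
  rw [div_eq_iff hQ2] at h1 h3
  refine ⟨affineGL hk0 one_ne_zero β,
    (P.coeff 2 + 3 * P.coeff 3 * β - β * Q.coeff 2) / P.coeff 3,
    (P.coeff 1 + 2 * P.coeff 2 * β + 3 * P.coeff 3 * β ^ 2
      - β * (Q.coeff 1 + 2 * Q.coeff 2 * β)) / P.coeff 3,
    (P.eval β - β * Q.eval β) / P.coeff 3, γ - β, ?_, ?_⟩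
  · refine Polynomial.funext fun z => ?_
    rw [conjNum_affineGL_eval, hk, nfNum_eval, eval_cubic hP, eval_cubic hQ]
    simp only [cubicForm, hQ3]
    field_simp
    ring
  · refine Polynomial.funext fun z => ?_
    rw [conjDen_affineGL_eval, hk, nfDen_eval]
    simp only [cubicForm, hQ3, h1, h3]
    field_simp
    ring

end Reduction

section FixedPoint

variable {L : Type*} [NontriviallyNormedField L] [IsUltrametricDist L]

lemma exists_norm_two_mul_inv_sub_lt (h2 : ‖(2 : L)‖ = 1) {l : L}
    (h : ‖l‖ < 1 ∨ ‖1 + l‖ < 1) :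
    1 - l ≠ 0 ∧ ∃ n : ℕ, 1 ≤ n ∧ n ≤ 2 ∧ ‖2 * (1 - l)⁻¹ - n‖ < 1 := by
  have h1 : ‖1 - l‖ = 1 := by
    rcases h with h | h
    · exact um_norm_eq norm_one (by simpa using h)
    · exact um_norm_eq (y := 2) h2 (by
        rw [show 1 - l - 2 = -(1 + l) by ring, norm_neg]; exact h)
  have h0 : 1 - l ≠ 0 := by rw [← norm_ne_zero_iff, h1]; exact one_ne_zero
  refine ⟨h0, ?_⟩
  rcases h with h | h
  · refine ⟨2, by norm_num, le_rfl, ?_⟩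
    rw [show 2 * (1 - l)⁻¹ - (2 : ℕ) = 2 * l / (1 - l) by push_cast; field_simp; ring, norm_div,
      norm_mul, h1, h2]
    simpa using h
  · refine ⟨1, le_rfl, by norm_num, ?_⟩
    rw [show 2 * (1 - l)⁻¹ - (1 : ℕ) = (1 + l) / (1 - l) by push_cast; field_simp; ring,
      norm_div, h1]
    simpa using h

/-- A cubic map not fixing `∞` has a fixed point whose multiplier `l` is repelling, or else
satisfies `‖l‖ = ‖1 + l‖ = 1`. -/
lemma NoCommonZero.exists_fixed_point [IsAlgClosed L]
    (hres : ∀ n : ℕ, n ≠ 0 → ‖(n : L)‖ = 1) {P Q : L[X]} (h : NoCommonZero P Q)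
    (hP : P.natDegree ≤ 3) (hQ : Q.natDegree ≤ 3) (hQ3 : Q.coeff 3 ≠ 0) :
    ∃ z, P.eval z = z * Q.eval z ∧
      (1 < ‖ratDeriv P Q z‖ ∨ (‖ratDeriv P Q z‖ = 1 ∧ ‖1 + ratDeriv P Q z‖ = 1)) := by
  have : Infinite L := IsAlgClosed.instInfinite
  have h2 : ‖(2 : L)‖ = 1 := by exact_mod_cast hres 2 two_ne_zero
  have h20 : (2 : L) ≠ 0 := by rw [← norm_ne_zero_iff, h2]; exact one_ne_zero
  by_contra! hn
  have hfix : ∀ z, P.eval z = z * Q.eval z →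
      (derivative (X * Q - P)).eval z = Q.eval z * (1 - ratDeriv P Q z) := by
    intro z hz
    have := h.eval_ne_zero hP hQ hz
    simp only [ratDeriv, hz, derivative_sub, derivative_mul, derivative_X, eval_sub, eval_add,
      eval_mul, eval_one, eval_X]
    field_simp
    ring
  have hmul : ∀ z, P.eval z = z * Q.eval z → ‖ratDeriv P Q z‖ < 1 ∨ ‖1 + ratDeriv P Q z‖ < 1 := by
    intro z hz
    obtain ⟨h1, h3⟩ := hn z hz
    rcases h1.eq_or_lt with h1 | h1
    · exact Or.inr (lt_of_le_of_ne (um_add_le norm_one.le h1.le) (h3 h1))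
    · exact Or.inl h1
  obtain ⟨w, x, y, z, hF⟩ := exists_quartic_roots h20 ((Q.coeff 2 - P.coeff 3) / Q.coeff 3)
    ((Q.coeff 1 - P.coeff 2) / Q.coeff 3) ((Q.coeff 0 - P.coeff 1) / Q.coeff 3)
    (-P.coeff 0 / Q.coeff 3)
  have hF' : X * Q - P = C (Q.coeff 3) * ((X - C w) * (X - C x) * (X - C y) * (X - C z)) := by
    refine Polynomial.funext fun t => ?_
    simp only [eval_mul, eval_sub, eval_X, eval_C]
    rw [← hF, eval_cubic hP, eval_cubic hQ]
    field_simp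
    ring
  have hroot : ∀ t, (t - w) * (t - x) * (t - y) * (t - z) = 0 → P.eval t = t * Q.eval t := by
    intro t ht
    have := congrArg (eval t) hF'
    simp only [eval_mul, eval_sub, eval_X, eval_C, ht, mul_zero] at this
    linear_combination -this
  have hroot' : ∀ t, (t - w) * (t - x) * (t - y) * (t - z) = 0 → ∀ D,
      (derivative ((X - C w) * (X - C x) * (X - C y) * (X - C z))).eval t = D →
      D ≠ 0 ∧ ∃ n : ℕ, 1 ≤ n ∧ n ≤ 2 ∧ ‖2 * (Q.eval t / (Q.coeff 3 * D)) - n‖ < 1 := by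
    intro t ht D hD
    have e := hfix t (hroot t ht)
    rw [hF', derivative_C_mul, eval_C_mul, hD] at e
    have hq := h.eval_ne_zero hP hQ (hroot t ht)
    obtain ⟨h0, n, h1, h3, h4⟩ := exists_norm_two_mul_inv_sub_lt h2 (hmul t (hroot t ht))
    refine ⟨fun hD0 => mul_ne_zero hq h0 (by rw [← e, hD0, mul_zero]), n, h1, h3, ?_⟩
    rw [e, div_mul_cancel_left₀ hq]
    exact h4
  obtain ⟨dw, nw, aw, bw, cw⟩ := hroot' w (by ring) ((w - x) * (w - y) * (w - z)) (by
    simp [derivative_mul])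
  obtain ⟨dx, nx, ax, bx, cx⟩ := hroot' x (by ring) ((x - w) * (x - y) * (x - z)) (by
    simp [derivative_mul])
  obtain ⟨dy, ny, ay, b_y, cy⟩ := hroot' y (by ring) ((y - w) * (y - x) * (y - z)) (by
    simp [derivative_mul])
  obtain ⟨dz, nz, az, bz, cz⟩ := hroot' z (by ring) ((z - w) * (z - x) * (z - y)) (by
    simp [derivative_mul])
  have hsum : Q.eval w / (Q.coeff 3 * ((w - x) * (w - y) * (w - z)))
      + Q.eval x / (Q.coeff 3 * ((x - w) * (x - y) * (x - z)))
      + Q.eval y / (Q.coeff 3 * ((y - w) * (y - x) * (y - z)))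
      + Q.eval z / (Q.coeff 3 * ((z - w) * (z - x) * (z - y))) = 1 := by
    simp only [mul_ne_zero_iff] at dw dx dy dz
    obtain ⟨⟨h1, h3⟩, h4⟩ := dw
    obtain ⟨⟨-, h5⟩, h6⟩ := dx
    have h7 := dy.2
    rw [show x - w = -(w - x) by ring, show y - w = -(w - y) by ring,
      show y - x = -(x - y) by ring, show z - w = -(w - z) by ring,
      show z - x = -(x - z) by ring, show z - y = -(y - z) by ring]
    simp only [eval_cubic hQ]
    field_simp
    ring
  have hlt := um_add_lt (um_add_lt (um_add_lt cw cx) cy) cz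
  obtain ⟨m, hm⟩ : ∃ m, nw + nx + ny + nz = m + 1 + 2 := ⟨nw + nx + ny + nz - 3, by omega⟩
  have hm' : (nw : L) + nx + ny + nz = m + 1 + 2 := by
    exact_mod_cast congrArg (Nat.cast : ℕ → L) hm
  have e : ∀ u v s t : L, 2 * u - nw + (2 * v - nx) + (2 * s - ny) + (2 * t - nz)
      = 2 * (u + v + s + t) - (nw + nx + ny + nz) := by intros; ring
  rw [e, hsum, hm', show 2 * 1 - ((m : L) + 1 + 2) = -((m + 1 : ℕ) : L) by push_cast; ring,
    norm_neg, hres _ m.succ_ne_zero] at hlt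
  exact lt_irrefl _ hlt

end FixedPoint

section Dichotomy

variable {L : Type*} [NontriviallyNormedField L]

/-- Some conjugate of `P / Q` has good reduction, or a repelling cycle of period at most `3`. -/
def HasGoodOrRepellingConj (P Q : L[X]) : Prop :=
  ∃ A : GL (Fin 2) L,
    ((∀ i : ℕ, ‖(conjNum 3 P Q A).coeff i‖ ≤ 1) ∧ (∀ i : ℕ, ‖(conjDen 3 P Q A).coeff i‖ ≤ 1) ∧
      ‖res3 (conjNum 3 P Q A) (conjDen 3 P Q A)‖ = 1) ∨
    HasShortRepellingCycle
      (fun z => (conjNum 3 P Q A).eval z / (conjDen 3 P Q A).eval z)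
      {z | (conjDen 3 P Q A).eval z ≠ 0} (ratDeriv (conjNum 3 P Q A) (conjDen 3 P Q A))

lemma HasGoodOrRepellingConj.of_conj {P Q : L[X]} {A : GL (Fin 2) L}
    (h : HasGoodOrRepellingConj (conjNum 3 P Q A) (conjDen 3 P Q A)) :
    HasGoodOrRepellingConj P Q := by
  obtain ⟨B, hB⟩ := h
  rw [(conj_conj P Q A B).1, (conj_conj P Q A B).2] at hB
  exact ⟨A * B, hB⟩

lemma hasGoodOrRepellingConj_of_good {P Q : L[X]} (hP : P.natDegree ≤ 3) (hQ : Q.natDegree ≤ 3)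
    (h1 : ∀ i : ℕ, ‖P.coeff i‖ ≤ 1) (h2 : ∀ i : ℕ, ‖Q.coeff i‖ ≤ 1) (h3 : ‖res3 P Q‖ = 1) :
    HasGoodOrRepellingConj P Q := by
  refine ⟨1, Or.inl ?_⟩
  rw [(conj_one hP hQ).1, (conj_one hP hQ).2]
  exact ⟨h1, h2, h3⟩

lemma hasGoodOrRepellingConj_of_cycle {P Q : L[X]} (hP : P.natDegree ≤ 3) (hQ : Q.natDegree ≤ 3)
    (h : HasShortRepellingCycle (fun z => P.eval z / Q.eval z) {z | Q.eval z ≠ 0}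
      (ratDeriv P Q)) : HasGoodOrRepellingConj P Q := by
  refine ⟨1, Or.inr ?_⟩
  rw [(conj_one hP hQ).1, (conj_one hP hQ).2]
  exact h

lemma nfNum_natDegree_le (q b c : L) : (nfNum q b c).natDegree ≤ 3 := by
  rw [nfNum]; compute_degree

lemma nfDen_natDegree_le (r s : L) : (nfDen r s).natDegree ≤ 3 := by
  rw [nfDen_eq]; compute_degree; norm_num

variable [IsUltrametricDist L] [IsAlgClosed L] [CompleteSpace L]

lemma nf_good_or_repelling_of_normalized (h2 : ‖(2 : L)‖ = 1) (h3 : ‖(3 : L)‖ = 1)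
    {r s q b c : L} (hr : ‖r‖ = 1) (hr1 : ‖1 + r‖ = 1) (hq : ‖q‖ ≤ 1) (hs : ‖s‖ ≤ 1)
    (hb : ‖b‖ ≤ 1) (hc : ‖c‖ ≤ 1) (hc0 : c ≠ 0) (hNs : s ^ 3 + q * s ^ 2 + b * s + c ≠ 0)
    (h : ‖q‖ = 1 ∨ ‖s‖ = 1 ∨ ‖b‖ = 1 ∨ ‖c‖ = 1) :
    HasGoodOrRepellingConj (nfNum q b c) (nfDen r s) := by
  have hsq : ‖s ^ 2‖ ≤ 1 := by rw [norm_pow]; exact pow_le_one₀ (norm_nonneg _) hs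
  have hmul : ∀ {x y : L}, ‖x‖ ≤ 1 → ‖y‖ ≤ 1 → ‖x * y‖ ≤ 1 := fun hx hy => by
    simpa using norm_mul_le_mul hx hy
  rcases hc.lt_or_eq with hc | hc
  · exact hasGoodOrRepellingConj_of_cycle (nfNum_natDegree_le _ _ _) (nfDen_natDegree_le _ _)
      (nfMap_cycle h2 h3 hr hr1 hq hs hb hc hc0 hNs
        (by rcases h with h | h | h | h <;> first | (exact absurd h hc.ne) | simp [h]))
  have hlow : ‖s ^ 3 + q * s ^ 2 + b * s‖ ≤ 1 := by
    refine um_add_le (um_add_le ?_ (hmul hq hsq)) (hmul hb hs)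
    rw [norm_pow]; exact pow_le_one₀ (norm_nonneg _) hs
  rcases (um_add_le hlow hc.le).lt_or_eq with hN | hN
  · have hs1 : ‖s‖ = 1 := by
      refine le_antisymm hs ?_
      by_contra! hs1
      have : ‖s ^ 3 + q * s ^ 2 + b * s‖ < 1 := by
        rw [show s ^ 3 + q * s ^ 2 + b * s = s * (s ^ 2 + q * s + b) by ring]
        exact norm_mul_lt_one hs1 (um_add_le (um_add_le hsq (hmul hq hs)) hb)
      have := um_sub_lt hN this
      rw [add_sub_cancel_left] at this
      exact this.ne hc
    have hconj : conjNum 3 (nfNum q b c) (nfDen r s) (affineGL one_ne_zero one_ne_zero s)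
          = nfNum (q + 3 * s - r * s) (3 * s ^ 2 + 2 * q * s + b - r * s ^ 2)
            (s ^ 3 + q * s ^ 2 + b * s + c) ∧
        conjDen 3 (nfNum q b c) (nfDen r s) (affineGL one_ne_zero one_ne_zero s)
          = nfDen r (-s) := by
      constructor <;> refine Polynomial.funext fun z => ?_
      · rw [conjNum_affineGL_eval, nfNum_eval, cubicForm_nfNum, cubicForm_nfDen]; ring
      · rw [conjDen_affineGL_eval, nfDen_eval, cubicForm_nfDen]; ring
    refine HasGoodOrRepellingConj.of_conj (A := affineGL one_ne_zero one_ne_zero s) ?_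
    rw [hconj.1, hconj.2]
    refine hasGoodOrRepellingConj_of_cycle (nfNum_natDegree_le _ _ _) (nfDen_natDegree_le _ _)
      (nfMap_cycle h2 h3 hr hr1 ?_ ?_ ?_ hN hNs ?_ (Or.inr (Or.inl (by rwa [norm_neg]))))
    · exact um_sub_le (um_add_le hq (hmul h3.le hs)) (hmul hr.le hs)
    · rwa [norm_neg]
    · exact um_sub_le (um_add_le (um_add_le (hmul h3.le hsq) (hmul (hmul h2.le hq) hs)) hb)
        (hmul hr.le hsq)
    · convert hc0 using 1; ring
  · refine hasGoodOrRepellingConj_of_good (nfNum_natDegree_le _ _ _) (nfDen_natDegree_le _ _)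
      (fun i => ?_) (fun i => ?_) ?_
    · rcases lt_or_ge 3 i with hi | hi
      · simp [coeff_eq_zero_of_natDegree_lt ((nfNum_natDegree_le q b c).trans_lt hi)]
      · interval_cases i <;> simp [nfNum, coeff_X, coeff_C, hq, hb, hc.le]
    · rcases lt_or_ge 3 i with hi | hi
      · simp [coeff_eq_zero_of_natDegree_lt ((nfDen_natDegree_le r s).trans_lt hi)]
      · interval_cases i <;> simp [nfDen_eq, coeff_X, coeff_C, hr, hs]
    · rw [res3_nf, norm_mul, norm_mul, norm_pow, hr, hc, hN]; norm_num

lemma nf_good_or_repelling (h2 : ‖(2 : L)‖ = 1) (h3 : ‖(3 : L)‖ = 1) {r s q b c : L}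
    (hr : ‖r‖ = 1) (hr1 : ‖1 + r‖ = 1) (hc0 : c ≠ 0) (hNs : s ^ 3 + q * s ^ 2 + b * s + c ≠ 0) :
    HasGoodOrRepellingConj (nfNum q b c) (nfDen r s) := by
  classical
  obtain ⟨β, rfl⟩ := IsAlgClosed.exists_pow_nat_eq b (n := 2) two_pos
  obtain ⟨γ, rfl⟩ := IsAlgClosed.exists_pow_nat_eq c (n := 3) three_pos
  obtain ⟨τ, hτ, hmax⟩ := Finset.exists_max_image ({q, s, β, γ} : Finset L) (‖·‖) (by simp)
  simp only [Finset.mem_insert, Finset.mem_singleton, forall_eq_or_imp, forall_eq] at hτ hmax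
  obtain ⟨hq, hs, hβ, hγ⟩ := hmax
  have hγ0 : γ ≠ 0 := fun h => hc0 (by rw [h]; ring)
  have hτpos : 0 < ‖τ‖ := (norm_pos_iff.2 hγ0).trans_le hγ
  have hτ0 : τ ≠ 0 := norm_pos_iff.1 hτpos
  have hdiv : ∀ {x : L}, ‖x‖ ≤ ‖τ‖ → ‖x / τ‖ ≤ 1 := fun h => by
    rw [norm_div]; exact div_le_one_of_le₀ h (norm_nonneg _)
  have hconj : conjNum 3 (nfNum q (β ^ 2) (γ ^ 3)) (nfDen r s) (affineGL (inv_ne_zero hτ0) hτ0 0)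
        = nfNum (q / τ) ((β / τ) ^ 2) ((γ / τ) ^ 3) ∧
      conjDen 3 (nfNum q (β ^ 2) (γ ^ 3)) (nfDen r s) (affineGL (inv_ne_zero hτ0) hτ0 0)
        = nfDen r (s / τ) := by
    constructor <;> refine Polynomial.funext fun z => ?_
    · rw [conjNum_affineGL_eval, nfNum_eval, cubicForm_nfNum, cubicForm_nfDen]
      field_simp
      ring
    · rw [conjDen_affineGL_eval, nfDen_eval, cubicForm_nfDen]
      field_simp
      ring
  refine HasGoodOrRepellingConj.of_conj (A := affineGL (inv_ne_zero hτ0) hτ0 0) ?_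
  rw [hconj.1, hconj.2]
  refine nf_good_or_repelling_of_normalized h2 h3 hr hr1 (hdiv hq) (hdiv hs) ?_ ?_ ?_ ?_ ?_
  · rw [norm_pow]; exact pow_le_one₀ (norm_nonneg _) (hdiv hβ)
  · rw [norm_pow]; exact pow_le_one₀ (norm_nonneg _) (hdiv hγ)
  · exact pow_ne_zero _ (div_ne_zero hγ0 hτ0)
  · rw [show (s / τ) ^ 3 + q / τ * (s / τ) ^ 2 + (β / τ) ^ 2 * (s / τ) + (γ / τ) ^ 3
      = (s ^ 3 + q * s ^ 2 + β ^ 2 * s + γ ^ 3) / τ ^ 3 by field_simp]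
    exact div_ne_zero hNs (pow_ne_zero _ hτ0)
  · rcases hτ with rfl | rfl | rfl | rfl <;> simp [div_self hτ0]

/-- A cubic rational map has potential good reduction, or a repelling cycle of period at most
`3`. -/
theorem NoCommonZero.hasGoodOrRepellingConj (hres : ∀ n : ℕ, n ≠ 0 → ‖(n : L)‖ = 1) {P Q : L[X]}
    (h : NoCommonZero P Q) (hP : P.natDegree ≤ 3) (hQ : Q.natDegree ≤ 3) :
    HasGoodOrRepellingConj P Q := by
  have h2 : ‖(2 : L)‖ = 1 := by exact_mod_cast hres 2 two_ne_zero
  have h3 : ‖(3 : L)‖ = 1 := by exact_mod_cast hres 3 three_ne_zero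
  wlog hQ3 : Q.coeff 3 ≠ 0 generalizing P Q
  · obtain ⟨x, hx⟩ := h.exists_not_fixed hP hQ
    refine HasGoodOrRepellingConj.of_conj (A := moveInfty x)
      (this (h.conj _) (conjNum_natDegree_le _ _ _) (conjDen_natDegree_le _ _ _) ?_)
    rw [conjDen_moveInfty, coeff_sub, coeff_C_mul, homApply_coeff_three, homApply_coeff_three]
    simpa [cubicForm_one_right hP, cubicForm_one_right hQ, sub_eq_zero] using hx
  obtain ⟨z, hz, hl⟩ := h.exists_fixed_point hres hP hQ hQ3
  have hQz := h.eval_ne_zero hP hQ hz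
  rcases hl with hl | ⟨hl, hl1⟩
  · refine hasGoodOrRepellingConj_of_cycle hP hQ ⟨1, Or.inl rfl, z, ?_, ?_, by simpa using hl⟩
    · intro i hi
      obtain rfl : i = 0 := by omega
      exact hQz
    · rw [Function.iterate_one, hz, mul_div_cancel_right₀ _ hQz]
  refine HasGoodOrRepellingConj.of_conj (A := moveInfty z) ?_
  have hnc := h.conj (moveInfty z)
  have hP' := conjNum_natDegree_le P Q (moveInfty z)
  have hQ' := conjDen_natDegree_le P Q (moveInfty z)
  have c1 : (conjNum 3 P Q (moveInfty z)).coeff 3 = Q.eval z := by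
    rw [conjNum_moveInfty, homApply_coeff_three]
    simp [cubicForm_one_right hQ]
  have c2 : (conjDen 3 P Q (moveInfty z)).coeff 3 = 0 := by
    rw [conjDen_moveInfty, coeff_sub, coeff_C_mul, homApply_coeff_three, homApply_coeff_three]
    simp [cubicForm_one_right hP, cubicForm_one_right hQ, hz]
  have c3 : (conjDen 3 P Q (moveInfty z)).coeff 2 = ratDeriv P Q z * Q.eval z := by
    rw [conjDen_moveInfty, coeff_sub, coeff_C_mul, homApply_coeff_two, homApply_coeff_two,
      ratDeriv, hz, eval_derivative_cubic hP, eval_derivative_cubic hQ]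
    simp
    field_simp
  have hl0 : ratDeriv P Q z ≠ 0 := by rw [← norm_ne_zero_iff, hl]; exact one_ne_zero
  obtain ⟨A, q, b, c, s, hA, hA'⟩ := exists_conj_eq_nf
    (norm_ne_zero_iff.1 (by rw [h2]; exact one_ne_zero)) hP' hQ' c2 (by rwa [c1])
    (by rw [c3]; exact mul_ne_zero hl0 hQz)
  rw [c1, c3, mul_div_cancel_right₀ _ hQz] at hA'
  refine HasGoodOrRepellingConj.of_conj (A := A) ?_
  have hnc' := hnc.conj A
  rw [hA, hA'] at hnc' ⊢
  refine nf_good_or_repelling h2 h3 hl hl1 ?_ ?_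
  · intro hc
    have := (hnc' 0 1 (by simp [cubicForm_nfNum, hc]) (by simp [cubicForm_nfDen])).2
    exact one_ne_zero this
  · intro hN
    have := (hnc' s 1 (by simpa [cubicForm_nfNum] using hN) (by simp [cubicForm_nfDen])).2
    exact one_ne_zero this

end Dichotomy

/-- **Existence of a repelling cycle of period ≤ 3 for cubic rational maps without potential
good reduction.**  Let `K` be an algebraically closed field, complete with respect to a
nontrivial non-Archimedean absolute value, with residue field of characteristic `0` (encoded
by `‖n‖ = 1` for every nonzero natural number `n`).  If a rational map `f = P/Q` of degree `3`
over `K` has no conjugate `f^A`, `A ∈ GL₂(K)`, whose homogeneous representation has all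
coefficients in the valuation ring and resultant of absolute value `1`, then `f` has a
repelling periodic point of period at most `3`. -/
theorem stmt7 {K : Type*} [NontriviallyNormedField K] [CompleteSpace K] [IsAlgClosed K]
    (hna : IsNonarchimedean (fun x : K => ‖x‖))
    (hres : ∀ n : ℕ, n ≠ 0 → ‖(n : K)‖ = 1)
    (P Q : Polynomial K) (hco : IsCoprime P Q) (hdeg : max P.natDegree Q.natDegree = 3)
    (hpgr : ¬ ∃ A : GL (Fin 2) K,
      (∀ i : ℕ, ‖(conjNum 3 P Q A).coeff i‖ ≤ 1) ∧
      (∀ i : ℕ, ‖(conjDen 3 P Q A).coeff i‖ ≤ 1) ∧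
      ‖res3 (conjNum 3 P Q A) (conjDen 3 P Q A)‖ = 1) :
    ∃ n : ℕ, (n = 1 ∨ n = 2 ∨ n = 3) ∧ ∃ A : GL (Fin 2) K, ∃ z : K,
      (∀ i < n, (conjDen 3 P Q A).eval ((cg 3 P Q A)^[i] z) ≠ 0) ∧
      (cg 3 P Q A)^[n] z = z ∧
      1 < ∏ i ∈ Finset.range n,
        ‖ratDeriv (conjNum 3 P Q A) (conjDen 3 P Q A) ((cg 3 P Q A)^[i] z)‖ := by
  have : IsUltrametricDist K := IsUltrametricDist.isUltrametricDist_of_isNonarchimedean_norm hna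
  obtain ⟨A, hA | ⟨n, hn, z, h1, h2, h3⟩⟩ :=
    (noCommonZero_of_isCoprime hco hdeg).hasGoodOrRepellingConj hres
      (hdeg ▸ le_max_left _ _) (hdeg ▸ le_max_right _ _)
  · exact absurd ⟨A, hA⟩ hpgr
  · exact ⟨n, hn, A, z, h1, h2, h3⟩
end
end

section
/- Let n ≥ 2 and m ≥ 1 be integers, and for 1 ≤ i ≤ m let μᵢ⁺ and μᵢ⁻ be integers satisfying μᵢ⁺ ≥ 2 and μᵢ⁺ ≥ μᵢ⁻ ≥ 1. If Σ_{i=1}^m (μᵢ⁺ + μᵢ⁻ − 2) ≤ n − 1, then Σ_{i=1}^m μᵢ⁺ μᵢ⁻ < 2n(n−1). -/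
/-- **Combinatorial inequality for local degrees along type II 2-cycles.**
If `n ≥ 2`, `m ≥ 1`, and `μᵢ⁺ ≥ 2`, `μᵢ⁺ ≥ μᵢ⁻ ≥ 1` are integers with
`Σ (μᵢ⁺ + μᵢ⁻ − 2) ≤ n − 1`, then `Σ μᵢ⁺ μᵢ⁻ < 2n(n−1)`. -/
theorem stmt12 (n m : ℕ) (hn : 2 ≤ n) (hm : 1 ≤ m) (μp μm : Fin m → ℤ)
    (h2 : ∀ i, 2 ≤ μp i) (h1 : ∀ i, 1 ≤ μm i) (hpm : ∀ i, μm i ≤ μp i)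
    (hsum : ∑ i, (μp i + μm i - 2) ≤ (n : ℤ) - 1) :
    ∑ i, μp i * μm i < 2 * (n : ℤ) * ((n : ℤ) - 1) := by
  have hs : ∀ i, 1 ≤ μp i + μm i - 2 := fun i => by linarith [h2 i, h1 i]
  have hle : ∀ i, μp i + μm i - 2 ≤ (n : ℤ) - 1 := fun i =>
    (Finset.single_le_sum (f := fun j => μp j + μm j - 2)
      (fun j _ => zero_le_one.trans (hs j)) (Finset.mem_univ i)).trans hsum
  have hterm : ∀ i, μp i * μm i < 2 * (n : ℤ) * (μp i + μm i - 2) := by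
    intro i
    nlinarith [sq_nonneg (μp i - μm i), hs i, hle i,
      mul_nonneg (zero_le_one.trans (hs i)) (sub_nonneg.2 (hle i)),
      mul_nonneg (sub_nonneg.2 (hs i)) (sub_nonneg.2 (hs i))]
  calc ∑ i, μp i * μm i < ∑ i, 2 * (n : ℤ) * (μp i + μm i - 2) :=
        Finset.sum_lt_sum_of_nonempty ⟨⟨0, hm⟩, Finset.mem_univ _⟩ fun i _ => hterm i
    _ = 2 * (n : ℤ) * ∑ i, (μp i + μm i - 2) := by rw [Finset.mul_sum]
    _ ≤ 2 * (n : ℤ) * ((n : ℤ) - 1) := mul_le_mul_of_nonneg_left hsum (by positivity)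
end
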